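/- Let h ≥ 2 be an integer and for x > 1 let T_h(x) denote the number of h-tuples (a_0, a_1, …, a_{h−1}) of nonzero ideals of O_K with N(a_0)^h · N(a_1)^{h+1} ⋯ N(a_{h−1})^{2h−1} ≤ x. Then T_h(x) = κ (∏_{i=1}^{h−1} ζ_K(1 + i/h)) x^{1/h} + O_h(R_{T_h}(x)), where the implied constant depends only on h and K, and R_{T_h}(x) = x^{(1/h)(1 − 2/(n_K+1))} if h/(h+1) < 1 − 2/(n_K+1); R_{T_h}(x) = x^{(1/h)(1 − 2/(n_K+1))} log x if h/(h+1) = 1 − 2/(n_K+1); R_{T_h}(x) = x^{1/(h+1)} if h/(h+1) > 1 − 2/(n_K+1). -/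

import Mathlib

open Filter Topology
open scoped BigOperators

noncomputable section

variable (K : Type) [Field K] [NumberField K]

/-- The residue `κ` of the Dedekind zeta function of `K` at `s = 1`. -/
def kappa : ℝ :=
  (2 ^ NumberField.InfinitePlace.nrRealPlaces K *
      (2 * Real.pi) ^ NumberField.InfinitePlace.nrComplexPlaces K *
      (NumberField.classNumber K) * NumberField.Units.regulator K) /
    ((NumberField.Units.torsionOrder K) * Real.sqrt |(NumberField.discr K : ℝ)|)

/-- The Dedekind zeta function of `K` at a real argument, as a sum over nonzero ideals. -/
def zetaKR (s : ℝ) : ℝ :=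
  ∑' m : {m : Ideal (NumberField.RingOfIntegers K) // m ≠ 0},
    ((Ideal.absNorm m.1 : ℝ)) ^ (-s)

/-- The number of `h`-tuples `(a_0, …, a_{h-1})` of nonzero ideals with
`N(a_0)^h N(a_1)^{h+1} ⋯ N(a_{h-1})^{2h-1} ≤ x`. -/
def Th (h : ℕ) (x : ℝ) : ℕ :=
  Nat.card {a : Fin h → Ideal (NumberField.RingOfIntegers K) //
    (∀ i, a i ≠ 0) ∧
      (∏ i : Fin h, (Ideal.absNorm (a i) : ℝ) ^ (h + (i : ℕ))) ≤ x}

/-- The error term `R_{T_h}`. -/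
def RTh (h : ℕ) (x : ℝ) : ℝ :=
  if (h : ℝ)/(h + 1) < 1 - 2/((Module.finrank ℚ K : ℝ) + 1) then
    x ^ (((1 : ℝ)/h) * (1 - 2/((Module.finrank ℚ K : ℝ) + 1)))
  else if (h : ℝ)/(h + 1) = 1 - 2/((Module.finrank ℚ K : ℝ) + 1) then
    x ^ (((1 : ℝ)/h) * (1 - 2/((Module.finrank ℚ K : ℝ) + 1))) * Real.log x
  else x ^ ((1 : ℝ)/(h + 1))

section
open Filter Topology MeasureTheory Set
open scoped BigOperators

namespace Landau

/-- Terms of the Gudermann series. -/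
noncomputable def gt (s : ℂ) : ℂ := (s + 1/2) * (Complex.log (s + 1) - Complex.log s) - 1

lemma log_add_one_sub {s : ℂ} (hs : 0 < s.re) :
    Complex.log (s + 1) - Complex.log s = Complex.log (1 + 1 / s) := by
  have hs0 : s ≠ 0 := fun h => by simp [h] at hs
  have hre : 0 < (1 + 1/s).re := by
    rw [Complex.add_re, Complex.one_re, one_div, Complex.inv_re]
    have : 0 < Complex.normSq s := Complex.normSq_pos.mpr hs0
    positivity
  have hs1 : 1 + 1 / s ≠ 0 := fun h => by rw [h] at hre; simp at hre
  have e : s + 1 = s * (1 + 1/s) := by field_simp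
  have a1 := abs_lt.mp (Complex.abs_arg_lt_pi_div_two_iff.mpr (Or.inl hs))
  have a2 := abs_lt.mp (Complex.abs_arg_lt_pi_div_two_iff.mpr (Or.inl hre))
  rw [e, Complex.log_mul hs0 hs1 ⟨by linarith [a1.1, a2.1], by linarith [a1.2, a2.2]⟩]
  ring

lemma norm_gt_le {s : ℂ} (hs : 0 < s.re) (h2 : 2 ≤ ‖s‖) : ‖gt s‖ ≤ 2 / ‖s‖ ^ 2 := by
  have hs0 : s ≠ 0 := fun h => by simp [h] at hs
  set z := 1 / s with hz
  have hzn : ‖z‖ = 1 / ‖s‖ := by rw [hz, norm_div, norm_one]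
  have hz2 : ‖z‖ ≤ 1/2 := by rw [hzn]; exact one_div_le_one_div_of_le (by norm_num) h2
  have hz1 : ‖z‖ < 1 := by linarith
  have hz0 : z ≠ 0 := by rw [hz]; simpa using hs0
  have hinv : (1 - ‖z‖)⁻¹ ≤ 2 := by
    rw [inv_le_comm₀ (by linarith) (by norm_num)]; linarith
  have b1 := Complex.norm_log_sub_logTaylor_le 2 hz1
  have b2 := Complex.norm_log_one_add_sub_self_le hz1
  have ht : Complex.logTaylor (2+1) z = z - z^2/2 := by
    rw [Complex.logTaylor_succ, Complex.logTaylor_succ, Complex.logTaylor_succ, Complex.logTaylor_zero]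
    simp; ring
  rw [ht] at b1
  have hsz : s = 1 / z := by rw [hz]; simp
  have e : gt s = (Complex.log (1 + z) - (z - z^2/2)) / z + (Complex.log (1+z) - z) / 2 := by
    rw [gt, log_add_one_sub hs, ← hz, hsz]
    field_simp
    ring
  rw [e]
  have hzp : 0 < ‖z‖ := norm_pos_iff.mpr hz0
  have c1 : ‖(Complex.log (1 + z) - (z - z^2/2)) / z‖ ≤ ‖z‖^2 := by
    rw [norm_div, div_le_iff₀ hzp]
    refine b1.trans ?_
    have : ‖z‖ ^ (2+1) * (1 - ‖z‖)⁻¹ ≤ ‖z‖^(2+1) * 2 := by gcongr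
    push_cast
    have h3 : 0 ≤ ‖z‖^3 := by positivity
    rw [div_le_iff₀ (by norm_num)]
    nlinarith
  have c2 : ‖(Complex.log (1+z) - z) / 2‖ ≤ ‖z‖^2 := by
    rw [norm_div, div_le_iff₀ (by simp)]
    refine b2.trans ?_
    have : ‖z‖ ^ 2 * (1 - ‖z‖)⁻¹ ≤ ‖z‖^2 * 2 := by gcongr
    have h3 : 0 ≤ ‖z‖^2 := by positivity
    simp
    rw [div_le_iff₀ (by norm_num)]
    nlinarith
  refine (norm_add_le _ _).trans ((add_le_add c1 c2).trans (le_of_eq ?_))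
  rw [hzn]; ring

lemma hasSum_tele {τ : ℝ} (hτ : 1 < τ) :
    HasSum (fun k : ℕ => 1 / (k + τ - 1) - 1 / (k + τ)) (1 / (τ - 1)) := by
  rw [hasSum_iff_tendsto_nat_of_nonneg]
  · have : ∀ n : ℕ, ∑ k ∈ Finset.range n, (1 / ((k:ℝ) + τ - 1) - 1 / (k + τ)) = 1 / (τ - 1) - 1 / (n + τ - 1) := by
      intro n
      induction n with
      | zero => simp
      | succ n ih => rw [Finset.sum_range_succ, ih]; push_cast; ring_nf
    simp_rw [this]
    have h : Tendsto (fun n : ℕ => (n:ℝ) + τ - 1) atTop atTop := by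
      apply tendsto_atTop_add_const_right
      apply tendsto_atTop_add_const_right
      exact tendsto_natCast_atTop_atTop
    have h2 : Tendsto (fun n : ℕ => 1 / ((n:ℝ) + τ - 1)) atTop (𝓝 0) := by
      simp only [one_div]; exact h.inv_tendsto_atTop
    simpa using h2.const_sub (1 / (τ - 1))
  · intro k
    rw [sub_nonneg]
    have hk : (0:ℝ) ≤ k := Nat.cast_nonneg k
    exact one_div_le_one_div_of_le (by linarith) (by linarith)

lemma norm_gt_add_le {s : ℂ} (hs : 0 < s.re) (h2 : 2 ≤ s.im) (k : ℕ) :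
    ‖gt (s + k)‖ ≤ 4 * (1 / (k + s.im - 1) - 1 / (k + s.im)) := by
  have hk : (0:ℝ) ≤ k := Nat.cast_nonneg k
  have him : (s + k).im = s.im := by simp
  have hre : (s + k).re = s.re + k := by simp
  have hn : 2 ≤ ‖s + k‖ := by
    have := Complex.abs_im_le_norm (s + k)
    rw [him, abs_of_nonneg (by linarith)] at this
    linarith
  refine (norm_gt_le (by rw [hre]; linarith) hn).trans ?_
  have hsq : ((k:ℝ) + s.im)^2 ≤ 2 * ‖s+k‖^2 := by
    rw [Complex.sq_norm, Complex.normSq_apply, him, hre]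
    nlinarith [sq_nonneg ((k:ℝ) - s.im), mul_nonneg hs.le hk, sq_nonneg s.re]
  have hp : 0 < (k:ℝ) + s.im := by linarith
  have hp1 : 0 < (k:ℝ) + s.im - 1 := by linarith
  have e : 4 * (1 / ((k:ℝ) + s.im - 1) - 1 / (k + s.im)) = 4 / ((k + s.im - 1) * (k + s.im)) := by
    field_simp; ring
  rw [e, div_le_div_iff₀ (by positivity) (by positivity)]
  nlinarith

noncomputable def mu (s : ℂ) : ℂ := ∑' k : ℕ, gt (s + k)

lemma summable_gt {s : ℂ} (hs : 0 < s.re) (h2 : 2 ≤ s.im) : Summable (fun k : ℕ => gt (s + k)) :=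
  Summable.of_norm_bounded ((hasSum_tele (by linarith : 1 < s.im)).summable.mul_left 4)
    (norm_gt_add_le hs h2)

lemma norm_mu_le {s : ℂ} (hs : 0 < s.re) (h2 : 2 ≤ s.im) : ‖mu s‖ ≤ 8 / s.im := by
  refine (tsum_of_norm_bounded ((hasSum_tele (by linarith : 1 < s.im)).mul_left 4)
    (norm_gt_add_le hs h2)).trans ?_
  rw [mul_one_div, div_le_div_iff₀ (by linarith) (by linarith)]
  linarith

/-- logarithm of Gamma up to a constant -/
noncomputable def Lg (s : ℂ) : ℂ := (s - 1/2) * Complex.log s - s + mu s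

lemma mu_succ {s : ℂ} (hs : 0 < s.re) (h2 : 2 ≤ s.im) : mu s = gt s + mu (s + 1) := by
  rw [mu, (summable_gt hs h2).tsum_eq_zero_add, mu]
  simp only [Nat.cast_zero, add_zero]
  congr 1
  apply tsum_congr
  intro k
  congr 1
  push_cast; ring

lemma exp_Lg_succ {s : ℂ} (hs : 0 < s.re) (h2 : 2 ≤ s.im) :
    Complex.exp (Lg (s + 1)) = s * Complex.exp (Lg s) := by
  have hs0 : s ≠ 0 := fun h => by simp [h] at hs
  have : Lg (s+1) = Complex.log s + Lg s := by
    rw [Lg, Lg, mu_succ hs h2, gt]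
    ring
  rw [this, Complex.exp_add, Complex.exp_log hs0]

lemma exp_Lg_nat {s : ℂ} (hs : 0 < s.re) (h2 : 2 ≤ s.im) (N : ℕ) :
    Complex.exp (Lg (s + N)) = (∏ j ∈ Finset.range N, (s + j)) * Complex.exp (Lg s) := by
  induction N with
  | zero => simp
  | succ N ih =>
    have h := exp_Lg_succ (s := s + N) (by simp; positivity) (by simpa using h2)
    rw [Finset.prod_range_succ, mul_right_comm, ← ih]
    push_cast
    rw [← add_assoc, h]; ring

lemma mu_tendsto {s : ℂ} (hs : 0 < s.re) (h2 : 2 ≤ s.im) :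
    Tendsto (fun N : ℕ => mu (s + (N + 1 : ℕ))) atTop (𝓝 0) := by
  have := (tendsto_sum_nat_add (fun k : ℕ => gt (s + k))).comp (tendsto_add_atTop_nat 1)
  refine this.congr (fun N => ?_)
  simp only [Function.comp, mu]
  apply tsum_congr
  intro k
  congr 1
  push_cast; ring

theorem Gamma_eq_exp_Lg {s : ℂ} (hs : 0 < s.re) (h2 : 2 ≤ s.im) :
    Complex.Gamma s = (√2 * √Real.pi : ℝ) * Complex.exp (Lg s) := by
  have hs0 : s ≠ 0 := fun h => by simp [h] at hs
  have hlim := Complex.GammaSeq_tendsto_Gamma s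
  refine tendsto_nhds_unique hlim ?_
  -- expression
  have hx : Tendsto (fun N : ℕ => (N:ℂ) * Complex.log (1 + (s+1) / N)) atTop (𝓝 (s + 1)) := by
    apply Complex.tendsto_nat_mul_log_one_add_of_tendsto
    apply tendsto_const_nhds.congr'
    filter_upwards [eventually_gt_atTop 0] with N hN
    have : (N:ℂ) ≠ 0 := by exact_mod_cast hN.ne'
    field_simp
  have hdiv : Tendsto (fun N : ℕ => (s+1) / (N:ℂ)) atTop (𝓝 0) :=
    tendsto_const_div_atTop_nhds_zero_nat (𝕜 := ℂ) (s+1)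
  have hy : Tendsto (fun N : ℕ => (s + 1/2) * Complex.log (1 + (s+1) / N)) atTop (𝓝 0) := by
    have : Tendsto (fun N : ℕ => Complex.log (1 + (s+1) / N)) atTop (𝓝 (Complex.log (1+0))) := by
      apply Tendsto.clog
      · exact tendsto_const_nhds.add hdiv
      · simp
    simpa using this.const_mul (s+1/2)
  have hE : Tendsto (fun N : ℕ => Complex.exp (-((N:ℂ) * Complex.log (1 + (s+1) / N)
      + (s + 1/2) * Complex.log (1 + (s+1) / N)) + (s + 1) - mu (s + (N + 1 : ℕ)))) atTop (𝓝 1) := by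
    have := (((hx.add hy).neg.add (tendsto_const_nhds (x := s+1))).sub (mu_tendsto hs h2)).cexp
    simpa using this
  have hS : Tendsto (fun N : ℕ => ((Stirling.stirlingSeq N : ℝ) : ℂ)) atTop (𝓝 (√Real.pi : ℝ)) :=
    (Complex.continuous_ofReal.tendsto _).comp Stirling.tendsto_stirlingSeq_sqrt_pi
  have hT := ((hE.mul hS).mul_const ((√2 : ℝ) * Complex.exp (Lg s) : ℂ))
  have hfin : (1 * ((√Real.pi : ℝ) : ℂ) * ((√2 : ℝ) * Complex.exp (Lg s) : ℂ)) =
     (√2 * √Real.pi : ℝ) * Complex.exp (Lg s) := by push_cast; ring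
  rw [hfin] at hT
  refine hT.congr' ?_
  filter_upwards [eventually_gt_atTop 0] with N hN
  have hNr : (0:ℝ) < N := by exact_mod_cast hN
  have hNc : (N:ℂ) ≠ 0 := by exact_mod_cast hN.ne'
  have hprod : (∏ j ∈ Finset.range (N+1), (s + j)) ≠ 0 := by
    rw [Finset.prod_ne_zero_iff]
    intro j _ h
    have : (s + j).re = 0 := by rw [h]; simp
    simp at this
    have hj : (0:ℝ) ≤ j := Nat.cast_nonneg j
    linarith
  have hpe := exp_Lg_nat hs h2 (N+1)
  rw [Complex.GammaSeq]
  rw [eq_div_iff hprod]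
  have hst : ((N.factorial : ℝ)) = Stirling.stirlingSeq N * (√(2 * N) * (N / Real.exp 1) ^ N) := by
    rw [Stirling.stirlingSeq]
    field_simp
  have hst' : ((N.factorial : ℂ)) = (Stirling.stirlingSeq N : ℝ) * ((√2 : ℝ) * Complex.exp ((1/2) * Complex.log N + N * Complex.log N - N)) := by
    have e1 : (√(2*N) * (N / Real.exp 1) ^ N : ℝ) = √2 * Real.exp ((1/2) * Real.log N + N * Real.log N - N) := by
      rw [Real.sqrt_mul (by norm_num), mul_assoc]
      congr 1
      rw [Real.exp_sub, Real.exp_add, div_pow, ← Real.exp_nat_mul, mul_one, mul_div_assoc]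
      congr 1
      · rw [Real.sqrt_eq_rpow, Real.rpow_def_of_pos hNr, mul_comm]
      · congr 1
        rw [Real.exp_nat_mul, Real.exp_log hNr]
    have : ((N.factorial : ℂ)) = ((N.factorial : ℝ) : ℂ) := by push_cast; rfl
    rw [this, hst, e1]
    push_cast
    rw [show Complex.log (N:ℂ) = ((Real.log N : ℝ) : ℂ) by rw [Complex.ofReal_log hNr.le]; simp]
  rw [hst', Complex.cpow_def_of_ne_zero hNc]
  have hL : Complex.exp (Lg s) * (∏ j ∈ Finset.range (N+1), (s + j)) = Complex.exp (Lg (s + (N+1:ℕ))) := by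
    rw [hpe]; ring
  have hlog : Complex.log (s + (N + 1 : ℕ)) = Complex.log N + Complex.log (1 + (s+1)/N) := by
    have hne : 1 + (s+1)/N ≠ 0 := by
      intro h
      have h3 : (N:ℂ) * (1 + (s+1)/N) = 0 := by rw [h, mul_zero]
      have h4 : (N:ℂ) * (1 + (s+1)/N) = N + (s + 1) := by field_simp
      rw [h4] at h3
      have h5 := congrArg Complex.re h3
      simp at h5
      linarith
    have := Complex.log_ofReal_mul hNr hne
    rw [Complex.ofReal_log hNr.le] at this
    simp only [Complex.ofReal_natCast] at this
    rw [← this]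
    congr 1
    push_cast
    field_simp
    ring
  rw [show ∀ A B C D : ℂ, A * B * (C * D) * (∏ j ∈ Finset.range (N+1), (s + j)) =
    A * B * C * (D * (∏ j ∈ Finset.range (N+1), (s + j))) by intros; ring, hL]
  rw [Lg, hlog]
  rw [show ∀ A B C D E: ℂ, Complex.exp A * B * C * Complex.exp D = B * C * Complex.exp (A + D) by
    intros; rw [Complex.exp_add]; ring]
  rw [show ∀ A B C D E: ℂ, Complex.exp A * (B * (C * Complex.exp D)) = B * C * Complex.exp (A + D) by
    intros; rw [Complex.exp_add]; ring]
  congr 2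
  push_cast
  ring
  all_goals exact 0

end Landau
end

section
open Filter Topology MeasureTheory Set
open scoped BigOperators

namespace Landau

/-- Functions with a Stirling-type expansion on a half line. -/
def StF (δ σ a : ℝ) (f : ℝ → ℂ) : Prop :=
  ∃ (β t0 C : ℝ) (h h' : ℝ → ℂ), 1 ≤ t0 ∧ 0 ≤ C ∧ ∀ t, t0 ≤ t →
    HasDerivAt h (h' t) t ∧ ‖h t‖ ≤ C ∧ ‖h' t‖ ≤ C / t ∧
    f t = h t * Complex.exp ((δ * t + a * Real.log t : ℝ) + Complex.I * ((σ * (t * Real.log t) + β * t : ℝ) : ℂ))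

lemma StF.mul {δ σ a δ' σ' a' : ℝ} {f g : ℝ → ℂ} (hf : StF δ σ a f) (hg : StF δ' σ' a' g) :
    StF (δ + δ') (σ + σ') (a + a') (fun t => f t * g t) := by
  obtain ⟨β, t0, C, h, h1, ht0, hC, H⟩ := hf
  obtain ⟨β', t0', C', k, k1, ht0', hC', H'⟩ := hg
  refine ⟨β + β', max t0 t0', 2 * (C * C') , fun t => h t * k t, fun t => h1 t * k t + h t * k1 t,
    le_max_of_le_left ht0, by positivity, fun t ht => ?_⟩
  obtain ⟨a1, a2, a3, a4⟩ := H t (le_trans (le_max_left _ _) ht)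
  obtain ⟨b1, b2, b3, b4⟩ := H' t (le_trans (le_max_right _ _) ht)
  have htp : 0 < t := by linarith [le_trans (le_max_left t0 t0') ht]
  refine ⟨a1.mul b1, ?_, ?_, ?_⟩
  · rw [norm_mul]
    have : ‖h t‖ * ‖k t‖ ≤ C * C' := by gcongr
    nlinarith [mul_nonneg hC hC']
  · refine (norm_add_le _ _).trans ?_
    rw [norm_mul, norm_mul]
    have e1 : ‖h1 t‖ * ‖k t‖ ≤ C / t * C' := by gcongr
    have e2 : ‖h t‖ * ‖k1 t‖ ≤ C * (C' / t) := by gcongr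
    refine (add_le_add e1 e2).trans (le_of_eq ?_)
    field_simp; ring
  · simp only
    rw [a4, b4]
    rw [show ∀ A B C D : ℂ, A * B * (C * D) = A * C * (B * D) by intros; ring, ← Complex.exp_add]
    congr 2
    push_cast; ring

lemma StF.const (c : ℂ) : StF 0 0 0 (fun _ => c) := by
  refine ⟨0, 1, ‖c‖, fun _ => c, fun _ => 0, le_rfl, norm_nonneg _, fun t ht => ⟨hasDerivAt_const _ _, le_rfl, ?_, ?_⟩⟩
  · simp; positivity
  · simp

lemma StF.cexp_lin (β : ℝ) : StF 0 0 0 (fun t => Complex.exp (Complex.I * ((β * t : ℝ) : ℂ))) := by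
  refine ⟨β, 1, 1, fun _ => 1, fun _ => 0, le_rfl, by norm_num, fun t ht => ⟨hasDerivAt_const _ _, by simp, ?_, ?_⟩⟩
  · simp; positivity
  · simp

lemma StF.pow {δ σ a : ℝ} {f : ℝ → ℂ} (hf : StF δ σ a f) (n : ℕ) :
    StF (n * δ) (n * σ) (n * a) (fun t => f t ^ n) := by
  induction n with
  | zero => simpa using StF.const 1
  | succ n ih =>
    have := ih.mul hf
    simp only [pow_succ]
    push_cast
    convert this using 1 <;> ring

lemma StF.congr {δ σ a : ℝ} {f g : ℝ → ℂ} (hf : StF δ σ a f) (hfg : ∀ t, 1 ≤ t → f t = g t) :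
    StF δ σ a g := by
  obtain ⟨β, t0, C, h, h1, ht0, hC, H⟩ := hf
  refine ⟨β, t0, C, h, h1, ht0, hC, fun t ht => ?_⟩
  rw [← hfg t (ht0.trans ht)]
  exact H t ht

lemma StF.scale {δ σ a : ℝ} {f : ℝ → ℂ} (hf : StF δ σ a f) {q : ℝ} (hq : 0 < q) :
    StF (q * δ) (q * σ) a (fun t => f (q * t)) := by
  obtain ⟨β, t0, C, h, h1, ht0, hC, H⟩ := hf
  refine ⟨q * β + q * σ * Real.log q, max 1 (t0 / q), C * Real.exp (a * Real.log q),
    fun t => h (q * t) * Real.exp (a * Real.log q),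
    fun t => (h1 (q * t) * q) * Real.exp (a * Real.log q), le_max_left _ _, by positivity, fun t ht => ?_⟩
  have ht1 : 1 ≤ t := (le_max_left _ _).trans ht
  have htq : t0 ≤ q * t := by
    have := (le_max_right _ _).trans ht
    rw [div_le_iff₀ hq] at this; linarith
  have htp : 0 < t := by linarith
  obtain ⟨a1, a2, a3, a4⟩ := H _ htq
  refine ⟨?_, ?_, ?_, ?_⟩
  · apply HasDerivAt.mul_const
    have h2 : HasDerivAt (fun t : ℝ => q * t) q t := by simpa using (hasDerivAt_id t).const_mul q
    have := HasDerivAt.scomp (𝕜 := ℝ) t a1 h2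
    simpa [mul_comm, Function.comp_def] using this
  · rw [norm_mul, Complex.norm_real, Real.norm_eq_abs, abs_of_pos (Real.exp_pos _)]
    gcongr
  · rw [norm_mul, norm_mul, Complex.norm_real, Complex.norm_real, Real.norm_eq_abs, Real.norm_eq_abs,
      abs_of_pos (Real.exp_pos _), abs_of_pos hq]
    have : ‖h1 (q * t)‖ * q ≤ C / t := by
      refine (mul_le_mul_of_nonneg_right a3 hq.le).trans (le_of_eq ?_)
      field_simp
    calc _ ≤ C / t * Real.exp (a * Real.log q) := by gcongr
      _ = _ := by ring
  · simp only
    rw [a4, Complex.ofReal_exp, mul_assoc (h (q * t)), ← Complex.exp_add, Real.log_mul hq.ne' htp.ne']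
    congr 2
    push_cast; ring

lemma StF.Gamma_one {p : ℝ} (hp : 0 < p) :
    StF (-(Real.pi/2)) 1 (p - 1/2) (fun t => Complex.Gamma (p + Complex.I * t)) := by
  set r : ℝ := min (p/2) 1 with hr
  have hr0 : 0 < r := by rw [hr]; positivity
  have hr1 : r ≤ 1 := min_le_right _ _
  have hrp : r ≤ p / 2 := min_le_left _ _
  -- R
  set R : ℂ → ℂ := fun s => Complex.Gamma s / ((√2 * √Real.pi : ℝ) * Complex.exp ((s - 1/2) * Complex.log s - s)) with hR
  have hsp : (0:ℝ) < √2 * √Real.pi := by positivity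
  have hspc : ((√2 * √Real.pi : ℝ) : ℂ) ≠ 0 := by exact_mod_cast hsp.ne'
  have hRmu : ∀ s : ℂ, 0 < s.re → 2 ≤ s.im → R s = Complex.exp (mu s) := by
    intro s h1 h2
    rw [hR]; simp only
    rw [Gamma_eq_exp_Lg h1 h2, Lg, mul_div_mul_left _ _ hspc, ← Complex.exp_sub]
    congr 1; ring
  have hRd : ∀ s : ℂ, 0 < s.re → DifferentiableAt ℂ R s := by
    intro s h1
    have hsl : s ∈ Complex.slitPlane := Or.inl h1
    have hg : DifferentiableAt ℂ Complex.Gamma s := by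
      apply Complex.differentiableAt_Gamma
      intro m h
      rw [h] at h1
      simp at h1
      linarith [Nat.cast_nonneg (α := ℝ) m]
    refine hg.div ?_ (mul_ne_zero hspc (Complex.exp_ne_zero _))
    have : DifferentiableAt ℂ Complex.log s := (Complex.hasStrictDerivAt_log hsl).hasDerivAt.differentiableAt
    fun_prop
  have hRb : ∀ s : ℂ, 0 < s.re → 2 ≤ s.im → ‖R s‖ ≤ Real.exp 4 := by
    intro s h1 h2
    rw [hRmu s h1 h2, Complex.norm_exp]
    apply Real.exp_le_exp.mpr
    refine (Complex.re_le_norm _).trans ((norm_mu_le h1 h2).trans ?_)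
    rw [div_le_iff₀ (by linarith)]; linarith
  have hRb1 : ∀ s : ℂ, 0 < s.re → 2 ≤ s.im → ‖R s - 1‖ ≤ 8 / s.im * Real.exp 4 := by
    intro s h1 h2
    rw [hRmu s h1 h2]
    have hm := norm_mu_le h1 h2
    have hm4 : ‖mu s‖ ≤ 4 := hm.trans (by rw [div_le_iff₀ (by linarith)]; linarith)
    have hq := Complex.norm_exp_sub_sum_le_norm_mul_exp (mu s) 1
    simp only [Finset.sum_range_one, pow_zero, Nat.factorial_zero, Nat.cast_one, div_one, pow_one] at hq
    refine hq.trans ?_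
    gcongr
  -- sequences
  set ℓ : ℝ → ℂ := fun t => Complex.log (1 + (-(Complex.I * p) / t)) with hℓ
  have hlog : ∀ t : ℝ, 0 < t → Complex.log (p + Complex.I * t) = Real.log t + Complex.I * (Real.pi/2) + ℓ t := by
    intro t ht
    have htc : (t:ℂ) ≠ 0 := by exact_mod_cast ht.ne'
    have e : (p + Complex.I * t : ℂ) = (t:ℂ) * (Complex.I * (1 + (-(Complex.I * p) / t))) := by
      field_simp
      ring_nf; simp [Complex.I_sq]
    have hre : (1 + (-(Complex.I * p) / t) : ℂ).re = 1 := by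
      rw [Complex.add_re, Complex.div_ofReal_re]; simp
    have hz : (1 + (-(Complex.I * p) / t) : ℂ) ≠ 0 := by
      intro h; rw [h] at hre; simp at hre
    have hargi : Complex.arg Complex.I = Real.pi/2 := Complex.arg_I
    have a2 := abs_lt.mp (Complex.abs_arg_lt_pi_div_two_iff.mpr (Or.inl (by rw [hre]; norm_num : 0 < (1 + (-(Complex.I * p) / t) : ℂ).re)))
    rw [e, Complex.log_ofReal_mul ht (mul_ne_zero Complex.I_ne_zero hz),
      Complex.log_mul Complex.I_ne_zero hz ⟨by rw [hargi]; linarith [a2.1, Real.pi_pos], by rw [hargi]; linarith [a2.2]⟩, Complex.log_I]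
    simp only [hℓ]; ring
  have hℓb : ∀ t : ℝ, 2 * p ≤ t → 0 < t → ‖ℓ t‖ ≤ 3/2 * (p / t) := by
    intro t h1 h2
    have hn : ‖(-(Complex.I * p) / t : ℂ)‖ = p / t := by
      simp [abs_of_pos hp, abs_of_pos h2]
    have := Complex.norm_log_one_add_half_le_self (z := (-(Complex.I * p) / t : ℂ)) (by
      rw [hn, div_le_iff₀ h2]; linarith)
    rw [hn] at this
    exact this
  set E : ℝ → ℂ := fun t => (p - 1/2 + Complex.I * t) * Complex.log (p + Complex.I * t) - (p + Complex.I * t)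
     - (-(Real.pi/2) * t + (p - 1/2) * Real.log t + Complex.I * (t * Real.log t - t)) with hE
  set E' : ℝ → ℂ := fun t => Complex.I * ℓ t - Complex.I * (1/2) / (p + Complex.I * t) - (p - 1/2) / t with hE'
  have hpos : ∀ t : ℝ, (p + Complex.I * t : ℂ) ≠ 0 := by
    intro t h
    have := congrArg Complex.re h
    simp at this; linarith
  have hdlin : ∀ t : ℝ, HasDerivAt (fun t : ℝ => (p + Complex.I * t : ℂ)) Complex.I t := by
    intro t
    have := ((Complex.ofRealCLM.hasDerivAt (x := t)).const_mul Complex.I).const_add (p:ℂ)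
    simpa using this
  have hEd : ∀ t : ℝ, 0 < t → HasDerivAt E (E' t) t := by
    intro t ht
    have htc : (t:ℂ) ≠ 0 := by exact_mod_cast ht.ne'
    have d1 := hdlin t
    have hsl : (p + Complex.I * t : ℂ) ∈ Complex.slitPlane := by left; simp [hp]
    have d2 : HasDerivAt (fun t : ℝ => Complex.log (p + Complex.I * t)) (Complex.I / (p + Complex.I * t)) t :=
      d1.clog_real hsl
    have d3 : HasDerivAt (fun t : ℝ => (p - 1/2 + Complex.I * t : ℂ)) Complex.I t := by
      have := ((Complex.ofRealCLM.hasDerivAt (x := t)).const_mul Complex.I).const_add (p - 1/2:ℂ)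
      simpa using this
    have d4 : HasDerivAt (fun t : ℝ => ((Real.log t : ℝ) : ℂ)) ((t⁻¹ : ℝ) : ℂ) t := (Real.hasDerivAt_log ht.ne').ofReal_comp
    have d5 : HasDerivAt (fun t : ℝ => (t : ℂ)) 1 t := Complex.ofRealCLM.hasDerivAt (x := t)
    have := ((d3.mul d2).sub d1).sub (((d5.const_mul (-(Real.pi/2):ℂ)).add (d4.const_mul (p - 1/2 : ℂ))).add
      (((d5.mul d4).sub d5).const_mul Complex.I))
    refine this.congr_deriv ?_
    rw [hlog t ht]
    simp only [hE']
    have hq := hpos t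
    push_cast
    field_simp
    ring_nf
    simp only [Complex.I_sq, Complex.I_pow_three]
    ring
  have hEb : ∀ t : ℝ, 2 * p ≤ t → 1 ≤ t → ‖E t‖ ≤ (|p - 1/2| + 1) * (3/2 * p) + |p - 1/2| * 2 + p := by
    intro t h1 h2
    have htp : 0 < t := by linarith
    have e : E t = (p - 1/2 + Complex.I * t) * ℓ t + (p - 1/2) * (Complex.I * (Real.pi/2)) - p := by
      simp only [hE]; rw [hlog t htp]
      ring_nf; simp only [Complex.I_sq]; ring
    rw [e]
    have n1 : ‖(p - 1/2 + Complex.I * t : ℂ)‖ ≤ |p - 1/2| + t := by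
      refine (norm_add_le _ _).trans ?_
      rw [show (p - 1/2 : ℂ) = ((p - 1/2 : ℝ) : ℂ) by push_cast; ring, Complex.norm_real, norm_mul, Complex.norm_I, Complex.norm_real, Real.norm_eq_abs, Real.norm_eq_abs, abs_of_pos htp, one_mul]
    have n2 : ‖((p - 1/2) * (Complex.I * (Real.pi/2)) : ℂ)‖ ≤ |p - 1/2| * 2 := by
      rw [show (p - 1/2 : ℂ) = ((p - 1/2 : ℝ) : ℂ) by push_cast; ring, norm_mul, norm_mul, Complex.norm_I, Complex.norm_real, Real.norm_eq_abs, one_mul]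
      gcongr
      rw [show (Real.pi/2 : ℂ) = ((Real.pi/2 : ℝ) : ℂ) by push_cast; ring, Complex.norm_real, Real.norm_eq_abs, abs_of_pos (by positivity)]
      linarith [Real.pi_le_four]
    have n3 : ‖(p - 1/2 + Complex.I * t : ℂ) * ℓ t‖ ≤ (|p - 1/2| + 1) * (3/2 * p) := by
      rw [norm_mul]
      calc _ ≤ (|p - 1/2| + t) * (3/2 * (p/t)) := by
            have := hℓb t h1 htp
            gcongr
        _ = (|p - 1/2| / t + 1) * (3/2 * p) := by field_simp
        _ ≤ _ := by
            gcongr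
            exact div_le_self (abs_nonneg _) h2
    refine (norm_sub_le _ _).trans ?_
    rw [Complex.norm_real, Real.norm_eq_abs, abs_of_pos hp]
    gcongr
    exact (norm_add_le _ _).trans (add_le_add n3 n2)
  have hE'b : ∀ t : ℝ, 2 * p ≤ t → 1 ≤ t → ‖E' t‖ ≤ (3/2 * p + 1/2 + |p - 1/2|) / t := by
    intro t h1 h2
    have htp : 0 < t := by linarith
    simp only [hE']
    have m1 : ‖Complex.I * ℓ t‖ ≤ 3/2 * p / t := by
      rw [norm_mul, Complex.norm_I, one_mul]; exact (hℓb t h1 htp).trans (le_of_eq (by ring))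
    have m2 : ‖Complex.I * (1/2) / (p + Complex.I * t)‖ ≤ 1/2 / t := by
      rw [norm_div, norm_mul, Complex.norm_I, one_mul]
      have : t ≤ ‖(p + Complex.I * t : ℂ)‖ := by
        have := Complex.abs_im_le_norm (p + Complex.I * t : ℂ)
        simp [abs_of_pos htp] at this; exact this
      have h3 : ‖(1/2 : ℂ)‖ = 1/2 := by norm_num
      rw [h3]
      gcongr
    have m3 : ‖((p - 1/2) / t : ℂ)‖ ≤ |p - 1/2| / t := by
      rw [show (p - 1/2 : ℂ) = ((p - 1/2 : ℝ) : ℂ) by push_cast; ring, norm_div, Complex.norm_real, Complex.norm_real, Real.norm_eq_abs, Real.norm_eq_abs, abs_of_pos htp]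
    calc _ ≤ 3/2 * p / t + 1/2 / t + |p - 1/2| / t := (norm_sub_le _ _).trans (add_le_add ((norm_sub_le _ _).trans (add_le_add m1 m2)) m3)
      _ = _ := by ring
  -- derivative of R
  have hR' : ∀ t : ℝ, 4 ≤ t → ‖deriv R (p + Complex.I * t)‖ ≤ (16 * Real.exp 4 / r) / t := by
    intro t ht
    have hball : ∀ z ∈ Metric.closedBall (p + Complex.I * t : ℂ) r, 0 < z.re ∧ t / 2 ≤ z.im ∧ 2 ≤ z.im := by
      intro z hz
      rw [Metric.mem_closedBall, dist_eq_norm] at hz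
      have k1 := (Complex.abs_re_le_norm (z - (p + Complex.I * t))).trans hz
      have k2 := (Complex.abs_im_le_norm (z - (p + Complex.I * t))).trans hz
      simp at k1 k2
      rw [abs_le] at k1 k2
      refine ⟨by linarith, by linarith, by linarith⟩
    have hd : DiffContOnCl ℂ (fun s => R s - 1) (Metric.ball (p + Complex.I * t : ℂ) r) := by
      apply DifferentiableOn.diffContOnCl
      intro z hz
      rw [closure_ball _ hr0.ne'] at hz
      exact ((hRd z (hball z hz).1).sub_const 1).differentiableWithinAt
    have := Complex.norm_deriv_le_of_forall_mem_sphere_norm_le (C := 16 * Real.exp 4 / t) hr0 hd (by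
      intro z hz
      have hz' := hball z (Metric.sphere_subset_closedBall hz)
      refine (hRb1 z hz'.1 hz'.2.2).trans ?_
      have : 8 / z.im ≤ 16 / t := by
        rw [div_le_div_iff₀ (by linarith) (by linarith)]; linarith
      calc _ ≤ 16 / t * Real.exp 4 := by gcongr
        _ = _ := by ring)
    rw [deriv_sub_const] at this
    refine this.trans (le_of_eq (by ring))
  -- assemble
  set M1 := (|p - 1/2| + 1) * (3/2 * p) + |p - 1/2| * 2 + p with hM1
  set M2 := (3/2 * p + 1/2 + |p - 1/2|) with hM2
  have hM2p : 0 ≤ M2 := by positivity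
  set C := (√2 * √Real.pi) * Real.exp 4 * Real.exp M1 * (1 + 16 / r + M2) with hC
  have hC0 : 0 ≤ C := by positivity
  refine ⟨-1, max 4 (2 * p), C, fun t => (√2 * √Real.pi : ℝ) * (R (p + Complex.I * t) * Complex.exp (E t)),
    fun t => (√2 * √Real.pi : ℝ) * (deriv R (p + Complex.I * t) * Complex.I * Complex.exp (E t) + R (p + Complex.I * t) * (Complex.exp (E t) * E' t)),
    le_trans (by norm_num) (le_max_left _ _), hC0, fun t ht => ?_⟩
  have ht4 : 4 ≤ t := (le_max_left _ _).trans ht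
  have ht2 : 2 * p ≤ t := (le_max_right _ _).trans ht
  have htp : 0 < t := by linarith
  have hre : 0 < (p + Complex.I * t : ℂ).re := by simpa using hp
  have him : 2 ≤ (p + Complex.I * t : ℂ).im := by simp; linarith
  have hexpE : ‖Complex.exp (E t)‖ ≤ Real.exp M1 := by
    rw [Complex.norm_exp]
    exact Real.exp_le_exp.mpr ((Complex.re_le_norm _).trans (hEb t ht2 (by linarith)))
  refine ⟨?_, ?_, ?_, ?_⟩
  · apply HasDerivAt.const_mul
    have hc : HasDerivAt (fun t : ℝ => R (p + Complex.I * t)) (deriv R (p + Complex.I * t) * Complex.I) t := by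
      have := HasDerivAt.comp_of_eq (𝕜 := ℝ) (𝕜' := ℂ) (h₂ := R) t (hRd _ hre).hasDerivAt (hdlin t) rfl
      exact this
    exact hc.mul ((hEd t htp).cexp)
  · rw [norm_mul, norm_mul, Complex.norm_real, Real.norm_eq_abs, abs_of_pos hsp]
    have := hRb _ hre him
    calc _ ≤ √2 * √Real.pi * (Real.exp 4 * Real.exp M1) := by gcongr
      _ = (√2 * √Real.pi) * Real.exp 4 * Real.exp M1 * 1 := by ring
      _ ≤ C := by
        rw [hC]; gcongr
        have : 0 ≤ 16 / r := by positivity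
        linarith
  · rw [norm_mul, Complex.norm_real, Real.norm_eq_abs, abs_of_pos hsp]
    have h1 := hRb _ hre him
    have h2 := hR' t ht4
    have h3 := hE'b t ht2 (by linarith)
    calc _ ≤ √2 * √Real.pi * ((16 * Real.exp 4 / r) / t * Real.exp M1 + Real.exp 4 * (Real.exp M1 * (M2 / t))) := by
          gcongr
          refine (norm_add_le _ _).trans ?_
          rw [norm_mul, norm_mul, norm_mul, norm_mul, Complex.norm_I, mul_one]
          gcongr
      _ = (√2 * √Real.pi) * Real.exp 4 * Real.exp M1 * (16 / r + M2) / t := by ring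
      _ ≤ C / t := by
        rw [hC]; gcongr
        linarith
  · simp only
    have : Complex.Gamma (p + Complex.I * t) = R (p + Complex.I * t) * ((√2 * √Real.pi : ℝ) * Complex.exp (((p + Complex.I * t : ℂ) - 1/2) * Complex.log (p + Complex.I * t) - (p + Complex.I * t))) := by
      simp only [hR]
      rw [div_mul_cancel₀]
      exact mul_ne_zero hspc (Complex.exp_ne_zero _)
    rw [this, mul_left_comm, mul_assoc, mul_assoc, ← Complex.exp_add]
    congr 3
    simp only [hE]
    push_cast
    ring

lemma StF.Gamma {p q : ℝ} (hp : 0 < p) (hq : 0 < q) :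
    StF (-(Real.pi/2) * q) q (p - 1/2) (fun t => Complex.Gamma (p + Complex.I * (q * t : ℝ))) := by
  have := (StF.Gamma_one hp).scale hq
  convert this using 1 <;> ring

end Landau
end

section
open Filter Topology MeasureTheory Set
open scoped BigOperators

namespace Landau

/-- First derivative test. -/
lemma first_deriv_test {a b m : ℝ} (hab : a ≤ b) (hm : 0 < m) {θ θ1 θ2 : ℝ → ℝ}
    (h1 : ∀ t ∈ Icc a b, HasDerivAt θ (θ1 t) t)
    (h2 : ∀ t ∈ Icc a b, HasDerivAt θ1 (θ2 t) t)
    (hc : ContinuousOn θ2 (Icc a b))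
    (hneg : ∀ t ∈ Icc a b, θ2 t ≤ 0)
    (hlow : (∀ t ∈ Icc a b, m ≤ θ1 t) ∨ (∀ t ∈ Icc a b, θ1 t ≤ -m)) :
    ‖∫ t in a..b, Complex.exp (Complex.I * (θ t : ℂ))‖ ≤ 4 / m := by
  have hI : uIcc a b = Icc a b := uIcc_of_le hab
  have habs : ∀ t ∈ Icc a b, m ≤ |θ1 t| := by
    intro t ht
    rcases hlow with h | h
    · exact (h t ht).trans (le_abs_self _)
    · exact (le_neg.mpr (h t ht)).trans (neg_le_abs _)
  have hne : ∀ t ∈ Icc a b, θ1 t ≠ 0 := fun t ht h0 => by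
    have := habs t ht; rw [h0, abs_zero] at this; linarith
  have hc1 : ContinuousOn θ1 (Icc a b) := fun t ht => (h2 t ht).continuousAt.continuousWithinAt
  have hc0 : ContinuousOn θ (Icc a b) := fun t ht => (h1 t ht).continuousAt.continuousWithinAt
  -- u = 1/(I θ1), v = exp(I θ)
  have hu : ∀ t ∈ uIcc a b, HasDerivAt (fun t => (((θ1 t)⁻¹ : ℝ) : ℂ)) ((-(θ2 t) / (θ1 t)^2 : ℝ) : ℂ) t := by
    intro t ht
    rw [hI] at ht
    exact ((h2 t ht).inv (hne t ht)).ofReal_comp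
  have hv : ∀ t ∈ uIcc a b, HasDerivAt (fun t => Complex.exp (Complex.I * (θ t : ℂ)))
      (Complex.exp (Complex.I * (θ t : ℂ)) * (Complex.I * (θ1 t : ℂ))) t := by
    intro t ht
    rw [hI] at ht
    exact (((h1 t ht).ofReal_comp).const_mul Complex.I).cexp
  have hcu : ContinuousOn (fun t => -(θ2 t) / (θ1 t)^2) (Icc a b) :=
    (hc.neg).div (hc1.pow 2) (fun t ht => pow_ne_zero 2 (hne t ht))
  have hce : ContinuousOn (fun t => Complex.exp (Complex.I * (θ t : ℂ))) (Icc a b) :=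
    (continuousOn_const.mul (Complex.continuous_ofReal.comp_continuousOn hc0)).cexp
  have hpart := intervalIntegral.integral_mul_deriv_eq_deriv_mul hu hv
    (ContinuousOn.intervalIntegrable (by rw [hI]; exact Complex.continuous_ofReal.comp_continuousOn hcu))
    (ContinuousOn.intervalIntegrable (by
      rw [hI]
      exact hce.mul (continuousOn_const.mul (Complex.continuous_ofReal.comp_continuousOn hc1))))
  have heq : ∫ t in a..b, (((θ1 t)⁻¹ : ℝ) : ℂ) * (Complex.exp (Complex.I * (θ t : ℂ)) * (Complex.I * (θ1 t : ℂ)))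
      = Complex.I * ∫ t in a..b, Complex.exp (Complex.I * (θ t : ℂ)) := by
    rw [← intervalIntegral.integral_const_mul]
    apply intervalIntegral.integral_congr
    intro t ht
    rw [hI] at ht
    have : (θ1 t : ℂ) ≠ 0 := by exact_mod_cast hne t ht
    simp only [Complex.ofReal_inv]
    field_simp
  have hnorm : ∀ x : ℝ, ‖Complex.exp (Complex.I * (x : ℂ))‖ = 1 := by
    intro x; rw [mul_comm]; exact Complex.norm_exp_ofReal_mul_I x
  have hint2 : ‖∫ t in a..b, ((-(θ2 t) / (θ1 t)^2 : ℝ) : ℂ) * Complex.exp (Complex.I * (θ t : ℂ))‖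
      ≤ ∫ t in a..b, -(θ2 t) / (θ1 t)^2 := by
    refine (intervalIntegral.norm_integral_le_integral_norm hab).trans (le_of_eq ?_)
    apply intervalIntegral.integral_congr
    intro t ht
    rw [hI] at ht
    simp only [norm_mul, hnorm, mul_one, Complex.norm_real, Real.norm_eq_abs]
    apply abs_of_nonneg
    exact div_nonneg (neg_nonneg.mpr (hneg t ht)) (sq_nonneg _)
  have hint3 : ∫ t in a..b, -(θ2 t) / (θ1 t)^2 = (θ1 b)⁻¹ - (θ1 a)⁻¹ := by
    apply intervalIntegral.integral_eq_sub_of_hasDerivAt (f := fun t => (θ1 t)⁻¹)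
    · intro t ht
      rw [hI] at ht
      exact (h2 t ht).inv (hne t ht)
    · exact ContinuousOn.intervalIntegrable (by rw [hI]; exact hcu)
  have hinv : ∀ t ∈ Icc a b, |(θ1 t)⁻¹| ≤ 1 / m := by
    intro t ht
    rw [abs_inv, ← one_div]
    exact one_div_le_one_div_of_le hm (habs t ht)
  have ha := hinv a (left_mem_Icc.mpr hab)
  have hb := hinv b (right_mem_Icc.mpr hab)
  have hfin : ‖∫ t in a..b, Complex.exp (Complex.I * (θ t : ℂ))‖ =
      ‖Complex.I * ∫ t in a..b, Complex.exp (Complex.I * (θ t : ℂ))‖ := by simp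
  rw [hfin, ← heq, hpart]
  refine (norm_sub_le _ _).trans ?_
  refine (add_le_add (norm_sub_le _ _) hint2).trans ?_
  rw [hint3, norm_mul, norm_mul, hnorm, hnorm, Complex.norm_real, Complex.norm_real, mul_one, mul_one,
    Real.norm_eq_abs, Real.norm_eq_abs]
  have e1 := abs_le.mp ha
  have e2 := abs_le.mp hb
  have : (4:ℝ) / m = 1/m+1/m+(1/m+1/m) := by ring
  rw [this]
  linarith [e1.1, e2.2]

lemma norm_int_exp_le {a b : ℝ} (hab : a ≤ b) (θ : ℝ → ℝ) :
    ‖∫ t in a..b, Complex.exp (Complex.I * (θ t : ℂ))‖ ≤ b - a := by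
  have := intervalIntegral.norm_integral_le_of_norm_le_const (a := a) (b := b) (C := 1)
    (f := fun t => Complex.exp (Complex.I * (θ t : ℂ))) (fun x _ => by
      rw [mul_comm]; exact (Complex.norm_exp_ofReal_mul_I _).le)
  rwa [one_mul, abs_of_nonneg (by linarith)] at this

/-- Second derivative test on an interval where the derivative keeps its sign. -/
lemma second_deriv_test_aux {a b lam : ℝ} (hab : a ≤ b) (hl : 0 < lam) {θ θ1 θ2 : ℝ → ℝ}
    (h1 : ∀ t ∈ Icc a b, HasDerivAt θ (θ1 t) t)
    (h2 : ∀ t ∈ Icc a b, HasDerivAt θ1 (θ2 t) t)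
    (hc : ContinuousOn θ2 (Icc a b))
    (hneg : ∀ t ∈ Icc a b, θ2 t ≤ -lam)
    (hs : 0 ≤ θ1 b ∨ θ1 a ≤ 0) :
    ‖∫ t in a..b, Complex.exp (Complex.I * (θ t : ℂ))‖ ≤ 5 / √lam := by
  have hsl : 0 < √lam := Real.sqrt_pos.mpr hl
  set d : ℝ := 1 / √lam with hd
  have hd0 : 0 < d := by positivity
  by_cases hsmall : b - a ≤ d
  · refine (norm_int_exp_le hab θ).trans (hsmall.trans ?_)
    rw [hd]; gcongr; norm_num
  push Not at hsmall
  have hdec : ∀ x ∈ Icc a b, ∀ y ∈ Icc a b, x ≤ y → lam * (y - x) ≤ θ1 x - θ1 y := by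
    intro x hx y hy hxy
    have := (convex_Icc a b).image_sub_le_mul_sub_of_deriv_le (f := θ1) (C := -lam)
      (fun t ht => (h2 t ht).continuousAt.continuousWithinAt)
      (fun t ht => ((h2 t (interior_subset ht)).differentiableAt).differentiableWithinAt)
      (fun t ht => by rw [(h2 t (interior_subset ht)).deriv]; exact hneg t (interior_subset ht))
      x hx y hy hxy
    linarith
  have hld : lam * d = √lam := by
    rw [hd, mul_one_div, Real.div_sqrt]
  have hce : ContinuousOn (fun t => Complex.exp (Complex.I * (θ t : ℂ))) (Icc a b) :=
    (continuousOn_const.mul (Complex.continuous_ofReal.comp_continuousOn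
      (fun t ht => (h1 t ht).continuousAt.continuousWithinAt))).cexp
  have hii : ∀ x ∈ Icc a b, ∀ y ∈ Icc a b, x ≤ y → IntervalIntegrable
      (fun t => Complex.exp (Complex.I * (θ t : ℂ))) volume x y := by
    intro x hx y hy hxy
    apply ContinuousOn.intervalIntegrable
    rw [uIcc_of_le hxy]
    exact hce.mono (Icc_subset_Icc hx.1 hy.2)
  have hAm : a ∈ Icc a b := left_mem_Icc.mpr hab
  have hBm : b ∈ Icc a b := right_mem_Icc.mpr hab
  have h5 : 4 / √lam + d = 5 / √lam := by rw [hd]; ring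
  rcases hs with hs | hs
  · set p := b - d with hp
    have hpm : p ∈ Icc a b := ⟨by linarith, by linarith⟩
    rw [← intervalIntegral.integral_add_adjacent_intervals (hii a hAm p hpm hpm.1) (hii p hpm b hBm hpm.2)]
    refine (norm_add_le _ _).trans ?_
    rw [← h5]
    have hsub : Icc a p ⊆ Icc a b := Icc_subset_Icc le_rfl hpm.2
    refine add_le_add (first_deriv_test hpm.1 hsl (fun t ht => h1 t (hsub ht)) (fun t ht => h2 t (hsub ht))
      (hc.mono hsub) (fun t ht => (hneg t (hsub ht)).trans (by linarith)) (Or.inl ?_)) ?_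
    · intro t ht
      have h := hdec t (hsub ht) b hBm (hsub ht).2
      have : lam * d ≤ lam * (b - t) := by
        apply mul_le_mul_of_nonneg_left _ hl.le
        have := ht.2; linarith
      linarith
    · refine (norm_int_exp_le hpm.2 θ).trans ?_
      linarith
  · set p := a + d with hp
    have hpm : p ∈ Icc a b := ⟨by linarith, by linarith⟩
    rw [← intervalIntegral.integral_add_adjacent_intervals (hii a hAm p hpm hpm.1) (hii p hpm b hBm hpm.2)]
    refine (norm_add_le _ _).trans ?_
    rw [← h5, add_comm]
    have hsub : Icc p b ⊆ Icc a b := Icc_subset_Icc hpm.1 le_rfl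
    refine add_le_add (first_deriv_test hpm.2 hsl (fun t ht => h1 t (hsub ht)) (fun t ht => h2 t (hsub ht))
      (hc.mono hsub) (fun t ht => (hneg t (hsub ht)).trans (by linarith)) (Or.inr ?_)) ?_
    · intro t ht
      have h := hdec a hAm t (hsub ht) (hsub ht).1
      have : lam * d ≤ lam * (t - a) := by
        apply mul_le_mul_of_nonneg_left _ hl.le
        have := ht.1; linarith
      linarith
    · refine (norm_int_exp_le hpm.1 θ).trans ?_
      linarith

lemma second_deriv_test {a b lam : ℝ} (hab : a ≤ b) (hl : 0 < lam) {θ θ1 θ2 : ℝ → ℝ}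
    (h1 : ∀ t ∈ Icc a b, HasDerivAt θ (θ1 t) t)
    (h2 : ∀ t ∈ Icc a b, HasDerivAt θ1 (θ2 t) t)
    (hc : ContinuousOn θ2 (Icc a b))
    (hneg : ∀ t ∈ Icc a b, θ2 t ≤ -lam) :
    ‖∫ t in a..b, Complex.exp (Complex.I * (θ t : ℂ))‖ ≤ 10 / √lam := by
  have hsl : 0 < √lam := Real.sqrt_pos.mpr hl
  have h10 : 5 / √lam + 5 / √lam = 10 / √lam := by ring
  have hle : 5 / √lam ≤ 10 / √lam := by gcongr; norm_num
  by_cases hA : θ1 a ≤ 0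
  · exact (second_deriv_test_aux hab hl h1 h2 hc hneg (Or.inr hA)).trans hle
  by_cases hB : 0 ≤ θ1 b
  · exact (second_deriv_test_aux hab hl h1 h2 hc hneg (Or.inl hB)).trans hle
  push Not at hA hB
  have hc1 : ContinuousOn θ1 (Icc a b) := fun t ht => (h2 t ht).continuousAt.continuousWithinAt
  obtain ⟨p, hpm, hp0⟩ := intermediate_value_Icc' hab hc1 (show (0:ℝ) ∈ Icc (θ1 b) (θ1 a) from ⟨hB.le, hA.le⟩)
  have hce : ContinuousOn (fun t => Complex.exp (Complex.I * (θ t : ℂ))) (Icc a b) :=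
    (continuousOn_const.mul (Complex.continuous_ofReal.comp_continuousOn
      (fun t ht => (h1 t ht).continuousAt.continuousWithinAt))).cexp
  have hs1 : Icc a p ⊆ Icc a b := Icc_subset_Icc le_rfl hpm.2
  have hs2 : Icc p b ⊆ Icc a b := Icc_subset_Icc hpm.1 le_rfl
  rw [← intervalIntegral.integral_add_adjacent_intervals (b := p)
    (ContinuousOn.intervalIntegrable (by rw [uIcc_of_le hpm.1]; exact hce.mono hs1))
    (ContinuousOn.intervalIntegrable (by rw [uIcc_of_le hpm.2]; exact hce.mono hs2)), ← h10]
  refine (norm_add_le _ _).trans (add_le_add ?_ ?_)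
  · exact second_deriv_test_aux hpm.1 hl (fun t ht => h1 t (hs1 ht)) (fun t ht => h2 t (hs1 ht))
      (hc.mono hs1) (fun t ht => hneg t (hs1 ht)) (Or.inl hp0.ge)
  · exact second_deriv_test_aux hpm.2 hl (fun t ht => h1 t (hs2 ht)) (fun t ht => h2 t (hs2 ht))
      (hc.mono hs2) (fun t ht => hneg t (hs2 ht)) (Or.inr hp0.le)

/-- The oscillating integral for the phase `α t - n t log t`. -/
lemma osc_phase_bound {n : ℝ} (hn : 1 ≤ n) (α : ℝ) {A T : ℝ} (hA : 1 ≤ A) (hT : A ≤ T) :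
    ‖∫ t in A..T, Complex.exp (Complex.I * ((α * t - n * (t * Real.log t) : ℝ) : ℂ))‖ ≤ 10 * √T := by
  have hT0 : 0 < T := by linarith
  have hpos : ∀ t ∈ Icc A T, 0 < t := fun t ht => by linarith [ht.1]
  have := second_deriv_test (a := A) (b := T) (lam := 1 / T) hT (by positivity)
    (θ := fun t => α * t - n * (t * Real.log t)) (θ1 := fun t => α * 1 - n * (Real.log t + 1))
    (θ2 := fun t => - (n * (t⁻¹)))
    (fun t ht => ((hasDerivAt_id t).const_mul α).sub
      ((Real.hasDerivAt_mul_log (hpos t ht).ne').const_mul n))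
    (fun t ht => by
      have := (((Real.hasDerivAt_log (hpos t ht).ne').add_const (1:ℝ)).const_mul n).const_sub (α * 1)
      exact this)
    (by
      apply ContinuousOn.neg
      apply continuousOn_const.mul
      exact continuousOn_inv₀.mono (fun t ht => (hpos t ht).ne'))
    (fun t ht => by
      have h0 := hpos t ht
      apply neg_le_neg
      rw [← one_div]
      have : 1 / T ≤ 1 / t := one_div_le_one_div_of_le h0 ht.2
      have h2 : 0 < 1 / t := by positivity
      nlinarith)
  refine this.trans (le_of_eq ?_)
  rw [Real.sqrt_div zero_le_one, Real.sqrt_one]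
  field_simp

end Landau
end

section
open Filter Topology MeasureTheory Set
open scoped BigOperators

namespace Landau

lemma osc_phase_bound' {n : ℝ} (hn : 1 ≤ n) (α : ℝ) {A T : ℝ} (hA : 1 ≤ A) (hT : A ≤ T) :
    ‖∫ t in A..T, Complex.exp (Complex.I * ((n * (t * Real.log t) + α * t : ℝ) : ℂ))‖ ≤ 10 * √T := by
  have := osc_phase_bound hn (-α) hA hT
  rw [← RCLike.norm_conj, ← intervalIntegral.intervalIntegral_conj] at this
  refine le_trans (le_of_eq ?_) this
  congr 2
  ext t
  rw [← Complex.exp_conj]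
  congr 1
  rw [map_mul, Complex.conj_I, Complex.conj_ofReal]
  push_cast; ring

lemma rpow_mul_exp_bound {κ u : ℝ} (hκ : 0 ≤ κ) (hu : 0 < u) :
    u ^ κ * Real.exp (-(u^2/2)) ≤ Real.exp (κ^2) := by
  rw [Real.rpow_def_of_pos hu, ← Real.exp_add]
  apply Real.exp_le_exp.mpr
  have h1 : Real.log u ≤ u := (Real.log_le_sub_one_of_pos hu).trans (by linarith)
  have h2 : Real.log u * κ ≤ u * κ := mul_le_mul_of_nonneg_right h1 hκ
  nlinarith [sq_nonneg (κ - u/2), sq_nonneg u]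

/-- oscillatory integral with gaussian cutoff -/
lemma osc_gauss {n a : ℝ} (hn : 1 ≤ n) (ha : -(1/2) < a) {f : ℝ → ℂ} (hf : StF 0 n a f) :
    ∃ t0 C : ℝ, 1 ≤ t0 ∧ 0 ≤ C ∧ ∀ x η T : ℝ, 0 < η → t0 ≤ T →
      ‖∫ t in t0..T, f t * (Complex.exp (Complex.I * ((x * t : ℝ) : ℂ)) * (Real.exp (-(η^2*t^2/2)) : ℝ))‖
        ≤ C * η ^ (-(a + 1/2)) := by
  obtain ⟨β, t0, C, h, h1, ht0, hC, H⟩ := hf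
  set κ := a + 1/2 with hκ
  have hκ0 : 0 < κ := by linarith
  set M := 10 * C * (5 + |a|) * ((1/4) ^ (-κ/2) * (1/2) * Real.Gamma (κ/2)) with hM
  have hG : 0 < Real.Gamma (κ/2) := Real.Gamma_pos_of_pos (by positivity)
  have hM0 : 0 ≤ M := by positivity
  refine ⟨t0, 10 * C * Real.exp (κ^2) + M, ht0, by positivity, fun x η T hη hT => ?_⟩
  set J : ℝ → ℂ := fun T => ∫ t in t0..T, Complex.exp (Complex.I * ((n * (t * Real.log t) + (β + x) * t : ℝ) : ℂ)) with hJ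
  set g : ℝ → ℂ := fun t => Complex.exp (Complex.I * ((n * (t * Real.log t) + (β + x) * t : ℝ) : ℂ)) with hg
  have hgc : Continuous g := by
    have : Continuous (fun t : ℝ => t * Real.log t) := Real.continuous_mul_log
    fun_prop
  have hJd : ∀ t, HasDerivAt J (g t) t := fun t => intervalIntegral.integral_hasDerivAt_right
    (hgc.intervalIntegrable _ _) hgc.aestronglyMeasurable.stronglyMeasurableAtFilter hgc.continuousAt
  have hJb : ∀ t, t0 ≤ t → ‖J t‖ ≤ 10 * √t := fun t ht => osc_phase_bound' hn _ ht0 ht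
  set E : ℝ → ℝ := fun t => Real.exp (a * Real.log t - η^2*t^2/2) with hE
  set u : ℝ → ℂ := fun t => h t * (E t : ℝ) with hu
  set u' : ℝ → ℂ := fun t => deriv h t * (E t : ℝ) + h t * ((E t * (a * t⁻¹ - η^2*t) : ℝ) : ℂ) with hu'
  have hp : ∀ t, t0 ≤ t → 0 < t := fun t ht => by linarith
  have hEd : ∀ t, t0 ≤ t → HasDerivAt E (E t * (a * t⁻¹ - η^2*t)) t := by
    intro t ht
    have d1 := (Real.hasDerivAt_log (hp t ht).ne').const_mul a
    have d2 : HasDerivAt (fun t : ℝ => η^2*t^2/2) (η^2*t) t := by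
      have := (((hasDerivAt_id t).pow 2).const_mul (η^2)).div_const 2
      refine this.congr_deriv ?_
      simp; ring
    exact (d1.sub d2).exp
  have hdh : ∀ t, t0 ≤ t → deriv h t = h1 t := fun t ht => (H t ht).1.deriv
  have hud : ∀ t, t0 ≤ t → HasDerivAt u (u' t) t := by
    intro t ht
    have := (H t ht).1
    rw [← hdh t ht] at this
    exact this.mul (hEd t ht).ofReal_comp
  have huIcc : ∀ t ∈ uIcc t0 T, t0 ≤ t := fun t ht => by rw [uIcc_of_le hT] at ht; exact ht.1
  have hEc : ContinuousOn E (uIcc t0 T) := fun t ht => (hEd t (huIcc t ht)).continuousAt.continuousWithinAt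
  have hhc : ContinuousOn h (uIcc t0 T) := fun t ht => (H t (huIcc t ht)).1.continuousAt.continuousWithinAt
  have hu'i : IntervalIntegrable u' volume t0 T := by
    apply IntervalIntegrable.add
    · apply IntervalIntegrable.mul_continuousOn
      · rw [intervalIntegrable_iff_integrableOn_Icc_of_le hT]
        apply Measure.integrableOn_of_bounded (M := C)
        · simp
        · exact (stronglyMeasurable_deriv h).aestronglyMeasurable
        · rw [ae_restrict_iff' measurableSet_Icc]
          refine Eventually.of_forall (fun t ht => ?_)
          rw [hdh t ht.1]
          exact (H t ht.1).2.2.1.trans (div_le_self hC (by linarith [ht.1]))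
      · exact Complex.continuous_ofReal.comp_continuousOn hEc
    · apply ContinuousOn.intervalIntegrable
      apply hhc.mul
      apply Complex.continuous_ofReal.comp_continuousOn
      apply hEc.mul
      apply ContinuousOn.sub
      · apply continuousOn_const.mul
        exact continuousOn_inv₀.mono (fun t ht => (hp t (huIcc t ht)).ne')
      · fun_prop
  have hIBP := intervalIntegral.integral_mul_deriv_eq_deriv_mul (u := u) (v := J) (u' := u') (v' := g)
    (fun t ht => hud t (huIcc t ht)) (fun t _ => hJd t) hu'i (hgc.intervalIntegrable _ _)
  have hJ0 : J t0 = 0 := by simp [hJ]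
  rw [hJ0, mul_zero, sub_zero] at hIBP
  have hcong : ∫ t in t0..T, f t * (Complex.exp (Complex.I * ((x * t : ℝ) : ℂ)) * (Real.exp (-(η^2*t^2/2)) : ℝ)) = ∫ t in t0..T, u t * g t := by
    apply intervalIntegral.integral_congr
    intro t ht
    have := (H t (huIcc t ht)).2.2.2
    simp only [this, hu, hg, hE]
    rw [Complex.ofReal_exp, Complex.ofReal_exp, mul_assoc, mul_assoc, ← Complex.exp_add, ← Complex.exp_add, ← Complex.exp_add]
    congr 2
    push_cast; ring
  rw [hcong, hIBP]
  have hEeq : ∀ t, 0 < t → E t = t ^ a * Real.exp (-(η^2*t^2/2)) := by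
    intro t ht
    rw [Real.rpow_def_of_pos ht, ← Real.exp_add, hE]
    simp only
    congr 1; ring
  have hT0 := hp T hT
  have b1 : ‖u T * J T‖ ≤ 10 * C * Real.exp (κ^2) * η ^ (-κ) := by
    rw [norm_mul, hu]
    simp only
    rw [norm_mul, Complex.norm_real, Real.norm_eq_abs, abs_of_pos (Real.exp_pos _)]
    calc _ ≤ C * E T * (10 * √T) := by
          have := (H T hT).2.1
          have := hJb T hT
          have : 0 ≤ E T := (Real.exp_pos _).le
          gcongr
      _ = 10 * C * ((η * T) ^ κ * Real.exp (-((η*T)^2/2))) * η ^ (-κ) := by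
          rw [hEeq T hT0, Real.sqrt_eq_rpow, Real.mul_rpow hη.le hT0.le, Real.rpow_neg hη.le, hκ, Real.rpow_add hT0]
          have : (η ^ (a + 1/2)) ≠ 0 := by positivity
          field_simp
      _ ≤ _ := by
          have := rpow_mul_exp_bound hκ0.le (mul_pos hη hT0)
          gcongr
  have b2 : ‖∫ t in t0..T, u' t * J t‖ ≤ M * η ^ (-κ) := by
    have hIntg := integrableOn_rpow_mul_exp_neg_mul_sq (b := η^2/4) (by positivity) (s := a - 1/2) (by linarith)
    have hval := integral_rpow_mul_exp_neg_mul_rpow (p := 2) (q := a - 1/2) (b := η^2/4) (by norm_num) (by linarith) (by positivity)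
    have hpt : ∀ t ∈ Ioc t0 T, ‖u' t * J t‖ ≤ 10 * C * (5 + |a|) * (t ^ (a - 1/2) * Real.exp (-(η^2/4) * t^2)) := by
      intro t ht
      have htt := ht.1.le
      have htp := hp t htt
      have e0 : 0 ≤ E t := (Real.exp_pos _).le
      have n1 : ‖u' t‖ ≤ C / t * E t * (1 + |a| + η^2*t^2) := by
        rw [hu']
        simp only
        refine (norm_add_le _ _).trans ?_
        rw [norm_mul, norm_mul, Complex.norm_real, Complex.norm_real, Real.norm_eq_abs, Real.norm_eq_abs, abs_mul, abs_of_pos (Real.exp_pos _), hdh t htt]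
        have k1 := (H t htt).2.1
        have k2 := (H t htt).2.2.1
        have k3 : |a * t⁻¹ - η^2*t| ≤ |a| * t⁻¹ + η^2*t := by
          refine (abs_sub _ _).trans ?_
          rw [abs_mul, abs_of_pos (inv_pos.mpr htp), abs_of_pos (by positivity : 0 < η^2*t)]
        calc _ ≤ C / t * E t + C * (E t * (|a| * t⁻¹ + η^2*t)) := by gcongr
          _ = _ := by field_simp; ring
      rw [norm_mul]
      calc _ ≤ C / t * E t * (1 + |a| + η^2*t^2) * (10 * √t) := by
            have := hJb t htt
            have : 0 ≤ C / t := by positivity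
            gcongr
        _ = 10 * C * t ^ (a - 1/2) * ((1 + |a| + η^2*t^2) * Real.exp (-(η^2*t^2/2))) := by
            rw [hEeq t htp, Real.sqrt_eq_rpow, show a - 1/2 = a + 1/2 - 1 by ring, Real.rpow_sub_one htp.ne', Real.rpow_add htp]
            ring
        _ ≤ 10 * C * t ^ (a - 1/2) * ((5 + |a|) * Real.exp (-(η^2/4) * t^2)) := by
            gcongr ?_ * ?_
            set v := η^2*t^2 with hv
            have hv0 : 0 ≤ v := by positivity
            have : Real.exp (-(v/2)) = Real.exp (-(v/4)) * Real.exp (-(v/4)) := by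
              rw [← Real.exp_add]; congr 1; ring
            rw [show -(η^2/4)*t^2 = -(v/4) by rw [hv]; ring, this, ← mul_assoc]
            gcongr
            rw [Real.exp_neg, ← div_eq_mul_inv, div_le_iff₀ (Real.exp_pos _)]
            have e1 := Real.add_one_le_exp (v/4)
            nlinarith [abs_nonneg a]
        _ = _ := by ring
    refine (intervalIntegral.norm_integral_le_integral_norm hT).trans ?_
    rw [intervalIntegral.integral_of_le hT]
    calc _ ≤ ∫ t in Ioc t0 T, 10 * C * (5 + |a|) * (t ^ (a - 1/2) * Real.exp (-(η^2/4) * t^2)) := by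
          apply setIntegral_mono_on _ _ measurableSet_Ioc hpt
          · have : IntervalIntegrable (fun t => u' t * J t) volume t0 T := by
              apply hu'i.mul_continuousOn
              exact fun t _ => (hJd t).continuousAt.continuousWithinAt
            rw [intervalIntegrable_iff_integrableOn_Ioc_of_le hT] at this
            exact this.norm
          · apply Integrable.const_mul
            exact hIntg.mono_set (fun t ht => by simp; linarith [ht.1])
      _ = 10 * C * (5 + |a|) * ∫ t in Ioc t0 T, (t ^ (a - 1/2) * Real.exp (-(η^2/4) * t^2)) := by
          rw [integral_const_mul]
      _ ≤ 10 * C * (5 + |a|) * ∫ t in Ioi 0, (t ^ (a - 1/2) * Real.exp (-(η^2/4) * t^2)) := by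
          refine mul_le_mul_of_nonneg_left (setIntegral_mono_set hIntg ?_ ?_) (by positivity)
          · rw [EventuallyLE, ae_restrict_iff' measurableSet_Ioi]
            refine Eventually.of_forall (fun t ht => ?_)
            have : (0:ℝ) < t := ht
            simp only [Pi.zero_apply]
            positivity
          · exact HasSubset.Subset.eventuallyLE (fun t ht => by simp; linarith [ht.1])
      _ = 10 * C * (5 + |a|) * ((η^2/4) ^ (-κ / 2) * (1 / 2) * Real.Gamma (κ / 2)) := by
          congr 1
          simp_rw [Real.rpow_two] at hval
          rw [hval, show a - 1/2 + 1 = κ by rw [hκ]; ring]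
      _ = _ := by
          rw [show η^2/4 = η^2 * (1/4) by ring, Real.mul_rpow (by positivity) (by norm_num), ← Real.rpow_natCast, ← Real.rpow_mul hη.le, hM]
          rw [show ((2:ℕ):ℝ) * (-κ/2) = -κ by push_cast; ring]
          ring
  calc _ ≤ 10 * C * Real.exp (κ^2) * η ^ (-κ) + M * η ^ (-κ) := (norm_sub_le _ _).trans (add_le_add b1 b2)
    _ = _ := by ring

end Landau
end

section
open Filter Topology MeasureTheory Set
open scoped BigOperators

namespace Landau

/-- Gaussian decay in a strip -/
def GDecay (a b : ℝ) (F : ℂ → ℂ) : Prop :=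
  ∃ C k d : ℝ, 0 ≤ C ∧ 0 < d ∧ ∀ s : ℂ, a ≤ s.re → s.re ≤ b → 2 ≤ |s.im| →
    ‖F s‖ ≤ C * Real.exp (k * |s.im| - d * s.im ^ 2)

lemma exp_quad_le {k d t : ℝ} (hd : 0 < d) : Real.exp (k * |t| - d * t^2) ≤ Real.exp (k^2/(2*d)) * Real.exp (-(d/2) * t^2) := by
  rw [← Real.exp_add]
  apply Real.exp_le_exp.mpr
  rw [← sq_abs t]
  set x := |t|
  have : k^2/(2*d) + -(d/2) * x^2 - (k * x - d * x^2) = (d * x - k)^2/(2*d) := by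
    field_simp; ring
  have h2 : 0 ≤ (d * x - k)^2/(2*d) := by positivity
  linarith

lemma line_continuous {F : ℂ → ℂ} {σ : ℝ} (hF : ∀ s : ℂ, s.re = σ → ContinuousAt F s) :
    Continuous (fun t : ℝ => F (σ + t * Complex.I)) := by
  rw [continuous_iff_continuousAt]
  intro t
  apply ContinuousAt.comp (f := fun t : ℝ => (σ + t * Complex.I : ℂ)) (g := F)
  · apply hF; simp
  · fun_prop

lemma integrable_of_continuous_decay {f : ℝ → ℂ} (hf : Continuous f) {C k d : ℝ} (hC : 0 ≤ C) (hd : 0 < d)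
    (hb : ∀ t, 2 ≤ |t| → ‖f t‖ ≤ C * Real.exp (k * |t| - d * t ^ 2)) : Integrable f := by
  obtain ⟨M, hM⟩ := (isCompact_Icc (a := (-2:ℝ)) (b := 2)).exists_bound_of_continuousOn hf.continuousOn
  have hM0 : 0 ≤ M := (norm_nonneg _).trans (hM 0 (by simp))
  set C' := C * Real.exp (k^2/(2*d)) + M * Real.exp (d/2 * 4)
  have hi : Integrable (fun t : ℝ => C' * Real.exp (-(d/2) * t^2)) := (integrable_exp_neg_mul_sq (by positivity)).const_mul _
  refine hi.mono' hf.aestronglyMeasurable (Eventually.of_forall fun t => ?_)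
  rcases le_or_gt 2 |t| with h | h
  · refine (hb t h).trans ?_
    calc _ ≤ C * (Real.exp (k^2/(2*d)) * Real.exp (-(d/2) * t^2)) := by
          gcongr; exact exp_quad_le hd
      _ = (C * Real.exp (k^2/(2*d))) * Real.exp (-(d/2) * t^2) := by ring
      _ ≤ _ := by
        gcongr
        have : 0 ≤ M * Real.exp (d/2 * 4) := by positivity
        linarith
  · have ht := abs_lt.mp h
    refine (hM t ⟨ht.1.le, ht.2.le⟩).trans ?_
    calc M ≤ M * (Real.exp (d/2*4) * Real.exp (-(d/2) * t^2)) := by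
          apply le_mul_of_one_le_right hM0
          rw [← Real.exp_add]
          apply Real.one_le_exp
          have : t^2 ≤ 4 := by nlinarith
          nlinarith
      _ = M * Real.exp (d/2*4) * Real.exp (-(d/2) * t^2) := by ring
      _ ≤ _ := by
        gcongr
        have : 0 ≤ C * Real.exp (k^2/(2*d)) := by positivity
        linarith

lemma GDecay.integrable {a b : ℝ} {F : ℂ → ℂ} (hF : GDecay a b F) {σ : ℝ} (h1 : a ≤ σ) (h2 : σ ≤ b)
    (hc : ∀ s : ℂ, s.re = σ → ContinuousAt F s) : Integrable (fun t : ℝ => F (σ + t * Complex.I)) := by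
  obtain ⟨C, k, d, hC, hd, H⟩ := hF
  refine integrable_of_continuous_decay (line_continuous hc) hC hd (k := k) (fun t ht => ?_)
  have := H (σ + t * Complex.I) (by simpa using h1) (by simpa using h2) (by simpa using ht)
  simpa using this

theorem line_shift {a b : ℝ} (hab : a ≤ b) {F : ℂ → ℂ} (hF : GDecay a b F)
    (hd : ∀ s : ℂ, a ≤ s.re → s.re ≤ b → DifferentiableAt ℂ F s) :
    ∫ t : ℝ, F (a + t * Complex.I) = ∫ t : ℝ, F (b + t * Complex.I) := by
  have ia := hF.integrable le_rfl hab (fun s hs => (hd s hs.ge (hs ▸ hab)).continuousAt)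
  have ib := hF.integrable hab le_rfl (fun s hs => (hd s (hs ▸ hab) hs.le).continuousAt)
  have la := intervalIntegral_tendsto_integral ia tendsto_neg_atTop_atBot tendsto_id
  have lb := intervalIntegral_tendsto_integral ib tendsto_neg_atTop_atBot tendsto_id
  obtain ⟨C, k, d, hC, hd0, H⟩ := hF
  have hdiff := la.sub lb
  have hz : Tendsto (fun T : ℝ => (∫ t in (-T)..T, F (a + t * Complex.I)) - ∫ t in (-T)..T, F (b + t * Complex.I)) atTop (𝓝 0) := by
    have hbd : ∀ T : ℝ, 2 ≤ T → ‖(∫ t in (-T)..T, F (a + t * Complex.I)) - ∫ t in (-T)..T, F (b + t * Complex.I)‖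
        ≤ 2 * ((C * Real.exp (k^2/(2*d))) * Real.exp (-(d/2) * T^2) * |b - a|) := by
      intro T hT
      have hrect := Complex.integral_boundary_rect_eq_zero_of_differentiableOn F (a - T * Complex.I) (b + T * Complex.I) (by
        intro s hs
        rw [Complex.mem_reProdIm] at hs
        simp at hs
        have := hs.1
        rw [uIcc_of_le hab] at this
        exact (hd s this.1 this.2).differentiableWithinAt)
      simp at hrect
      have e : (∫ t in (-T)..T, F (a + t * Complex.I)) - ∫ t in (-T)..T, F (b + t * Complex.I) =
         -Complex.I * ((∫ x in a..b, F (x + -(T * Complex.I))) - ∫ x in a..b, F (x + T * Complex.I)) := by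
        have : Complex.I * ((∫ t in (-T)..T, F (a + t * Complex.I)) - ∫ t in (-T)..T, F (b + t * Complex.I)) = (∫ x in a..b, F (x + -(T * Complex.I))) - ∫ x in a..b, F (x + T * Complex.I) := by
          linear_combination -hrect
        rw [← this, ← mul_assoc]
        simp
      rw [e, norm_mul, norm_neg, Complex.norm_I, one_mul]
      have hpt : ∀ (T' : ℝ), |T'| = T → ∀ x ∈ uIoc a b, ‖F (x + T' * Complex.I)‖ ≤ (C * Real.exp (k^2/(2*d))) * Real.exp (-(d/2) * T^2) := by
        intro T' hT' x hx
        rw [uIoc_of_le hab] at hx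
        have := H (x + T' * Complex.I) (by simpa using hx.1.le) (by simpa using hx.2) (by simpa [hT'] using hT)
        refine this.trans ?_
        rw [mul_assoc]
        gcongr
        refine (exp_quad_le hd0).trans (le_of_eq ?_)
        simp
        left
        rw [← hT', sq_abs]
      have b1 := intervalIntegral.norm_integral_le_of_norm_le_const (hpt T (abs_of_pos (by linarith)))
      have b2 := intervalIntegral.norm_integral_le_of_norm_le_const (hpt (-T) (by rw [abs_neg]; exact abs_of_pos (by linarith)))
      refine (norm_sub_le _ _).trans ?_
      rw [two_mul]
      refine add_le_add (le_trans (le_of_eq ?_) b2) b1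
      congr 2
      ext x
      push_cast
      ring_nf
    rw [tendsto_zero_iff_norm_tendsto_zero]
    refine squeeze_zero' (Eventually.of_forall fun _ => norm_nonneg _) ((eventually_ge_atTop 2).mono hbd) ?_
    have : Tendsto (fun T : ℝ => Real.exp (-(d/2) * T^2)) atTop (𝓝 0) := by
      apply Real.tendsto_exp_atBot.comp
      apply Tendsto.const_mul_atTop_of_neg (by linarith)
      exact tendsto_pow_atTop (by norm_num)
    have := (((this.const_mul (C * Real.exp (k^2/(2*d)))).mul_const |b - a|).const_mul 2)
    simpa using this
  have := tendsto_nhds_unique hdiff hz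
  exact sub_eq_zero.mp this

/-- the gaussian weight -/
noncomputable def gw (v η : ℝ) (s : ℂ) : ℂ := Complex.exp (v * s + η^2 * s^2/2)

lemma norm_gw (v η : ℝ) (s : ℂ) : ‖gw v η s‖ = Real.exp (v * s.re + η^2 * s.re^2/2 - η^2 * s.im^2/2) := by
  rw [gw, Complex.norm_exp]
  congr 1
  have : (η^2 * s^2/2 : ℂ) = ((η^2/2 : ℝ) : ℂ) * (s * s) := by push_cast; ring
  rw [this, Complex.add_re, Complex.re_ofReal_mul, Complex.re_ofReal_mul, Complex.mul_re]
  ring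

lemma gw_differentiable (v η : ℝ) : Differentiable ℂ (gw v η) := by
  unfold gw; fun_prop

lemma gw_add (v w η : ℝ) (s : ℂ) : gw (v + w) η s = Complex.exp (w * s) * gw v η s := by
  rw [gw, gw, ← Complex.exp_add]; congr 1; push_cast; ring

lemma gw_shift (v η p : ℝ) (s : ℂ) : gw v η (s + p) = gw v η p * gw (v + p * η^2) η s := by
  rw [gw, gw, gw, ← Complex.exp_add]; congr 1; push_cast; ring

lemma gw_decay {F : ℂ → ℂ} {a b C k : ℝ} (hC : 0 ≤ C) (v : ℝ) {η : ℝ} (hη : 0 < η)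
    (hF : ∀ s : ℂ, a ≤ s.re → s.re ≤ b → 2 ≤ |s.im| → ‖F s‖ ≤ C * Real.exp (k * |s.im|)) :
    GDecay a b (fun s => F s * gw v η s) := by
  set m := max |a| |b|
  refine ⟨C * Real.exp (|v| * m + η^2 * m^2/2), k, η^2/2, by positivity, by positivity, fun s h1 h2 h3 => ?_⟩
  rw [norm_mul, norm_gw]
  have hre : |s.re| ≤ m := by
    rw [abs_le]
    constructor
    · have := (neg_abs_le a); have := le_max_left |a| |b|; linarith
    · have := (le_abs_self b); have := le_max_right |a| |b|; linarith
  have hm0 : 0 ≤ m := (abs_nonneg _).trans hre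
  have e1 : v * s.re ≤ |v| * m := by
    calc v * s.re ≤ |v * s.re| := le_abs_self _
      _ = |v| * |s.re| := abs_mul _ _
      _ ≤ _ := by gcongr
  have e2 : s.re^2 ≤ m^2 := by rw [← sq_abs s.re]; gcongr
  calc _ ≤ (C * Real.exp (k * |s.im|)) * Real.exp (|v| * m + η^2 * m^2/2 - η^2 * s.im^2/2) := by
        gcongr
        exact hF s h1 h2 h3
    _ = _ := by
        rw [mul_assoc, mul_assoc, ← Real.exp_add, ← Real.exp_add]
        congr 2; ring

/-- The gaussian distribution function -/
noncomputable def Phi (η v : ℝ) : ℝ := ∫ u in Ioi (0:ℝ), 1 / (η * √(2 * Real.pi)) * Real.exp (-(v - u)^2/(2*η^2))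

lemma gw_line_integral (w b : ℝ) {η : ℝ} (hη : 0 < η) :
    ∫ t : ℝ, gw w η (b + t * Complex.I) = (√(2 * Real.pi) / η * Real.exp (-w^2/(2*η^2)) : ℝ) := by
  have h := integral_cexp_quadratic (b := -(η^2/2 : ℝ)) (by
    rw [Complex.neg_re, Complex.ofReal_re]; have : 0 < η^2/2 := by positivity
    linarith) (Complex.I * (w + η^2 * b)) (w * b + η^2 * b^2/2)
  have e : ∀ t : ℝ, gw w η (b + t * Complex.I) = Complex.exp (-(η^2/2 : ℝ) * t^2 + (Complex.I * (w + η^2 * b)) * t + (w * b + η^2 * b^2/2)) := by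
    intro t
    rw [gw]; congr 1
    push_cast
    ring_nf
    rw [Complex.I_sq]; ring
  simp_rw [e]
  rw [h]
  have hηc : (η:ℂ) ≠ 0 := by exact_mod_cast hη.ne'
  push_cast
  congr 1
  · rw [neg_neg]
    have : (Real.pi / (η^2/2) : ℂ) = ((2 * Real.pi / η^2 : ℝ) : ℂ) := by push_cast; field_simp
    rw [this, show (1/2 : ℂ) = ((1/2 : ℝ) : ℂ) by push_cast; rfl, ← Complex.ofReal_cpow (by positivity), ← Real.sqrt_eq_rpow, Real.sqrt_div (by positivity), Real.sqrt_sq hη.le]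
    push_cast; rfl
  · congr 1
    field_simp
    rw [Complex.I_sq]
    ring

theorem perron_pos {b : ℝ} (hb : 0 < b) (v : ℝ) {η : ℝ} (hη : 0 < η) :
    ∫ t : ℝ, gw v η (b + t * Complex.I) / (b + t * Complex.I) = 2 * Real.pi * Phi η v := by
  have h1 : ∀ t : ℝ, gw v η (b + t * Complex.I) / (b + t * Complex.I) =
      ∫ u in Ioi (0:ℝ), gw (v - u) η (b + t * Complex.I) := by
    intro t
    have hi := integral_exp_mul_complex_Ioi (a := -(b + t * Complex.I)) (by simp [hb]) 0
    have e : ∀ u : ℝ, gw (v - u) η (b + t * Complex.I) = Complex.exp (-(b + t * Complex.I) * u) * gw v η (b + t * Complex.I) := by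
      intro u
      rw [sub_eq_add_neg, gw_add]
      congr 2; push_cast; ring
    simp_rw [e]
    rw [integral_mul_const, hi]
    rw [Complex.ofReal_zero, mul_zero, Complex.exp_zero, neg_div_neg_eq]
    ring
  simp_rw [h1]
  rw [integral_integral_swap]
  · simp_rw [gw_line_integral _ _ hη]
    rw [integral_complex_ofReal, Phi]
    rw [← Complex.ofReal_ofNat, ← Complex.ofReal_mul, ← Complex.ofReal_mul, ← integral_const_mul]
    congr 2
    ext u
    rw [← mul_assoc]
    congr 1
    have hpi : (0:ℝ) < 2 * Real.pi := by positivity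
    have : √(2 * Real.pi) * √(2 * Real.pi) = 2 * Real.pi := Real.mul_self_sqrt hpi.le
    field_simp
    linarith
  · -- integrability on the product
    have hi1 : Integrable (fun t : ℝ => Real.exp (-(η^2/2) * t^2)) := integrable_exp_neg_mul_sq (by positivity)
    have hi2 : Integrable (fun u : ℝ => Real.exp (-b * u)) (volume.restrict (Ioi 0)) := integrableOn_exp_mul_Ioi (by linarith) 0
    have hp := (hi1.mul_prod hi2).const_mul (Real.exp (v * b + η^2*b^2/2))
    refine hp.mono' ?_ (Eventually.of_forall fun z => ?_)
    · apply Continuous.aestronglyMeasurable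
      unfold gw Function.uncurry
      fun_prop
    · simp only [Function.uncurry]
      rw [norm_gw]
      rw [← Real.exp_add, ← Real.exp_add]
      apply le_of_eq
      congr 1
      simp
      ring

end Landau
end

section
open Filter Topology MeasureTheory Set
open scoped BigOperators

namespace Landau

lemma Phi_density_integral (v : ℝ) {η : ℝ} (hη : 0 < η) :
    Integrable (fun u : ℝ => 1 / (η * √(2 * Real.pi)) * Real.exp (-(v - u)^2/(2*η^2))) ∧
    ∫ u : ℝ, 1 / (η * √(2 * Real.pi)) * Real.exp (-(v - u)^2/(2*η^2)) = 1 := by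
  have e : (fun u : ℝ => 1 / (η * √(2 * Real.pi)) * Real.exp (-(v - u)^2/(2*η^2))) =
     fun u => (fun x => 1 / (η * √(2 * Real.pi)) * Real.exp (-(1/(2*η^2)) * x^2)) (v - u) := by
    ext u; simp only; congr 2; ring
  have hi : Integrable (fun x : ℝ => 1 / (η * √(2 * Real.pi)) * Real.exp (-(1/(2*η^2)) * x^2)) :=
    (integrable_exp_neg_mul_sq (by positivity)).const_mul _
  rw [e]
  refine ⟨hi.comp_sub_left v, ?_⟩
  rw [integral_sub_left_eq_self (fun x => 1 / (η * √(2 * Real.pi)) * Real.exp (-(1/(2*η^2)) * x^2)), integral_const_mul, integral_gaussian]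
  rw [show Real.pi / (1 / (2*η^2)) = η^2 * (2 * Real.pi) by field_simp, Real.sqrt_mul (sq_nonneg η), Real.sqrt_sq hη.le]
  have : √(2 * Real.pi) ≠ 0 := by positivity
  field_simp

lemma Phi_add_neg (v : ℝ) {η : ℝ} (hη : 0 < η) : Phi η v + Phi η (-v) = 1 := by
  obtain ⟨hi, h1⟩ := Phi_density_integral v hη
  have : Phi η (-v) = ∫ u in Iic (0:ℝ), 1 / (η * √(2 * Real.pi)) * Real.exp (-(v - u)^2/(2*η^2)) := by
    rw [Phi]
    have := integral_comp_neg_Ioi (0:ℝ) (fun u => 1 / (η * √(2 * Real.pi)) * Real.exp (-(v - u)^2/(2*η^2)))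
    rw [neg_zero] at this
    rw [← this]
    congr 1; ext u
    congr 3; ring
  rw [← integral_add_compl (measurableSet_Ioi (a := (0:ℝ))) hi, compl_Ioi] at h1
  rw [this, Phi, h1]

theorem perron_neg {b : ℝ} (hb : b < 0) (v : ℝ) {η : ℝ} (hη : 0 < η) :
    ∫ t : ℝ, gw v η (b + t * Complex.I) / (b + t * Complex.I) = 2 * Real.pi * (Phi η v - 1) := by
  have h := perron_pos (b := -b) (by linarith) (-v) hη
  rw [← integral_neg_eq_self]
  have e : ∀ t : ℝ, gw v η (b + (-t : ℝ) * Complex.I) / (b + (-t : ℝ) * Complex.I) =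
     - (gw (-v) η ((-b : ℝ) + t * Complex.I) / ((-b : ℝ) + t * Complex.I)) := by
    intro t
    have e2 : ((-b : ℝ) + t * Complex.I : ℂ) = -(b + (-t : ℝ) * Complex.I) := by push_cast; ring
    rw [e2, div_neg, neg_neg]
    congr 1
    rw [gw, gw]; congr 1; push_cast; ring
  simp_rw [e]
  rw [integral_neg, h]
  have := Phi_add_neg v hη
  have h2 : ((Phi η (-v) : ℝ) : ℂ) = 1 - Phi η v := by
    have := congrArg (fun x : ℝ => (x : ℂ)) this
    push_cast at this
    linear_combination this
  rw [h2]; ring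

lemma perron_integrable {b : ℝ} (hb : b ≠ 0) (v : ℝ) {η : ℝ} (hη : 0 < η) :
    Integrable (fun t : ℝ => gw v η (b + t * Complex.I) / (b + t * Complex.I)) := by
  have hd : GDecay b b (fun s => s⁻¹ * gw v η s) := by
    refine gw_decay (C := 1) (k := 0) zero_le_one v hη (fun s _ _ h => ?_)
    have : 2 ≤ ‖s‖ := h.trans (Complex.abs_im_le_norm s)
    rw [norm_inv]
    simp
    exact inv_le_one_of_one_le₀ (by linarith)
  have := hd.integrable le_rfl le_rfl (fun s hs => by
    have hs0 : s ≠ 0 := fun h => hb (by rw [← hs, h]; simp)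
    exact (continuousAt_id.inv₀ hs0).mul (gw_differentiable v η).continuous.continuousAt)
  refine this.congr (Eventually.of_forall fun t => ?_)
  simp only; ring

theorem pole_shift {a b p : ℝ} (hap : a < p) (hpb : p < b) {H : ℂ → ℂ} (hH : Differentiable ℂ H)
    {C k : ℝ} (hk : 0 ≤ k)
    (hb : ∀ s : ℂ, a ≤ s.re → s.re ≤ b → 2 ≤ |s.im| → ‖H s‖ ≤ C * Real.exp (k * |s.im|))
    (v : ℝ) {η : ℝ} (hη : 0 < η) :
    (∫ t : ℝ, H (b + t * Complex.I) * gw v η (b + t * Complex.I) / (b + t * Complex.I - p)) -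
    (∫ t : ℝ, H (a + t * Complex.I) * gw v η (a + t * Complex.I) / (a + t * Complex.I - p)) =
      2 * Real.pi * (H p * gw v η p) := by
  have hdec : GDecay a b (fun s => dslope H p s * gw v η s) := by
    refine gw_decay (C := |C| + ‖H p‖) (k := k) (by positivity) v hη (fun s h1 h2 h3 => ?_)
    have hsp : s ≠ p := by
      intro h; rw [h] at h3; simp at h3; linarith
    rw [dslope_of_ne _ hsp, slope_def_field, norm_div]
    have hn : 1 ≤ ‖s - p‖ := by
      have := Complex.abs_im_le_norm (s - p)
      simp at this; linarith
    refine (div_le_self (norm_nonneg _) hn).trans ((norm_sub_le _ _).trans ?_)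
    have h4 := hb s h1 h2 h3
    have h5 : C * Real.exp (k * |s.im|) ≤ |C| * Real.exp (k * |s.im|) := by gcongr; exact le_abs_self C
    have h6 : ‖H p‖ * 1 ≤ ‖H p‖ * Real.exp (k * |s.im|) := by
      gcongr; exact Real.one_le_exp (by positivity)
    rw [add_mul]; linarith
  have hdd : Differentiable ℂ (dslope H p) := by
    rw [← differentiableOn_univ] at hH ⊢
    exact (Complex.differentiableOn_dslope univ_mem).mpr hH
  have hfd : Differentiable ℂ (fun s => dslope H p s * gw v η s) := hdd.mul (gw_differentiable v η)
  have hshift := line_shift (hap.trans hpb).le hdec (fun s _ _ => hfd s)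
  have key : ∀ c : ℝ, a ≤ c → c ≤ b → c ≠ p →
      ∫ t : ℝ, H (c + t * Complex.I) * gw v η (c + t * Complex.I) / (c + t * Complex.I - p) =
      (∫ t : ℝ, dslope H p (c + t * Complex.I) * gw v η (c + t * Complex.I)) +
        H p * gw v η p * ∫ t : ℝ, gw (v + p * η^2) η ((c - p : ℝ) + t * Complex.I) / ((c - p : ℝ) + t * Complex.I) := by
    intro c h1 h2 hc
    rw [← integral_const_mul, ← integral_add]
    · congr 1
      ext t
      have hsp : (c + t * Complex.I : ℂ) ≠ p := by
        intro h; apply hc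
        have := congrArg Complex.re h
        simpa using this
      have hsp' : (c + t * Complex.I - p: ℂ) ≠ 0 := sub_ne_zero.mpr hsp
      rw [dslope_of_ne _ hsp, slope_def_field]
      have e : (c + t * Complex.I : ℂ) = ((c - p : ℝ) + t * Complex.I) + p := by push_cast; ring
      have e3 : ((c - p : ℝ) + t * Complex.I : ℂ) = c + t * Complex.I - p := by push_cast; ring
      have e2 := gw_shift v η p ((c - p : ℝ) + t * Complex.I)
      rw [← e] at e2
      rw [mul_div_assoc', mul_assoc (H p), ← e2, e3]
      field_simp
      ring
    · exact hdec.integrable h1 h2 (fun s _ => (hfd s).continuousAt)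
    · exact (perron_integrable (sub_ne_zero.mpr hc) _ hη).const_mul _
  rw [key a le_rfl (hap.trans hpb).le hap.ne, key b (hap.trans hpb).le le_rfl hpb.ne', hshift,
    perron_pos (by linarith) _ hη, perron_neg (by linarith) _ hη]
  ring

open ProbabilityTheory in
/-- `Phi` through the standard gaussian measure. -/
lemma Phi_eq_gaussian (v : ℝ) {η : ℝ} (hη : 0 < η) :
    Phi η v = ∫ z, (Ioi (0:ℝ)).indicator (fun _ => (1:ℝ)) (v - η * z) ∂(gaussianReal 0 1) := by
  rw [integral_gaussianReal_eq_integral_smul (by norm_num)]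
  have h1 : ∀ z : ℝ, gaussianPDFReal 0 1 z • (Ioi (0:ℝ)).indicator (fun _ => (1:ℝ)) (v - η * z)
     = (fun y => (Ioi (0:ℝ)).indicator (fun u => 1 / √(2 * Real.pi) * Real.exp (-(v - u)^2/(2*η^2))) (v - y)) (η * z) := by
    intro z
    simp only [indicator, mem_Ioi, smul_eq_mul, gaussianPDFReal]
    split_ifs
    · simp
      left
      field_simp
    · simp
  simp_rw [h1]
  rw [Measure.integral_comp_mul_left (fun y => (Ioi (0:ℝ)).indicator (fun u => 1 / √(2 * Real.pi) * Real.exp (-(v - u)^2/(2*η^2))) (v - y)), integral_sub_left_eq_self (fun y => (Ioi (0:ℝ)).indicator (fun u => 1 / √(2 * Real.pi) * Real.exp (-(v - u)^2/(2*η^2))) y),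
    integral_indicator measurableSet_Ioi, Phi, abs_of_pos (by positivity), smul_eq_mul, ← integral_const_mul]
  congr 1; ext u
  rw [← mul_assoc]
  congr 1
  field_simp

end Landau
end

section
open Filter Topology MeasureTheory Set
open scoped BigOperators

namespace Landau

lemma norm_Gamma_le {z : ℂ} (hz : 0 < z.re) : ‖Complex.Gamma z‖ ≤ Real.Gamma z.re := by
  rw [Complex.Gamma_eq_integral hz, Complex.GammaIntegral, Real.Gamma_eq_integral hz]
  refine (norm_integral_le_integral_norm _).trans (le_of_eq ?_)
  apply setIntegral_congr_fun measurableSet_Ioi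
  intro x hx
  have hx' : (0:ℝ) < x := hx
  simp only
  rw [norm_mul, Complex.norm_real, Real.norm_eq_abs, abs_of_pos (Real.exp_pos _), Complex.norm_cpow_eq_rpow_re_of_pos hx']
  simp

lemma Gamma_bdd {α β : ℝ} (hα : 0 < α) : ∃ C : ℝ, 0 < C ∧ ∀ z : ℂ, α ≤ z.re → z.re ≤ β → ‖Complex.Gamma z‖ ≤ C := by
  have hc : ContinuousOn Real.Gamma (Icc α β) := by
    intro x hx
    have : DifferentiableAt ℝ Real.Gamma x := Real.differentiableAt_Gamma (fun m h => by
      have := hx.1; have : (0:ℝ) ≤ m := Nat.cast_nonneg m; linarith)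
    exact this.continuousAt.continuousWithinAt
  obtain ⟨M, hM⟩ := isCompact_Icc.exists_bound_of_continuousOn hc
  refine ⟨max M 1, by positivity, fun z h1 h2 => ?_⟩
  refine (norm_Gamma_le (by linarith)).trans ((le_abs_self _).trans ((hM z.re ⟨h1, h2⟩).trans (le_max_left _ _)))

lemma norm_sin_le (z : ℂ) : ‖Complex.sin z‖ ≤ Real.exp |z.im| := by
  rw [Complex.sin]
  rw [norm_div, norm_mul, Complex.norm_I, mul_one]
  have h1 : ‖Complex.exp (-z * Complex.I)‖ ≤ Real.exp |z.im| := by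
    rw [Complex.norm_exp]; apply Real.exp_le_exp.mpr; simp; exact le_abs_self _
  have h2 : ‖Complex.exp (z * Complex.I)‖ ≤ Real.exp |z.im| := by
    rw [Complex.norm_exp]; apply Real.exp_le_exp.mpr; simp; exact neg_le_abs _
  have h3 : ‖(2:ℂ)‖ = 2 := by norm_num
  rw [h3, div_le_iff₀ (by norm_num)]
  refine (norm_sub_le _ _).trans (by linarith)

lemma inv_Gamma_bdd : ∃ C : ℝ, 0 < C ∧ ∀ z : ℂ, -1 ≤ z.re → z.re ≤ 5/2 → 1 ≤ |z.im| →
    ‖(Complex.Gamma z)⁻¹‖ ≤ C * Real.exp (Real.pi * |z.im|) := by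
  obtain ⟨C, hC, H⟩ := Gamma_bdd (α := 1/2) (β := 4) (by norm_num)
  refine ⟨C, hC, fun z h1 h2 h3 => ?_⟩
  have him : z.im ≠ 0 := by intro h; rw [h] at h3; simp at h3; linarith
  have z1 : z - 1 ≠ 0 := by intro h; apply him; have := congrArg Complex.im h; simpa using this
  have z2 : z - 2 ≠ 0 := by intro h; apply him; have := congrArg Complex.im h; simpa using this
  have g1 := Complex.Gamma_add_one (z - 2) z2
  have g2 := Complex.Gamma_add_one (z - 1) z1
  rw [show z - 2 + 1 = z - 1 by ring] at g1
  rw [show z - 1 + 1 = z by ring, g1] at g2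
  have hr := Complex.Gamma_mul_Gamma_one_sub (z - 2)
  have hsin : Complex.sin (Real.pi * (z - 2)) ≠ 0 := by
    rw [Complex.sin_ne_zero_iff]
    intro k hk
    apply him
    have hpi : (Real.pi : ℂ) ≠ 0 := by exact_mod_cast Real.pi_ne_zero
    have : z - 2 = k := by
      apply mul_left_cancel₀ hpi; rw [hk]; ring
    have := congrArg Complex.im this
    simpa using this
  have hpi : (Real.pi : ℂ) ≠ 0 := by exact_mod_cast Real.pi_ne_zero
  have hG0 : Complex.Gamma (z - 2) ≠ 0 := by
    intro h; rw [h, zero_mul] at hr; exact (div_ne_zero hpi hsin) hr.symm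
  have e : (Complex.Gamma z)⁻¹ = Complex.Gamma (3 - z) * Complex.sin (Real.pi * (z - 2)) / Real.pi / ((z - 1) * (z - 2)) := by
    rw [g2, show 3 - z = 1 - (z - 2) by ring]
    have : Complex.Gamma (1 - (z-2)) = Real.pi / Complex.sin (Real.pi * (z - 2)) / Complex.Gamma (z - 2) := by
      rw [← hr]; field_simp
    rw [this]
    generalize Complex.sin (Real.pi * (z - 2)) = S at hsin
    field_simp
  rw [e, norm_div, norm_div, norm_mul, norm_mul]
  have n1 : 1 ≤ ‖z - 1‖ := h3.trans (by simpa using Complex.abs_im_le_norm (z - 1))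
  have n2 : 1 ≤ ‖z - 2‖ := h3.trans (by simpa using Complex.abs_im_le_norm (z - 2))
  have n3 : 1 ≤ ‖z - 1‖ * ‖z - 2‖ := by nlinarith
  have n4 : 1 ≤ ‖(Real.pi : ℂ)‖ := by
    rw [Complex.norm_real, Real.norm_eq_abs, abs_of_pos Real.pi_pos]; linarith [Real.pi_gt_three]
  refine (div_le_self (by positivity) n3).trans ((div_le_self (by positivity) n4).trans ?_)
  gcongr
  · apply H <;> simp <;> linarith
  · refine (norm_sin_le _).trans (Real.exp_le_exp.mpr (le_of_eq ?_))
    simp [abs_mul, abs_of_pos Real.pi_pos]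

lemma StF.sin (x : ℝ) {q : ℝ} (hq : 0 < q) : StF q 0 0 (fun t => Complex.sin (x - Complex.I * (q * t : ℝ))) := by
  refine ⟨0, 1, 1 + (q * 2 + 1), fun t => (Complex.exp (Complex.I * x) - (Real.exp (-(2 * q * t)) : ℝ) * Complex.exp (-(Complex.I * x))) / (2 * Complex.I),
    fun t => (-((Real.exp (-(2 * q * t)) * (-(2 * q)) : ℝ) * Complex.exp (-(Complex.I * x)))) / (2 * Complex.I), le_rfl, by positivity, fun t ht => ⟨?_, ?_, ?_, ?_⟩⟩
  · apply HasDerivAt.div_const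
    have d1 : HasDerivAt (fun t : ℝ => Real.exp (-(2 * q * t))) (Real.exp (-(2 * q * t)) * (-(2 * q))) t := by
      have : HasDerivAt (fun t : ℝ => -(2 * q * t)) (-(2 * q)) t := by
        have := ((hasDerivAt_id t).const_mul (2*q)).fun_neg
        simpa using this
      exact this.exp
    have := (d1.ofReal_comp.mul_const (Complex.exp (-(Complex.I * x)))).const_sub (Complex.exp (Complex.I * x))
    exact this
  · have e1 : ‖Complex.exp (Complex.I * x)‖ = 1 := by rw [Complex.norm_exp]; simp
    have e2 : ‖Complex.exp (-(Complex.I * x))‖ = 1 := by rw [Complex.norm_exp]; simp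
    rw [norm_div]
    have : ‖(2 * Complex.I : ℂ)‖ = 2 := by simp
    rw [this, div_le_iff₀ (by norm_num)]
    refine (norm_sub_le _ _).trans ?_
    rw [norm_mul, e1, e2, Complex.norm_real, Real.norm_eq_abs, abs_of_pos (Real.exp_pos _), mul_one]
    have : Real.exp (-(2*q*t)) ≤ 1 := Real.exp_le_one_iff.mpr (by simp; positivity)
    linarith
  · have e2 : ‖Complex.exp (-(Complex.I * x))‖ = 1 := by rw [Complex.norm_exp]; simp
    have : ‖(2 * Complex.I : ℂ)‖ = 2 := by simp
    rw [norm_div, this, norm_neg, norm_mul, e2, mul_one, Complex.norm_real, Real.norm_eq_abs, abs_mul, abs_of_pos (Real.exp_pos _), abs_neg, abs_of_pos (by positivity)]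
    have h1 : Real.exp (-(2*q*t)) * (2 * q * t) ≤ 1 := by
      rw [Real.exp_neg, inv_mul_le_iff₀ (Real.exp_pos _), mul_one]
      linarith [Real.add_one_le_exp (2*q*t)]
    rw [le_div_iff₀ (by linarith)]
    calc _ = (Real.exp (-(2*q*t)) * (2 * q * t)) / 2 := by ring
      _ ≤ _ := by linarith
  · simp only
    rw [Complex.sin]
    have e1 : -(x - Complex.I * (q * t : ℝ)) * Complex.I = -(Complex.I * x) + ((-(q * t) : ℝ) : ℂ) := by
      push_cast; ring_nf; rw [Complex.I_sq]; ring
    have e2 : (x - Complex.I * (q * t : ℝ)) * Complex.I = (Complex.I * x) + ((q * t : ℝ) : ℂ) := by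
      push_cast; ring_nf; rw [Complex.I_sq]; ring
    rw [e1, e2, Complex.exp_add, Complex.exp_add]
    have e3 : Complex.exp (((-(q * t) : ℝ) : ℂ)) = Complex.exp ((-(2 * q * t) : ℝ) : ℂ) * Complex.exp ((q * t : ℝ) : ℂ) := by
      rw [← Complex.exp_add]; congr 1; push_cast; ring
    rw [e3, Complex.ofReal_exp]
    simp only [zero_mul, add_zero, Complex.ofReal_zero, mul_zero]
    field_simp
    rw [Complex.I_sq]; ring

lemma StF.inv_line {c : ℝ} (hc : c ≠ 0) : StF 0 0 (-1) (fun t => (c - Complex.I * t)⁻¹) := by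
  have hne : ∀ t : ℝ, (c - Complex.I * t : ℂ) ≠ 0 := by
    intro t h; apply hc; have := congrArg Complex.re h; simpa using this
  have hn : ∀ t : ℝ, 0 < t → t ≤ ‖(c - Complex.I * t : ℂ)‖ := by
    intro t ht
    have := Complex.abs_im_le_norm (c - Complex.I * t : ℂ)
    simpa [abs_of_pos ht] using this
  refine ⟨0, 1, 1 + |c|, fun t => t / (c - Complex.I * t), fun t => (1 * (c - Complex.I * t) - t * (-Complex.I)) / (c - Complex.I * t)^2, le_rfl, by positivity, fun t ht => ⟨?_, ?_, ?_, ?_⟩⟩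
  · have d5 : HasDerivAt (fun t : ℝ => (t : ℂ)) 1 t := Complex.ofRealCLM.hasDerivAt (x := t)
    have d6 : HasDerivAt (fun t : ℝ => (c - Complex.I * t : ℂ)) (-Complex.I) t := by
      simpa using (d5.const_mul Complex.I).const_sub (c:ℂ)
    exact d5.div d6 (hne t)
  · have := hn t (by linarith)
    rw [norm_div, Complex.norm_real, Real.norm_eq_abs, abs_of_pos (by linarith)]
    have h1 : t / ‖(c - Complex.I * t : ℂ)‖ ≤ 1 := div_le_one_of_le₀ this (norm_nonneg _)
    linarith [abs_nonneg c]
  · have h1 := hn t (by linarith)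
    simp only
    rw [show (1 * (c - Complex.I * t) - t * (-Complex.I) : ℂ) = c by ring, norm_div, norm_pow, Complex.norm_real, Real.norm_eq_abs]
    have h2 : t ≤ ‖(c - Complex.I * t : ℂ)‖^2 := by nlinarith
    gcongr
    linarith
  · have htc : (t:ℂ) ≠ 0 := by exact_mod_cast (by linarith : t ≠ 0)
    simp only [zero_mul, add_zero, Complex.ofReal_zero, mul_zero, zero_add]
    rw [Complex.ofReal_mul, Complex.ofReal_neg, Complex.ofReal_one, neg_one_mul, Complex.exp_neg, ← Complex.ofReal_exp, Real.exp_log (by linarith)]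
    have := hne t
    field_simp

/-- gamma factor -/
noncomputable def gam (r1 r2 : ℕ) (b : ℝ) (s : ℂ) : ℂ :=
  (b:ℂ)^s * Complex.Gamma (s/2)^r1 * Complex.Gamma s^r2

/-- quotient of gamma factors -/
noncomputable def GK (r1 r2 : ℕ) (b : ℝ) (s : ℂ) : ℂ :=
  (b:ℂ)^(1 - 2*s) * (Complex.Gamma ((1-s)/2) * Complex.Gamma (1 - s/2) * Complex.sin (Real.pi * s/2) / Real.pi)^r1 *
   (Complex.Gamma (1-s) * Complex.Gamma (1-s) * Complex.sin (Real.pi * s) / Real.pi)^r2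

lemma sin_pi_ne {s : ℂ} (h1 : -1 < s.re) (h2 : s.re < 1) (h0 : s.re ≠ 0) : Complex.sin (Real.pi * s) ≠ 0 := by
  rw [Complex.sin_ne_zero_iff]
  intro k hk
  have hpi : (Real.pi : ℂ) ≠ 0 := by exact_mod_cast Real.pi_ne_zero
  have : s = k := by
    apply mul_left_cancel₀ hpi; rw [hk]; ring
  have := congrArg Complex.re this
  simp at this
  rw [this] at h1 h2 h0
  norm_cast at h1 h2 h0
  omega

lemma gam_one_sub (r1 r2 : ℕ) {b : ℝ} (hb : 0 < b) {s : ℂ} (h1 : -1 < s.re) (h2 : s.re < 1) (h0 : s.re ≠ 0) :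
    gam r1 r2 b (1 - s) = GK r1 r2 b s * gam r1 r2 b s := by
  have hpi : (Real.pi : ℂ) ≠ 0 := by exact_mod_cast Real.pi_ne_zero
  have hbc : (b:ℂ) ≠ 0 := by exact_mod_cast hb.ne'
  have k1 := sin_pi_ne h1 h2 h0
  have hs2 : (s/2).re = s.re/2 := by simp
  have k2 := sin_pi_ne (s := s/2) (by rw [hs2]; linarith) (by rw [hs2]; linarith) (by rw [hs2]; intro h; apply h0; linarith)
  have r1' := Complex.Gamma_mul_Gamma_one_sub s
  have r2' := Complex.Gamma_mul_Gamma_one_sub (s/2)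
  rw [eq_div_iff k1] at r1'
  rw [eq_div_iff k2] at r2'
  rw [gam, gam, GK]
  have e1 : (b:ℂ)^(1-s) = (b:ℂ)^(1-2*s) * (b:ℂ)^s := by
    rw [← Complex.cpow_add _ _ hbc]; congr 1; ring
  have e2 : Complex.Gamma ((1-s)/2) = Complex.Gamma ((1-s)/2) * Complex.Gamma (1 - s/2) * Complex.sin (Real.pi * s/2) / Real.pi * Complex.Gamma (s/2) := by
    rw [show (Real.pi * s/2 : ℂ) = Real.pi * (s/2) by ring]
    rw [div_mul_eq_mul_div, eq_div_iff hpi]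
    linear_combination -Complex.Gamma ((1-s)/2) * r2'
  have e3 : Complex.Gamma (1-s) = Complex.Gamma (1-s) * Complex.Gamma (1-s) * Complex.sin (Real.pi * s) / Real.pi * Complex.Gamma s := by
    rw [div_mul_eq_mul_div, eq_div_iff hpi]
    linear_combination -Complex.Gamma (1-s) * r1'
  calc _ = (b:ℂ)^(1-s) * (Complex.Gamma ((1-s)/2) * Complex.Gamma (1 - s/2) * Complex.sin (Real.pi * s/2) / Real.pi * Complex.Gamma (s/2))^r1 * (Complex.Gamma (1-s) * Complex.Gamma (1-s) * Complex.sin (Real.pi * s) / Real.pi * Complex.Gamma s)^r2 := by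
        rw [← e2, ← e3]
    _ = _ := by rw [e1, mul_pow, mul_pow]; ring

lemma GK_zero {r1 r2 : ℕ} (h : 1 ≤ r1 + r2) (b : ℝ) : GK r1 r2 b 0 = 0 := by
  rw [GK]
  rcases Nat.eq_zero_or_pos r1 with h1 | h1
  · have : r2 ≠ 0 := by omega
    simp [this]
  · simp [h1.ne']

lemma differentiableAt_Gamma_of_re_pos {s : ℂ} (hs : 0 < s.re) : DifferentiableAt ℂ Complex.Gamma s := by
  apply Complex.differentiableAt_Gamma
  intro m h
  rw [h] at hs
  simp at hs
  linarith [Nat.cast_nonneg (α := ℝ) m]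

lemma GK_differentiableAt (r1 r2 : ℕ) {b : ℝ} (hb : 0 < b) {s : ℂ} (hs : s.re < 1) : DifferentiableAt ℂ (GK r1 r2 b) s := by
  have hbc : (b:ℂ) ≠ 0 := by exact_mod_cast hb.ne'
  have d1 : DifferentiableAt ℂ (fun s => Complex.Gamma ((1-s)/2)) s :=
    DifferentiableAt.comp (g := Complex.Gamma) (f := fun s : ℂ => (1-s)/2) s (differentiableAt_Gamma_of_re_pos (by simp; linarith)) (by fun_prop)
  have d2 : DifferentiableAt ℂ (fun s => Complex.Gamma (1 - s/2)) s :=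
    DifferentiableAt.comp (g := Complex.Gamma) (f := fun s : ℂ => 1-s/2) s (differentiableAt_Gamma_of_re_pos (by simp; linarith)) (by fun_prop)
  have d3 : DifferentiableAt ℂ (fun s => Complex.Gamma (1-s)) s :=
    DifferentiableAt.comp (g := Complex.Gamma) (f := fun s : ℂ => 1-s) s (differentiableAt_Gamma_of_re_pos (by simp; linarith)) (by fun_prop)
  have d4 : DifferentiableAt ℂ (fun s => (b:ℂ)^(1-2*s)) s := by
    apply DifferentiableAt.const_cpow (by fun_prop) (Or.inl hbc)
  unfold GK
  exact (d4.mul ((((d1.mul d2).mul (by fun_prop)).div_const _).pow r1)).mul ((((d3.mul d3).mul (by fun_prop)).div_const _).pow r2)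

lemma GK_growth (r1 r2 : ℕ) {b : ℝ} (hb : 0 < b) : ∃ C k : ℝ, 0 ≤ C ∧ 0 ≤ k ∧ ∀ s : ℂ, -(1/2) ≤ s.re → s.re ≤ 1/2 →
    ‖GK r1 r2 b s‖ ≤ C * Real.exp (k * |s.im|) := by
  obtain ⟨C, hC, H⟩ := Gamma_bdd (α := 1/4) (β := 4) (by norm_num)
  refine ⟨Real.exp (|Real.log b| * 2) * (C * C)^r1 * (C * C)^r2, r1 * (Real.pi/2) + r2 * Real.pi, by positivity, by positivity, fun s h1 h2 => ?_⟩
  have n4 : 1 ≤ ‖(Real.pi : ℂ)‖ := by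
    rw [Complex.norm_real, Real.norm_eq_abs, abs_of_pos Real.pi_pos]; linarith [Real.pi_gt_three]
  have e1 : ‖(b:ℂ)^(1-2*s)‖ ≤ Real.exp (|Real.log b| * 2) := by
    rw [Complex.norm_cpow_eq_rpow_re_of_pos hb, Real.rpow_def_of_pos hb]
    apply Real.exp_le_exp.mpr
    refine (le_abs_self _).trans ?_
    rw [abs_mul]
    gcongr
    simp
    rw [abs_le]; constructor <;> linarith
  have e2 : ‖Complex.Gamma ((1-s)/2) * Complex.Gamma (1 - s/2) * Complex.sin (Real.pi * s/2) / Real.pi‖ ≤ C * C * Real.exp (Real.pi/2 * |s.im|) := by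
    rw [norm_div]
    refine (div_le_self (norm_nonneg _) n4).trans ?_
    rw [norm_mul, norm_mul]
    gcongr
    · apply H <;> simp <;> linarith
    · apply H <;> simp <;> linarith
    · refine (norm_sin_le _).trans (Real.exp_le_exp.mpr (le_of_eq ?_))
      rw [show (Real.pi * s/2 : ℂ) = ((Real.pi/2 : ℝ) : ℂ) * s by push_cast; ring, Complex.im_ofReal_mul, abs_mul, abs_of_pos (by positivity)]
  have e3 : ‖Complex.Gamma (1-s) * Complex.Gamma (1 - s) * Complex.sin (Real.pi * s) / Real.pi‖ ≤ C * C * Real.exp (Real.pi * |s.im|) := by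
    rw [norm_div]
    refine (div_le_self (norm_nonneg _) n4).trans ?_
    rw [norm_mul, norm_mul]
    have : ‖Complex.Gamma (1 - s)‖ ≤ C := by apply H <;> simp <;> linarith
    gcongr
    · refine (norm_sin_le _).trans (Real.exp_le_exp.mpr (le_of_eq ?_))
      rw [Complex.im_ofReal_mul, abs_mul, abs_of_pos (by positivity)]
  rw [GK, norm_mul, norm_mul, norm_pow, norm_pow]
  calc _ ≤ Real.exp (|Real.log b| * 2) * (C * C * Real.exp (Real.pi/2 * |s.im|))^r1 * (C * C * Real.exp (Real.pi * |s.im|))^r2 := by gcongr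
    _ = _ := by
      rw [mul_pow _ (Real.exp _), mul_pow _ (Real.exp _), ← Real.exp_nat_mul, ← Real.exp_nat_mul, add_mul, Real.exp_add]
      ring_nf

end Landau
end

section
open Filter Topology MeasureTheory Set
open scoped BigOperators

namespace Landau

lemma GK_StF (r1 r2 : ℕ) {b : ℝ} (hb : 0 < b) {c : ℝ} (hc : c ≠ 0) (hc1 : c < 1) :
    StF 0 (r1 + 2 * r2 : ℝ) ((r1 + 2 * r2 : ℝ) * (1/2 - c) - 1)
      (fun t : ℝ => GK r1 r2 b (c - Complex.I * t) / (c - Complex.I * t)) := by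
  have hbc : (b:ℂ) ≠ 0 := by exact_mod_cast hb.ne'
  have g1 := StF.Gamma (p := (1-c)/2) (q := 1/2) (by linarith) (by norm_num)
  have g2 := StF.Gamma (p := 1 - c/2) (q := 1/2) (by linarith) (by norm_num)
  have g3 := StF.Gamma (p := 1 - c) (q := 1) (by linarith) (by norm_num)
  have s1 := StF.sin (Real.pi * c/2) (q := Real.pi/2) (by positivity)
  have s2 := StF.sin (Real.pi * c) (q := Real.pi) (by positivity)
  have A := ((((g1.mul g2).mul s1).mul (StF.const ((Real.pi : ℂ)⁻¹))).pow r1)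
  have B := ((((g3.mul g3).mul s2).mul (StF.const ((Real.pi : ℂ)⁻¹))).pow r2)
  have L := (StF.const ((b:ℂ)^((1 - 2*c : ℝ):ℂ))).mul (StF.cexp_lin (2 * Real.log b))
  have T := (((L.mul A).mul B).mul (StF.inv_line hc))
  have T2 := T.congr (g := fun t : ℝ => GK r1 r2 b (c - Complex.I * t) / (c - Complex.I * t)) (fun t ht => by
    rw [GK, div_eq_mul_inv]
    congr 1
    congr 1
    · congr 1
      · rw [show (1 - 2 * (c - Complex.I * t) : ℂ) = ((1 - 2*c : ℝ):ℂ) + 2 * Complex.I * t by push_cast; ring,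
          Complex.cpow_add _ _ hbc]
        congr 1
        rw [Complex.cpow_def_of_ne_zero hbc, ← Complex.ofReal_log hb.le]
        congr 1; push_cast; ring
      · rw [div_eq_mul_inv]
        congr 4
        · congr 1; congr 1; push_cast; ring
        · congr 1; push_cast; ring
        · push_cast; ring
    · rw [div_eq_mul_inv]
      congr 4
      · congr 1; congr 1; push_cast; ring
      · congr 1; push_cast; ring
      · push_cast; ring)
  convert T2 using 1 <;> ring

lemma conj_ofReal_cpow {b : ℝ} (hb : 0 < b) (z : ℂ) : (b:ℂ)^(starRingEnd ℂ z) = starRingEnd ℂ ((b:ℂ)^z) := by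
  have hbc : (b:ℂ) ≠ 0 := by exact_mod_cast hb.ne'
  rw [Complex.cpow_def_of_ne_zero hbc, Complex.cpow_def_of_ne_zero hbc, ← Complex.exp_conj, map_mul,
    ← Complex.ofReal_log hb.le, Complex.conj_ofReal]

lemma GK_conj (r1 r2 : ℕ) {b : ℝ} (hb : 0 < b) (s : ℂ) :
    GK r1 r2 b (starRingEnd ℂ s) = starRingEnd ℂ (GK r1 r2 b s) := by
  have h2 : (starRingEnd ℂ) (2:ℂ) = 2 := Complex.conj_ofNat 2
  rw [GK, GK]
  simp only [map_mul, map_pow, map_div₀, ← Complex.Gamma_conj, ← Complex.sin_conj, map_sub, map_one, h2, Complex.conj_ofReal,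
    ← conj_ofReal_cpow hb]

lemma gw_conj (v η : ℝ) (s : ℂ) : gw v η (starRingEnd ℂ s) = starRingEnd ℂ (gw v η s) := by
  have h2 : (starRingEnd ℂ) (2:ℂ) = 2 := Complex.conj_ofNat 2
  rw [gw, gw, ← Complex.exp_conj]
  simp only [map_mul, map_pow, map_div₀, map_add, h2, Complex.conj_ofReal]

lemma kern_integrable (r1 r2 : ℕ) {b : ℝ} (hb : 0 < b) {c : ℝ} (hc0 : c ≠ 0) (hc : |c| ≤ 1/8) (v : ℝ) {η : ℝ} (hη : 0 < η) :
    Integrable (fun t : ℝ => GK r1 r2 b (c + t * Complex.I) / (c + t * Complex.I) * gw v η (c + t * Complex.I)) := by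
  obtain ⟨C, k, hC, hk, H⟩ := GK_growth r1 r2 hb
  rw [abs_le] at hc
  have hd : GDecay c c (fun s => GK r1 r2 b s / s * gw v η s) := by
    refine gw_decay (C := C) (k := k) hC v hη (fun s h1 h2 h => ?_)
    have : 1 ≤ ‖s‖ := by linarith [h.trans (Complex.abs_im_le_norm s)]
    rw [norm_div]
    exact (div_le_self (norm_nonneg _) this).trans (H s (by linarith) (by linarith))
  refine hd.integrable (σ := c) le_rfl le_rfl (fun s hs => ?_)
  have hs0 : s ≠ 0 := by rintro rfl; exact hc0 (by simpa using hs.symm)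
  exact (((GK_differentiableAt r1 r2 hb (by linarith)).continuousAt).div continuousAt_id hs0).mul (gw_differentiable v η).continuous.continuousAt

lemma kernel_bound (r1 r2 : ℕ) (hn : 2 ≤ r1 + 2 * r2) {b : ℝ} (hb : 0 < b) {c : ℝ} (hc0 : c ≠ 0) (hc : |c| ≤ 1/8) :
    ∃ C : ℝ, 0 ≤ C ∧ ∀ v η : ℝ, 0 < η → η ≤ 1 →
      ‖∫ t : ℝ, GK r1 r2 b (c + t * Complex.I) / (c + t * Complex.I) * gw v η (c + t * Complex.I)‖ ≤
        C * Real.exp (c * v) * η ^ (-((r1 + 2 * r2 : ℝ) * (1/2 - c) - 1/2)) := by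
  have hc' := abs_le.mp hc
  have hn' : (2:ℝ) ≤ r1 + 2 * r2 := by exact_mod_cast hn
  set a : ℝ := (r1 + 2 * r2 : ℝ) * (1/2 - c) - 1 with ha
  have ha2 : -(1/2) < a := by rw [ha]; nlinarith
  obtain ⟨t0, C, ht0, hC, H⟩ := osc_gauss (by linarith) ha2 (GK_StF r1 r2 hb hc0 (by linarith : c < 1))
  set f : ℝ → ℂ := fun t : ℝ => GK r1 r2 b (c - Complex.I * t) / (c - Complex.I * t) with hf
  have hcont : Continuous f := by
    have := line_continuous (F := fun s => GK r1 r2 b s / s) (σ := c) (fun s hs => by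
      have hs0 : s ≠ 0 := by rintro rfl; exact hc0 (by simpa using hs.symm)
      exact (((GK_differentiableAt r1 r2 hb (by linarith)).continuousAt).div continuousAt_id hs0))
    have h2 := this.comp continuous_neg
    convert h2 using 1
    ext t
    simp only [hf, Function.comp]
    rw [show (c - Complex.I * t : ℂ) = c + ((-t : ℝ) : ℂ) * Complex.I by push_cast; ring]
  obtain ⟨M, hM⟩ := (isCompact_Icc (a := (0:ℝ)) (b := t0)).exists_bound_of_continuousOn hcont.continuousOn
  have hM0 : 0 ≤ M := (norm_nonneg _).trans (hM 0 ⟨le_rfl, by linarith⟩)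
  refine ⟨2 * (Real.exp 1 * (M * t0 + C)), by positivity, fun v η hη hη1 => ?_⟩
  set F : ℝ → ℂ := fun t => GK r1 r2 b (c + t * Complex.I) / (c + t * Complex.I) * gw v η (c + t * Complex.I) with hF
  have hFi : Integrable F := kern_integrable r1 r2 hb hc0 hc v hη
  have hconj : ∀ t, F t = starRingEnd ℂ (F (-t)) := by
    intro t
    simp only [hF, map_mul, map_div₀, ← GK_conj _ _ hb, ← gw_conj]
    have : (starRingEnd ℂ) (c + ((-t:ℝ):ℂ) * Complex.I) = c + t * Complex.I := by
      simp [map_add, map_mul, Complex.conj_ofReal]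
    rw [this]
  have hFneg : Integrable (fun t => F (-t)) := hFi.comp_neg
  set J : ℂ := ∫ t in Ioi (0:ℝ), F (-t) with hJ
  have split : ∫ t, F t = starRingEnd ℂ J + J := by
    rw [← integral_add_compl (s := Ioi (0:ℝ)) measurableSet_Ioi hFi]
    congr 1
    · rw [hJ, ← integral_conj]
      exact setIntegral_congr_fun measurableSet_Ioi (fun t _ => hconj t)
    · rw [hJ, compl_Ioi]
      have := integral_comp_neg_Ioi (0:ℝ) F
      rw [this, neg_zero]
  have e0 : ∀ t : ℝ, F (-t) = ((Real.exp (c * v + η^2 * c^2/2) : ℝ) : ℂ) *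
      (f t * (Complex.exp (Complex.I * ((-(v + η^2 * c) * t : ℝ) : ℂ)) * (Real.exp (-(η^2*t^2/2)) : ℝ))) := by
    intro t
    simp only [hF, hf]
    rw [show (c + ((-t : ℝ) : ℂ) * Complex.I : ℂ) = c - Complex.I * t by push_cast; ring]
    rw [mul_left_comm]
    congr 1
    rw [gw, Complex.ofReal_exp, Complex.ofReal_exp, ← Complex.exp_add, ← Complex.exp_add]
    congr 1
    push_cast
    ring_nf
    rw [Complex.I_sq]; ring
  have hc2 : c * c ≤ 1 := by nlinarith
  have hE : Real.exp (c * v + η^2 * c^2/2) ≤ Real.exp 1 * Real.exp (c * v) := by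
    rw [← Real.exp_add]; apply Real.exp_le_exp.mpr
    have : η^2 * c^2 ≤ 1 := by
      have : η^2 ≤ 1 := by nlinarith
      nlinarith [sq_nonneg c, sq_nonneg η]
    linarith
  have hpow : 1 ≤ η ^ (-(a + 1/2)) := by
    apply Real.one_le_rpow_of_pos_of_le_one_of_nonpos hη hη1; linarith
  have hJb : ‖J‖ ≤ Real.exp 1 * Real.exp (c * v) * ((M * t0 + C) * η ^ (-(a + 1/2))) := by
    have lim := intervalIntegral_tendsto_integral_Ioi (0:ℝ) hFneg.integrableOn tendsto_id
    refine le_of_tendsto lim.norm ?_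
    filter_upwards [eventually_ge_atTop t0] with T hT
    simp only [id, e0]
    rw [intervalIntegral.integral_const_mul, norm_mul, Complex.norm_real, Real.norm_eq_abs, abs_of_pos (Real.exp_pos _)]
    set G : ℝ → ℂ := fun t => (f t * (Complex.exp (Complex.I * ((-(v + η^2 * c) * t : ℝ) : ℂ)) * (Real.exp (-(η^2*t^2/2)) : ℝ))) with hG
    have hGc : Continuous G := by
      rw [hG]; fun_prop
    have hsp := intervalIntegral.integral_add_adjacent_intervals (hGc.intervalIntegrable (μ := volume) 0 t0) (hGc.intervalIntegrable t0 T)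
    have b1 : ‖∫ t in (0:ℝ)..t0, G t‖ ≤ M * |t0 - 0| := by
      apply intervalIntegral.norm_integral_le_of_norm_le_const
      intro t ht
      rw [uIoc_of_le (by linarith)] at ht
      rw [hG]; simp only
      rw [norm_mul, norm_mul, mul_comm Complex.I, Complex.norm_exp_ofReal_mul_I, one_mul, Complex.norm_real, Real.norm_eq_abs, abs_of_pos (Real.exp_pos _)]
      have : Real.exp (-(η^2*t^2/2)) ≤ 1 := Real.exp_le_one_iff.mpr (by simp; positivity)
      calc _ ≤ M * 1 := mul_le_mul (hM t ⟨ht.1.le, ht.2⟩) this (Real.exp_pos _).le hM0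
        _ = M := mul_one M
    have b2 := H (-(v + η^2 * c)) η T hη hT
    rw [sub_zero, abs_of_pos (by linarith)] at b1
    have b3 : ‖∫ t in (0:ℝ)..T, G t‖ ≤ (M * t0 + C) * η ^ (-(a + 1/2)) := by
      rw [← hsp]
      refine (norm_add_le _ _).trans ((add_le_add b1 b2).trans ?_)
      rw [add_mul]
      exact add_le_add_left (le_mul_of_one_le_right (by positivity) hpow) _
    exact mul_le_mul hE b3 (norm_nonneg _) (by positivity)
  rw [split]
  refine (norm_add_le _ _).trans ?_
  rw [RCLike.norm_conj]
  have : a + 1/2 = (r1 + 2 * r2 : ℝ) * (1/2 - c) - 1/2 := by rw [ha]; ring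
  rw [← this]
  calc ‖J‖ + ‖J‖ ≤ 2 * (Real.exp 1 * Real.exp (c * v) * ((M * t0 + C) * η ^ (-(a + 1/2)))) := by linarith
    _ = _ := by ring

lemma kernel_shift (r1 r2 : ℕ) (hr : 1 ≤ r1 + r2) {b : ℝ} (hb : 0 < b) (v : ℝ) {η : ℝ} (hη : 0 < η) :
    ∫ t : ℝ, GK r1 r2 b (((-(1/8) : ℝ):ℂ) + t * Complex.I) / (((-(1/8) : ℝ):ℂ) + t * Complex.I) * gw v η (((-(1/8) : ℝ):ℂ) + t * Complex.I) =
    ∫ t : ℝ, GK r1 r2 b (((1/8 : ℝ):ℂ) + t * Complex.I) / (((1/8 : ℝ):ℂ) + t * Complex.I) * gw v η (((1/8 : ℝ):ℂ) + t * Complex.I) := by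
  obtain ⟨C, k, hC, hk, H⟩ := GK_growth r1 r2 hb
  set D := dslope (GK r1 r2 b) 0 with hD
  have hDs : ∀ s : ℂ, s ≠ 0 → D s = GK r1 r2 b s / s := by
    intro s hs
    rw [hD, dslope_of_ne _ hs, slope_def_field, GK_zero hr, sub_zero, sub_zero]
  have hdiff : ∀ s : ℂ, s.re < 1 → DifferentiableAt ℂ D s := by
    have ho : IsOpen {s : ℂ | s.re < 1} := isOpen_lt Complex.continuous_re continuous_const
    have h0 : {s : ℂ | s.re < 1} ∈ 𝓝 (0:ℂ) := ho.mem_nhds (by simp)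
    have := (Complex.differentiableOn_dslope (f := GK r1 r2 b) h0).mpr (fun s hs => (GK_differentiableAt r1 r2 hb hs).differentiableWithinAt)
    intro s hs
    exact this.differentiableAt (ho.mem_nhds hs)
  have hdec : GDecay (-(1/8)) (1/8) (fun s => D s * gw v η s) := by
    refine gw_decay (C := C) (k := k) hC v hη (fun s h1 h2 h => ?_)
    have h1' : 1 ≤ ‖s‖ := by linarith [h.trans (Complex.abs_im_le_norm s)]
    have hs0 : s ≠ 0 := by rintro rfl; simp at h1'; linarith
    rw [hDs s hs0, norm_div]
    exact (div_le_self (norm_nonneg _) h1').trans (H s (by linarith) (by linarith))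
  have := line_shift (by norm_num) hdec (fun s h1 h2 => (hdiff s (by linarith)).mul (gw_differentiable v η s))
  have ne1 : ∀ t : ℝ, (((-(1/8) : ℝ):ℂ) + t * Complex.I) ≠ 0 := by
    intro t h; have := congrArg Complex.re h; simp at this
  have ne2 : ∀ t : ℝ, (((1/8 : ℝ):ℂ) + t * Complex.I) ≠ 0 := by
    intro t h; have := congrArg Complex.re h; simp at this
  simp only [hDs _ (ne1 _), hDs _ (ne2 _)] at this
  exact this

/-- The kernel, bounded in two ways. -/
lemma kernel_min (r1 r2 : ℕ) (hn : 2 ≤ r1 + 2 * r2) {b : ℝ} (hb : 0 < b) :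
    ∃ C : ℝ, 0 ≤ C ∧ ∀ v η : ℝ, 0 < η → η ≤ 1 →
      ‖∫ t : ℝ, GK r1 r2 b (((-(1/8) : ℝ):ℂ) + t * Complex.I) / (((-(1/8) : ℝ):ℂ) + t * Complex.I) * gw v η (((-(1/8) : ℝ):ℂ) + t * Complex.I)‖ ≤
        C * η ^ (-(((r1 + 2 * r2 : ℝ) - 1) / 2)) * Real.exp (-(1/8) * |v + (r1 + 2 * r2 : ℝ) * Real.log η|) := by
  obtain ⟨C1, hC1, H1⟩ := kernel_bound r1 r2 hn hb (c := -(1/8)) (by norm_num) (by norm_num)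
  obtain ⟨C2, hC2, H2⟩ := kernel_bound r1 r2 hn hb (c := 1/8) (by norm_num) (by norm_num)
  refine ⟨C1 + C2, by positivity, fun v η hη hη1 => ?_⟩
  set n : ℝ := (r1 + 2 * r2 : ℝ) with hnn
  have key : ∀ c : ℝ, Real.exp (c * v) * η ^ (-(n * (1/2 - c) - 1/2)) = η ^ (-((n - 1) / 2)) * Real.exp (c * (v + n * Real.log η)) := by
    intro c
    rw [Real.rpow_def_of_pos hη, Real.rpow_def_of_pos hη, ← Real.exp_add, ← Real.exp_add]
    congr 1; ring
  have h1 := H1 v η hη hη1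
  have h2 := H2 v η hη hη1
  rw [← kernel_shift r1 r2 (by omega) hb v hη] at h2
  rw [mul_assoc, key] at h1 h2
  rcases le_total 0 (v + n * Real.log η) with h | h
  · rw [abs_of_nonneg h]
    refine h1.trans ?_
    rw [← mul_assoc]
    gcongr
    linarith
  · rw [abs_of_nonpos h]
    refine h2.trans ?_
    rw [← mul_assoc]
    rw [show (-(1/8) * -(v + n * Real.log η)) = 1/8 * (v + n * Real.log η) by ring]
    gcongr
    linarith

end Landau
end

section
open Filter Topology MeasureTheory Set
open scoped BigOperators

namespace Landau

lemma group_sum {Q : Type*} (x g : Q → ℝ) (N w : ℤ → ℝ) (hw : ∀ k, 0 ≤ w k) (hg : ∀ q, g q ≤ w ⌊x q⌋)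
    (hN : ∀ k, ∀ F : Finset Q, (∀ q ∈ F, ⌊x q⌋ = k) → (F.card : ℝ) ≤ N k)
    (hs : Summable (fun k => N k * w k)) (F : Finset Q) : ∑ q ∈ F, g q ≤ ∑' k, N k * w k := by
  classical
  have hN0 : ∀ k, 0 ≤ N k := fun k => by simpa using hN k ∅ (by simp)
  rw [← Finset.sum_fiberwise_of_maps_to (s := F) (t := F.image (fun q => ⌊x q⌋)) (g := fun q => ⌊x q⌋)
    (fun q hq => Finset.mem_image_of_mem _ hq) g]
  calc _ ≤ ∑ k ∈ F.image (fun q => ⌊x q⌋), N k * w k := by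
        apply Finset.sum_le_sum
        intro k _
        calc _ ≤ ∑ q ∈ F with ⌊x q⌋ = k, w k := by
              apply Finset.sum_le_sum
              intro q hq
              have := (Finset.mem_filter.mp hq).2
              rw [← this]; exact hg q
          _ = ((F.filter (fun q => ⌊x q⌋ = k)).card : ℝ) * w k := by rw [Finset.sum_const, nsmul_eq_mul]
          _ ≤ N k * w k := mul_le_mul_of_nonneg_right (hN k _ (fun q hq => (Finset.mem_filter.mp hq).2)) (hw k)
    _ ≤ _ := hs.sum_le_tsum _ (fun k _ => mul_nonneg (hN0 k) (hw k))

lemma summable_exp_abs {c : ℝ} (hc : 0 < c) : Summable (fun k : ℤ => Real.exp (-(c * |(k:ℝ)|))) := by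
  have h : Summable (fun k : ℕ => Real.exp (-(c * |((k:ℤ):ℝ)|))) := by
    have := summable_geometric_of_lt_one (Real.exp_pos (-c)).le (by rw [← Real.exp_zero]; exact Real.exp_lt_exp.mpr (by linarith))
    refine this.congr (fun k => ?_)
    rw [← Real.exp_nat_mul]; congr 1
    rw [Int.cast_natCast, abs_of_nonneg (Nat.cast_nonneg k)]; ring
  refine Summable.of_nat_of_neg h ?_
  refine h.congr (fun k => ?_)
  simp

lemma Phi_nonneg (η v : ℝ) (hη : 0 < η) : 0 ≤ Phi η v := by
  rw [Phi]
  apply integral_nonneg; intro u; positivity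

lemma Phi_tail {v η : ℝ} (hη : 0 < η) : Phi η v ≤ Real.exp 2 * Real.exp (2 * v/η) := by
  rw [Phi_eq_gaussian v hη]
  have hi := ProbabilityTheory.integrable_exp_mul_gaussianReal (μ := 0) (v := 1) (-2)
  have hm := ProbabilityTheory.mgf_gaussianReal (p := ProbabilityTheory.gaussianReal 0 1) (X := id) (μ := 0) (v := 1) (by simp) (-2)
  rw [ProbabilityTheory.mgf] at hm
  calc _ ≤ ∫ z, Real.exp (2*v/η) * Real.exp (-2 * z) ∂(ProbabilityTheory.gaussianReal 0 1) := by
        apply integral_mono_of_nonneg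
        · exact Eventually.of_forall (fun z => indicator_nonneg (fun _ _ => zero_le_one) _)
        · exact hi.const_mul _
        · refine Eventually.of_forall (fun z => ?_)
          simp only [indicator]
          split_ifs with h
          · rw [← Real.exp_add, Real.one_le_exp_iff]
            have h' : 0 < v - η * z := h
            have : 2*v/η + -2*z = 2 * (v - η*z)/η := by field_simp; ring
            rw [this]; positivity
          · positivity
    _ = _ := by
        rw [integral_const_mul]
        simp only [id] at hm
        rw [hm, mul_comm]; norm_num

lemma Phi_approx {v η : ℝ} (hη : 0 < η) : |Phi η v - (if 0 ≤ v then 1 else 0)| ≤ Real.exp 2 * Real.exp (-(2 * |v|/η)) := by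
  split_ifs with h
  · have := Phi_add_neg v hη
    rw [show Phi η v - 1 = - Phi η (-v) by linarith, abs_neg, abs_of_nonneg (Phi_nonneg _ _ hη), abs_of_nonneg h]
    refine Phi_tail hη |>.trans (le_of_eq ?_)
    congr 2; ring
  · push Not at h
    rw [sub_zero, abs_of_nonneg (Phi_nonneg _ _ hη), abs_of_neg h]
    refine Phi_tail hη |>.trans (le_of_eq ?_)
    congr 2; ring

lemma ind_integrable (v η : ℝ) : Integrable (fun z => (Ioi (0:ℝ)).indicator (fun _ => (1:ℝ)) (v - η * z)) (ProbabilityTheory.gaussianReal 0 1) := by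
  refine Integrable.of_bound (C := 1) ?_ ?_
  · apply Measurable.aestronglyMeasurable
    exact (measurable_const.indicator measurableSet_Ioi).comp (by fun_prop)
  · refine Eventually.of_forall (fun z => ?_)
    refine (norm_indicator_le_norm_self _ _).trans (by simp)

lemma Phi_mono {η v w : ℝ} (hη : 0 < η) (h : v ≤ w) : Phi η v ≤ Phi η w := by
  rw [Phi_eq_gaussian v hη, Phi_eq_gaussian w hη]
  apply integral_mono (ind_integrable _ _) (ind_integrable _ _)
  intro z
  simp only [indicator, mem_Ioi]
  split_ifs <;> linarith

lemma Phi_short : ∃ c0 : ℝ, 0 < c0 ∧ ∀ η y : ℝ, 0 < η → |y| ≤ η → c0 ≤ Phi η (y + 2 * η) - Phi η (y - 2 * η) := by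
  refine ⟨(ProbabilityTheory.gaussianReal 0 1).real (Ioo (-1) 1), ?_, fun η y hη hy => ?_⟩
  · rw [measureReal_def, ENNReal.toReal_pos_iff]
    constructor
    · rw [pos_iff_ne_zero]
      intro h
      have hac := ProbabilityTheory.gaussianReal_absolutelyContinuous' 0 (v := 1) (by norm_num)
      have := hac h
      rw [Real.volume_Ioo] at this
      norm_num at this
    · exact measure_lt_top _ _
  · rw [Phi_eq_gaussian _ hη, Phi_eq_gaussian _ hη, ← integral_sub (ind_integrable _ _) (ind_integrable _ _)]
    rw [← integral_indicator_one measurableSet_Ioo]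
    apply integral_mono
    · exact (integrable_const (1:ℝ)).indicator measurableSet_Ioo
    · exact (ind_integrable _ _).sub (ind_integrable _ _)
    · intro z
      rw [abs_le] at hy
      simp only [indicator, mem_Ioi, mem_Ioo, Pi.one_apply]
      by_cases hz : -1 < z ∧ z < 1
      · rw [if_pos hz, if_pos (by nlinarith), if_neg (by nlinarith)]; norm_num
      · rw [if_neg hz]
        split_ifs <;> linarith

lemma tauber {Q : Type*} (l : Q → ℝ) {m ρ C : ℝ} (hm : 0 ≤ m) (hC : 0 ≤ C)
    (hA : ∀ v η : ℝ, 0 < η → η ≤ 1 → Summable (fun q => Phi η (v - l q)) ∧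
      |(∑' q, Phi η (v - l q)) - ρ * Real.exp v| ≤ C * (Real.exp v * η + η ^ (-m))) :
    ∃ C' : ℝ, 0 ≤ C' ∧ ∀ v η : ℝ, 0 < η → η ≤ 1 → {q | l q ≤ v}.Finite ∧
      |({q | l q ≤ v}.ncard : ℝ) - ρ * Real.exp v| ≤ C' * (Real.exp v * η + η ^ (-m)) := by
  classical
  obtain ⟨c0, hc0, hshort⟩ := Phi_short
  set E : ℝ → ℝ → ℝ := fun v η => Real.exp v * η + η ^ (-m) with hE
  have hEpos : ∀ v η, 0 < η → 0 < E v η := fun v η hη => by simp only [hE]; positivity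
  have hEsh : ∀ v w η, 0 < η → E (v + w) η ≤ Real.exp |w| * E v η := by
    intro v w η hη
    simp only [hE, mul_add]
    rw [Real.exp_add]
    have h1 : Real.exp w ≤ Real.exp |w| := Real.exp_le_exp.mpr (le_abs_self w)
    have h2 : 1 ≤ Real.exp |w| := Real.one_le_exp (abs_nonneg w)
    have h3 : 0 < η ^ (-m) := by positivity
    apply add_le_add
    · calc _ ≤ Real.exp v * Real.exp |w| * η := by gcongr
        _ = _ := by ring
    · exact le_mul_of_one_le_left h3.le h2
  -- short intervals
  set C1 : ℝ := (|ρ| * (4 * Real.exp 2) + 2 * C * Real.exp 2)/c0 with hC1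
  have hC1p : 0 ≤ C1 := by positivity
  have short : ∀ v η : ℝ, 0 < η → η ≤ 1 → ∀ F : Finset Q, (∀ q ∈ F, |v - l q| ≤ η) → (F.card : ℝ) ≤ C1 * E v η := by
    intro v η hη hη1 F hF
    obtain ⟨s1, b1⟩ := hA (v + 2 * η) η hη hη1
    obtain ⟨s2, b2⟩ := hA (v - 2 * η) η hη hη1
    have hle : c0 * F.card ≤ (∑' q, Phi η (v + 2 * η - l q)) - (∑' q, Phi η (v - 2 * η - l q)) := by
      rw [← s1.tsum_sub s2]
      calc c0 * F.card = ∑ q ∈ F, c0 := by rw [Finset.sum_const, nsmul_eq_mul]; ring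
        _ ≤ ∑ q ∈ F, (Phi η (v + 2 * η - l q) - Phi η (v - 2 * η - l q)) := by
            apply Finset.sum_le_sum
            intro q hq
            have := hshort η (v - l q) hη (hF q hq)
            rw [show v + 2 * η - l q = v - l q + 2 * η by ring, show v - 2 * η - l q = v - l q - 2 * η by ring]
            exact this
        _ ≤ _ := (s1.sub s2).sum_le_tsum _ (fun q _ => by
            have := Phi_mono hη (show v - 2 * η - l q ≤ v + 2 * η - l q by linarith)
            linarith)
    have e1 := hEsh v (2*η) η hη
    have e2 := hEsh v (-(2*η)) η hη
    rw [abs_neg, abs_of_pos (by linarith)] at e2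
    rw [abs_of_pos (by linarith)] at e1
    have hex : Real.exp (2*η) ≤ Real.exp 2 := Real.exp_le_exp.mpr (by linarith)
    have hE0 := hEpos v η hη
    have hd : |Real.exp (v + 2 * η) - Real.exp (v - 2*η)| ≤ 4 * Real.exp 2 * E v η := by
      have : Real.exp (v + 2 * η) - Real.exp (v - 2*η) ≤ 4 * η * Real.exp (v + 2*η) := by
        have h1 := Real.add_one_le_exp (-(4*η))
        have : Real.exp (v - 2*η) = Real.exp (v + 2*η) * Real.exp (-(4*η)) := by rw [← Real.exp_add]; congr 1; ring
        rw [this]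
        nlinarith [Real.exp_pos (v + 2*η)]
      rw [abs_of_nonneg (sub_nonneg.mpr (Real.exp_le_exp.mpr (by linarith)))]
      refine this.trans ?_
      rw [Real.exp_add]
      have h3 : 0 < η ^ (-m) := by positivity
      calc 4 * η * (Real.exp v * Real.exp (2*η)) ≤ 4 * η * (Real.exp v * Real.exp 2) := by gcongr
        _ = 4 * Real.exp 2 * (Real.exp v * η) := by ring
        _ ≤ _ := by simp only [hE]; gcongr; linarith
    have b1' : |(∑' q, Phi η (v + 2 * η - l q)) - ρ * Real.exp (v + 2*η)| ≤ C * (Real.exp 2 * E v η) :=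
      b1.trans (mul_le_mul_of_nonneg_left (e1.trans (by gcongr)) hC)
    have b2' : |(∑' q, Phi η (v - 2 * η - l q)) - ρ * Real.exp (v - 2*η)| ≤ C * (Real.exp 2 * E v η) := by
      refine b2.trans (mul_le_mul_of_nonneg_left (le_trans ?_ (e2.trans (by gcongr))) hC)
      rw [← sub_eq_add_neg]
    have hρ : ρ * (Real.exp (v + 2 * η) - Real.exp (v - 2*η)) ≤ |ρ| * (4 * Real.exp 2 * E v η) := by
      refine (le_abs_self _).trans ?_
      rw [abs_mul]; gcongr
    rw [abs_le] at b1' b2'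
    rw [hC1, div_mul_eq_mul_div, le_div_iff₀ hc0]
    nlinarith [b1'.2, b2'.1]
  -- main
  set S : ℝ := ∑' k : ℤ, Real.exp (-(1 * |(k:ℝ)|)) with hS
  have hsum := summable_exp_abs (c := 1) one_pos
  have hS0 : 0 ≤ S := tsum_nonneg (fun k => (Real.exp_pos _).le)
  set C2 : ℝ := C1 * Real.exp 1 * (Real.exp 2 * Real.exp 2) * S with hC2
  have hC2p : 0 ≤ C2 := by positivity
  refine ⟨C + C2, by positivity, fun v η hη hη1 => ?_⟩
  obtain ⟨sA, bA⟩ := hA v η hη hη1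
  have hfin : ∀ F : Finset Q, ∑ q ∈ F, |Phi η (v - l q) - (if 0 ≤ v - l q then 1 else 0)| ≤ C2 * E v η := by
    intro F
    have hterm : ∀ k : ℤ, (C1 * (Real.exp (|(k:ℝ)| + 1) * E v η)) * (Real.exp 2 * (Real.exp 2 * Real.exp (-(2 * |(k:ℝ)|)))) =
       (C1 * Real.exp 1 * (Real.exp 2 * Real.exp 2) * E v η) * Real.exp (-(1 * |(k:ℝ)|)) := by
      intro k
      rw [show -(2 * |(k:ℝ)|) = -(1 * |(k:ℝ)|) + (-|(k:ℝ)|) by ring, Real.exp_add, Real.exp_add, Real.exp_neg |(k:ℝ)|]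
      have := Real.exp_pos |(k:ℝ)|
      field_simp
    have := group_sum (fun q => (l q - v)/η) (fun q => |Phi η (v - l q) - (if 0 ≤ v - l q then 1 else 0)|)
      (fun k => C1 * (Real.exp (|(k:ℝ)| + 1) * E v η)) (fun k => Real.exp 2 * (Real.exp 2 * Real.exp (-(2 * |(k:ℝ)|))))
      (fun k => by positivity) ?_ ?_ ?_ F
    · refine this.trans (le_of_eq ?_)
      simp only [hterm]
      rw [tsum_mul_left, hC2]; ring
    · intro q
      refine (Phi_approx hη).trans ?_
      rw [← Real.exp_add 2 (-(2 * _))]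
      gcongr
      have h1 : |v - l q|/η = |(l q - v)/η| := by rw [abs_div, abs_of_pos hη, abs_sub_comm]
      rw [mul_div_assoc, h1]
      set x := (l q - v)/η
      have h2 := Int.floor_le x
      have h3 := Int.lt_floor_add_one x
      have : |((⌊x⌋:ℤ):ℝ)| ≤ |x| + 1 := by
        have : |((⌊x⌋:ℤ):ℝ) - x| ≤ 1 := by rw [abs_le]; constructor <;> linarith
        have h4 := abs_add_le (((⌊x⌋:ℤ):ℝ) - x) x
        rw [sub_add_cancel] at h4
        linarith
      linarith
    · intro k F hF
      have h1 := short (v + k * η) η hη hη1 F (fun q hq => by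
        have := Int.floor_eq_iff.mp (hF q hq)
        rw [le_div_iff₀ hη, div_lt_iff₀ hη] at this
        rw [abs_le]; constructor <;> nlinarith)
      refine h1.trans (mul_le_mul_of_nonneg_left ?_ hC1p)
      refine (hEsh v (k * η) η hη).trans ?_
      have hE0 := hEpos v η hη
      gcongr
      rw [abs_mul, abs_of_pos hη]
      nlinarith [abs_nonneg (k:ℝ)]
    · simp only [hterm]
      exact hsum.mul_left _
  have hsa : Summable (fun q => |Phi η (v - l q) - (if 0 ≤ v - l q then 1 else 0)|) :=
    summable_of_sum_le (fun q => abs_nonneg _) hfin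
  have hsd : Summable (fun q => Phi η (v - l q) - (if 0 ≤ v - l q then (1:ℝ) else 0)) := Summable.of_abs hsa
  have hsi : Summable (fun q => (if 0 ≤ v - l q then (1:ℝ) else 0)) := by
    have := sA.sub hsd
    simpa using this
  have hbd : |∑' q, (Phi η (v - l q) - (if 0 ≤ v - l q then (1:ℝ) else 0))| ≤ C2 * E v η := by
    have h1 := norm_tsum_le_tsum_norm (f := fun q => (Phi η (v - l q) - (if 0 ≤ v - l q then (1:ℝ) else 0))) hsa
    refine h1.trans (Real.tsum_le_of_sum_le (fun q => abs_nonneg _) hfin)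
  have hf : {q | l q ≤ v}.Finite := by
    have := hsi.tendsto_cofinite_zero.eventually (gt_mem_nhds (show (0:ℝ) < 1 by norm_num))
    rw [eventually_cofinite] at this
    refine this.subset (fun q hq => ?_)
    have : 0 ≤ v - l q := sub_nonneg.mpr hq
    simp only [mem_setOf_eq, if_pos this]; norm_num
  refine ⟨hf, ?_⟩
  have hcount : ∑' q, (if 0 ≤ v - l q then (1:ℝ) else 0) = ({q | l q ≤ v}.ncard : ℝ) := by
    rw [ncard_eq_toFinset_card _ hf, tsum_eq_sum (s := hf.toFinset) (fun q hq => by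
      have : ¬ (l q ≤ v) := by simpa using hq
      rw [if_neg]; linarith)]
    rw [Finset.sum_congr rfl (g := fun _ => (1:ℝ)) (fun q hq => by
      have : (l q ≤ v) := by simpa using hq
      rw [if_pos]; linarith)]
    simp
  rw [sA.tsum_sub hsi, hcount] at hbd
  have : ({q | l q ≤ v}.ncard : ℝ) - ρ * Real.exp v = ((∑' q, Phi η (v - l q)) - ρ * Real.exp v) - ((∑' q, Phi η (v - l q)) - ({q | l q ≤ v}.ncard : ℝ)) := by ring
  rw [this]
  refine (abs_sub _ _).trans ?_
  have := add_le_add bA hbd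
  rw [add_mul]; exact this

end Landau
end

section
open Filter Topology MeasureTheory Set
open scoped BigOperators

namespace Landau

lemma ginv_diff (r1 r2 : ℕ) {b : ℝ} (hb : 0 < b) : Differentiable ℂ (fun s => (gam r1 r2 b s)⁻¹) := by
  have hbc : (b:ℂ) ≠ 0 := by exact_mod_cast hb.ne'
  have e : (fun s => (gam r1 r2 b s)⁻¹) = fun s => (b:ℂ)^(-s) * ((Complex.Gamma (s/2))⁻¹)^r1 * ((Complex.Gamma s)⁻¹)^r2 := by
    ext s
    rw [gam, mul_inv, mul_inv, inv_pow, inv_pow, Complex.cpow_neg]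
  rw [e]
  have d1 : Differentiable ℂ (fun s : ℂ => (Complex.Gamma (s/2))⁻¹) :=
    Complex.differentiable_one_div_Gamma.comp (differentiable_id.div_const 2)
  have d4 : Differentiable ℂ (fun s : ℂ => (b:ℂ)^(-s)) := fun s =>
    DifferentiableAt.const_cpow (by fun_prop) (Or.inl hbc)
  exact (d4.mul (d1.pow r1)).mul (Complex.differentiable_one_div_Gamma.pow r2)

lemma ginv_zero {r1 r2 : ℕ} (h : 1 ≤ r1 + r2) (b : ℝ) : (gam r1 r2 b 0)⁻¹ = 0 := by
  rw [gam]
  rcases Nat.eq_zero_or_pos r1 with h1 | h1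
  · have : r2 ≠ 0 := by omega
    simp [this, Complex.Gamma_zero]
  · simp [h1.ne', Complex.Gamma_zero]

lemma ginv_growth (r1 r2 : ℕ) {b : ℝ} (hb : 0 < b) : ∃ C k : ℝ, 0 ≤ C ∧ 0 ≤ k ∧ ∀ s : ℂ, -(1/8) ≤ s.re → s.re ≤ 2 → 2 ≤ |s.im| →
    ‖(gam r1 r2 b s)⁻¹‖ ≤ C * Real.exp (k * |s.im|) := by
  obtain ⟨C, hC, H⟩ := inv_Gamma_bdd
  refine ⟨Real.exp (|Real.log b| * 2) * C^r1 * C^r2, r1 * (Real.pi/2) + r2 * Real.pi, by positivity, by positivity, fun s h1 h2 h3 => ?_⟩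
  have e1 : ‖(b:ℂ)^(-s)‖ ≤ Real.exp (|Real.log b| * 2) := by
    rw [Complex.norm_cpow_eq_rpow_re_of_pos hb, Real.rpow_def_of_pos hb]
    apply Real.exp_le_exp.mpr
    refine (le_abs_self _).trans ?_
    rw [abs_mul]
    gcongr
    simp
    rw [abs_le]; constructor <;> linarith
  have hs2 : (s/2).re = s.re/2 := by simp
  have hs3 : (s/2).im = s.im/2 := by simp
  have e2 := H (s/2) (by rw [hs2]; linarith) (by rw [hs2]; linarith) (by rw [hs3, abs_div, abs_of_pos (by norm_num : (0:ℝ) < 2)]; linarith)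
  have e3 := H s (by linarith) (by linarith) (by linarith)
  rw [hs3, abs_div, abs_of_pos (by norm_num : (0:ℝ) < 2)] at e2
  have e : (gam r1 r2 b s)⁻¹ = (b:ℂ)^(-s) * ((Complex.Gamma (s/2))⁻¹)^r1 * ((Complex.Gamma s)⁻¹)^r2 := by
    rw [gam, mul_inv, mul_inv, inv_pow, inv_pow, Complex.cpow_neg]
  rw [e, norm_mul, norm_mul, norm_pow, norm_pow]
  calc _ ≤ Real.exp (|Real.log b| * 2) * (C * Real.exp (Real.pi * (|s.im|/2)))^r1 * (C * Real.exp (Real.pi * |s.im|))^r2 := by gcongr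
    _ = _ := by
      rw [mul_pow _ (Real.exp _), mul_pow _ (Real.exp _), ← Real.exp_nat_mul, ← Real.exp_nat_mul, add_mul, Real.exp_add]
      ring_nf

lemma gam_ne_zero (r1 r2 : ℕ) {b : ℝ} (hb : 0 < b) {s : ℂ} (h : -1 < s.re) (h0 : s.re ≠ 0) : gam r1 r2 b s ≠ 0 := by
  have hbc : (b:ℂ) ≠ 0 := by exact_mod_cast hb.ne'
  have aux : ∀ z : ℂ, -1 < z.re → z.re ≠ 0 → Complex.Gamma z ≠ 0 := by
    intro z h1 h2
    apply Complex.Gamma_ne_zero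
    intro m hm
    rw [hm] at h1 h2
    simp at h1 h2
    have : (1:ℝ) ≤ m := by exact_mod_cast Nat.one_le_iff_ne_zero.mpr h2
    have h3 : (m:ℝ) < 1 := by exact_mod_cast (by omega : m < 1)
    linarith
  rw [gam]
  have hs2 : (s/2).re = s.re/2 := by simp
  refine mul_ne_zero (mul_ne_zero ?_ (pow_ne_zero _ (aux _ ?_ ?_))) (pow_ne_zero _ (aux _ h h0))
  · rw [Complex.cpow_def_of_ne_zero hbc]; exact Complex.exp_ne_zero _
  · rw [hs2]; linarith
  · rw [hs2]; intro h; apply h0; linarith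

/-- The data of a Dirichlet series with functional equation. -/
structure FEData (Q Q' : Type) (r1 r2 : ℕ) where
  lam : Q → ℝ
  mu : Q' → ℝ
  lam_pos : ∀ q, 0 < lam q
  mu_pos : ∀ q, 0 < mu q
  b : ℝ
  b_pos : 0 < b
  L0 : ℂ → ℂ
  A : ℂ
  B : ℂ
  c1 : ℂ
  c2 : ℂ
  c1_ne : c1 ≠ 0
  L0_diff : Differentiable ℂ L0
  L0_bdd : ∀ x y : ℝ, ∃ M : ℝ, ∀ s : ℂ, x ≤ s.re → s.re ≤ y → ‖L0 s‖ ≤ M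
  lam_sum : ∀ x : ℝ, 1 < x → Summable (fun q => lam q ^ (-x))
  mu_sum : ∀ x : ℝ, 1 < x → Summable (fun q => mu q ^ (-x))
  eq1 : ∀ s : ℂ, 1 < s.re → L0 s - A / s - B / (1 - s) = c1 * (gam r1 r2 b s * ∑' q, ((lam q : ℝ) : ℂ) ^ (-s))
  eq2 : ∀ s : ℂ, 1 < s.re → L0 (1 - s) - A / (1 - s) - B / s = c2 * (gam r1 r2 b s * ∑' q, ((mu q : ℝ) : ℂ) ^ (-s))
  Cm : ℝ
  Cm_nn : 0 ≤ Cm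
  mu_count : ∀ Y : ℝ, 0 < Y → ∀ F : Finset Q', (∀ q ∈ F, mu q ≤ Y) → (F.card : ℝ) ≤ Cm * Y

lemma FEData.decomp {Q Q' : Type} {r1 r2 : ℕ} (P : FEData Q Q' r1 r2) (hr : 1 ≤ r1 + r2) :
    ∃ (H : ℂ → ℂ) (ρ : ℂ) (C k : ℝ), Differentiable ℂ H ∧ 0 ≤ k ∧
      (∀ s : ℂ, -(1/8) ≤ s.re → s.re ≤ 2 → 2 ≤ |s.im| → ‖H s‖ ≤ C * Real.exp (k * |s.im|)) ∧
      ∀ s : ℂ, s ≠ 0 → s ≠ 1 → P.c1⁻¹ * (gam r1 r2 P.b s)⁻¹ * (P.L0 s - P.A / s - P.B / (1 - s)) / s = H s / s + ρ / (s - 1) := by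
  set G : ℂ → ℂ := fun s => (gam r1 r2 P.b s)⁻¹ with hG
  have hGd : Differentiable ℂ G := ginv_diff r1 r2 P.b_pos
  obtain ⟨C, k, hC, hk, hgr⟩ := ginv_growth r1 r2 P.b_pos
  obtain ⟨M, hM⟩ := P.L0_bdd (-(1/8)) 2
  have dd : ∀ c : ℂ, Differentiable ℂ (dslope G c) := fun c => by
    have := (Complex.differentiableOn_dslope (f := G) (s := univ) (c := c) univ_mem).mpr hGd.differentiableOn
    exact differentiableOn_univ.mp this
  set ρ : ℂ := P.c1⁻¹ * (P.B * G 1) with hρ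
  set H : ℂ → ℂ := fun s => P.c1⁻¹ * (P.L0 s * G s - P.A * dslope G 0 s + P.B * dslope G 1 s) - ρ with hH
  have d0 : ∀ s : ℂ, s ≠ 0 → dslope G 0 s = G s / s := by
    intro s hs
    rw [dslope_of_ne _ hs, slope_def_field, show G 0 = 0 from ginv_zero hr P.b, sub_zero, sub_zero]
  have d1 : ∀ s : ℂ, s ≠ 1 → dslope G 1 s = (G s - G 1) / (s - 1) := by
    intro s hs
    rw [dslope_of_ne _ hs, slope_def_field]
  have hM0 : 0 ≤ M := (norm_nonneg _).trans (hM 0 (by simp) (by simp))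
  refine ⟨H, ρ, ‖P.c1⁻¹‖ * (M * C + ‖P.A‖ * C + ‖P.B‖ * (C + ‖G 1‖)) + ‖ρ‖, k, ?_, hk, ?_, ?_⟩
  · exact ((((P.L0_diff.mul hGd).sub ((dd 0).const_mul _)).add ((dd 1).const_mul _)).const_mul _).sub_const _
  · intro s h1 h2 h3
    have hg : ‖G s‖ ≤ C * Real.exp (k * |s.im|) := hgr s h1 h2 h3
    have hs1 : 1 ≤ ‖s‖ := by linarith [h3.trans (Complex.abs_im_le_norm s)]
    have hs2 : 1 ≤ ‖s - 1‖ := by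
      have := Complex.abs_im_le_norm (s - 1)
      simp at this; linarith
    have hs0 : s ≠ 0 := by rintro rfl; simp at hs1; linarith
    have hs0' : s ≠ 1 := by rintro rfl; simp at hs2; linarith
    have hX : 1 ≤ Real.exp (k * |s.im|) := Real.one_le_exp (by positivity)
    set X := Real.exp (k * |s.im|)
    have b0 : ‖dslope G 0 s‖ ≤ C * X := by
      rw [d0 s hs0, norm_div]; exact (div_le_self (norm_nonneg _) hs1).trans hg
    have b1 : ‖dslope G 1 s‖ ≤ (C + ‖G 1‖) * X := by
      rw [d1 s hs0', norm_div]; refine (div_le_self (norm_nonneg _) hs2).trans ?_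
      refine (norm_sub_le _ _).trans ?_
      rw [add_mul]
      exact add_le_add hg (le_mul_of_one_le_right (norm_nonneg _) hX)
    rw [hH]
    refine (norm_sub_le _ _).trans ?_
    rw [add_mul]
    refine add_le_add ?_ (le_mul_of_one_le_right (norm_nonneg _) hX)
    rw [norm_mul, mul_assoc]
    refine mul_le_mul_of_nonneg_left ?_ (norm_nonneg _)
    refine (norm_add_le _ _).trans ?_
    rw [add_mul, add_mul]
    refine add_le_add ((norm_sub_le _ _).trans (add_le_add ?_ ?_)) ?_
    · rw [norm_mul, mul_assoc]; exact mul_le_mul (hM s h1 h2) hg (norm_nonneg _) hM0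
    · rw [norm_mul, mul_assoc]; gcongr
    · rw [norm_mul, mul_assoc]; gcongr
  · intro s hs0 hs1
    simp only [hH]
    rw [d0 s hs0, d1 s hs1, hρ]
    have h1 : s - 1 ≠ 0 := sub_ne_zero.mpr hs1
    have h2 : 1 - s ≠ 0 := sub_ne_zero.mpr hs1.symm
    have := P.c1_ne
    change P.c1⁻¹ * G s * _ / s = _
    rw [show P.B / (1 - s) = - (P.B / (s - 1)) by rw [← div_neg, neg_sub]]
    field_simp
    ring

lemma weight_sum {Q' : Type} (mu : Q' → ℝ) (mu_pos : ∀ q, 0 < mu q) {Cm : ℝ} (hC : 0 ≤ Cm)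
    (hc : ∀ Y : ℝ, 0 < Y → ∀ F : Finset Q', (∀ q ∈ F, mu q ≤ Y) → (F.card : ℝ) ≤ Cm * Y) :
    ∃ S : ℝ, 0 ≤ S ∧ ∀ (y : ℝ) (F : Finset Q'), ∑ q ∈ F, (mu q)⁻¹ * Real.exp (-(1/8) * |y + Real.log (mu q)|) ≤ S := by
  have hsum := summable_exp_abs (c := 1/8) (by norm_num)
  set S0 : ℝ := ∑' k : ℤ, Real.exp (-((1/8) * |(k:ℝ)|)) with hS0
  have hS : 0 ≤ S0 := tsum_nonneg (fun k => (Real.exp_pos _).le)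
  refine ⟨Cm * Real.exp 2 * S0, by positivity, fun y F => ?_⟩
  have hterm : ∀ k : ℤ, (Cm * Real.exp (k + 1 - y)) * (Real.exp (y - k) * Real.exp (1 - (1/8) * |(k:ℝ)|)) =
     Cm * Real.exp 2 * Real.exp (-((1/8) * |(k:ℝ)|)) := by
    intro k
    rw [mul_assoc, mul_assoc, ← Real.exp_add, ← Real.exp_add, ← Real.exp_add]
    congr 2; ring
  have := group_sum (fun q => y + Real.log (mu q)) (fun q => (mu q)⁻¹ * Real.exp (-(1/8) * |y + Real.log (mu q)|))
    (fun k => Cm * Real.exp (k + 1 - y)) (fun k => Real.exp (y - k) * Real.exp (1 - (1/8) * |(k:ℝ)|))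
    (fun k => by positivity) ?_ ?_ ?_ F
  · refine this.trans (le_of_eq ?_)
    simp only [hterm]
    rw [tsum_mul_left]
  · intro q
    have hx : (mu q)⁻¹ = Real.exp (y - (y + Real.log (mu q))) := by
      rw [show y - (y + Real.log (mu q)) = - Real.log (mu q) by ring, Real.exp_neg, Real.exp_log (mu_pos q)]
    rw [hx]
    set x := y + Real.log (mu q)
    have h2 := Int.floor_le x
    have h3 := Int.lt_floor_add_one x
    have h5 : |((⌊x⌋:ℤ):ℝ)| ≤ |x| + 1 := by
      have : |((⌊x⌋:ℤ):ℝ) - x| ≤ 1 := by rw [abs_le]; constructor <;> linarith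
      have h4 := abs_add_le (((⌊x⌋:ℤ):ℝ) - x) x
      rw [sub_add_cancel] at h4
      linarith
    apply mul_le_mul _ _ (Real.exp_pos _).le (Real.exp_pos _).le
    · apply Real.exp_le_exp.mpr; linarith
    · apply Real.exp_le_exp.mpr; linarith
  · intro k F hF
    refine hc _ (Real.exp_pos _) F (fun q hq => ?_)
    have := (Int.floor_eq_iff.mp (hF q hq)).2
    rw [← Real.exp_log (mu_pos q)]
    apply Real.exp_le_exp.mpr; linarith
  · simp only [hterm]
    exact hsum.mul_left _

end Landau
end

section
open Filter Topology MeasureTheory Set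
open scoped BigOperators

namespace Landau

lemma pole_integrable {a b σ p : ℝ} (h1 : a ≤ σ) (h2 : σ ≤ b) (hσp : σ ≠ p) {H : ℂ → ℂ} (hH : Differentiable ℂ H)
    {C k : ℝ} (hb : ∀ s : ℂ, a ≤ s.re → s.re ≤ b → 2 ≤ |s.im| → ‖H s‖ ≤ C * Real.exp (k * |s.im|))
    (v : ℝ) {η : ℝ} (hη : 0 < η) :
    Integrable (fun t : ℝ => H (σ + t * Complex.I) * gw v η (σ + t * Complex.I) / (σ + t * Complex.I - p)) := by
  have hd : GDecay a b (fun s => (H s / (s - p)) * gw v η s) := by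
    refine gw_decay (C := |C|) (k := k) (abs_nonneg C) v hη (fun s h1 h2 h3 => ?_)
    have hs2 : 1 ≤ ‖s - p‖ := by
      have := Complex.abs_im_le_norm (s - p)
      simp at this; linarith
    rw [norm_div]
    exact (div_le_self (norm_nonneg _) hs2).trans ((hb s h1 h2 h3).trans (by gcongr; exact le_abs_self C))
  have := hd.integrable (σ := σ) h1 h2 (fun s hs => by
    have hs0 : s - p ≠ 0 := by
      intro h; apply hσp; have := congrArg Complex.re h; simp at this; linarith
    exact ((hH.continuous.continuousAt).div (continuousAt_id.sub continuousAt_const) hs0).mul (gw_differentiable v η).continuous.continuousAt)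
  refine this.congr (Eventually.of_forall fun t => ?_)
  simp only; ring

lemma countable_of_summable_pos {Q : Type} {f : Q → ℝ} (hf : Summable f) (hp : ∀ q, 0 < f q) : Countable Q := by
  have := hf.countable_support
  have h2 : Function.support f = univ := by
    ext q; simp [(hp q).ne']
  rw [h2] at this
  exact countable_univ_iff.mp this

lemma cpow_eq_exp {x : ℝ} (hx : 0 < x) (s : ℂ) : (x:ℂ)^s = Complex.exp (Real.log x * s) := by
  have hxc : (x:ℂ) ≠ 0 := by exact_mod_cast hx.ne'
  rw [Complex.cpow_def_of_ne_zero hxc, Complex.ofReal_log hx.le]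

theorem FEData.smooth {Q Q' : Type} {r1 r2 : ℕ} (P : FEData Q Q' r1 r2) (hn : 2 ≤ r1 + 2 * r2) :
    ∃ ρ C : ℝ, 0 ≤ C ∧ ∀ v η : ℝ, 0 < η → η ≤ 1 →
      Summable (fun q => Phi η (v - Real.log (P.lam q))) ∧
      |(∑' q, Phi η (v - Real.log (P.lam q))) - ρ * Real.exp v| ≤ C * (Real.exp v * η + η ^ (-(((r1 + 2 * r2 : ℝ) - 1) / 2))) := by
  have hQ : Countable Q := countable_of_summable_pos (P.lam_sum 2 (by norm_num)) (fun q => Real.rpow_pos_of_pos (P.lam_pos q) _)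
  have hQ' : Countable Q' := countable_of_summable_pos (P.mu_sum 2 (by norm_num)) (fun q => Real.rpow_pos_of_pos (P.mu_pos q) _)
  have hn' : (2:ℝ) ≤ r1 + 2 * r2 := by exact_mod_cast hn
  obtain ⟨H, ρ, C, k, hHd, hk, hHg, hdec⟩ := P.decomp (by omega)
  obtain ⟨CK, hCK, hKer⟩ := kernel_min r1 r2 hn P.b_pos
  obtain ⟨S, hS, hW⟩ := weight_sum P.mu P.mu_pos P.Cm_nn P.mu_count
  have hπ : (2 * Real.pi : ℂ) ≠ 0 := by
    have : (Real.pi:ℂ) ≠ 0 := by exact_mod_cast Real.pi_ne_zero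
    simpa using this
  refine ⟨ρ.re, |ρ.re| * 2 + ‖H 0‖ + ‖P.c2 / P.c1‖ * (CK * S), by positivity, fun v η hη hη1 => ?_⟩
  set m : ℝ := ((r1 + 2 * r2 : ℝ) - 1) / 2 with hm
  -- the line 2
  have line2 : HasSum (fun q => (2 * Real.pi : ℂ) * (Phi η (v - Real.log (P.lam q)) : ℝ))
      (∫ t : ℝ, (H ((2:ℝ) + t * Complex.I) * gw v η ((2:ℝ) + t * Complex.I) / ((2:ℝ) + t * Complex.I - (0:ℝ)) +
        ρ * gw v η ((2:ℝ) + t * Complex.I) / ((2:ℝ) + t * Complex.I - (1:ℝ)))) := by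
    set F : Q → ℝ → ℂ := fun q t => gw (v - Real.log (P.lam q)) η ((2:ℝ) + t * Complex.I) / ((2:ℝ) + t * Complex.I) with hF
    have hFe : ∀ q t, F q t = ((P.lam q : ℝ) : ℂ) ^ (-((2:ℝ) + t * Complex.I)) * (gw v η ((2:ℝ) + t * Complex.I) / ((2:ℝ) + t * Complex.I)) := by
      intro q t
      simp only [hF]
      rw [sub_eq_add_neg v, gw_add, cpow_eq_exp (P.lam_pos q), mul_div_assoc]
      congr 2
      push_cast; ring
    have hFi : ∀ q, Integrable (F q) := fun q => perron_integrable (b := 2) (by norm_num) _ hη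
    have hFn : ∀ q, ∫ t, ‖F q t‖ = P.lam q ^ (-2:ℝ) * ∫ t : ℝ, ‖gw v η ((2:ℝ) + t * Complex.I) / ((2:ℝ) + t * Complex.I)‖ := by
      intro q
      rw [← integral_const_mul]
      congr 1; ext t
      rw [hFe, norm_mul, Complex.norm_cpow_eq_rpow_re_of_pos (P.lam_pos q)]
      congr 2
      simp
    have hs := hasSum_integral_of_summable_integral_norm hFi (by
      simp only [hFn]
      exact (P.lam_sum 2 (by norm_num)).mul_right _)
    have e1 : ∀ q, ∫ t, F q t = (2 * Real.pi : ℂ) * (Phi η (v - Real.log (P.lam q)) : ℝ) := by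
      intro q
      have := perron_pos (b := 2) (by norm_num) (v - Real.log (P.lam q)) hη
      exact this
    simp only [e1] at hs
    refine Eq.subst (motive := fun z => HasSum _ z) ?_ hs
    apply integral_congr_ae
    refine Eventually.of_forall (fun t => ?_)
    simp only [hFe]
    rw [tsum_mul_right]
    set s : ℂ := ((2:ℝ):ℂ) + t * Complex.I with hsdef
    have hre : s.re = 2 := by simp [hsdef]
    have hs0 : s ≠ 0 := by intro h; rw [h] at hre; simp at hre
    have hs1 : s ≠ 1 := by intro h; rw [h] at hre; simp at hre
    have hE := P.eq1 s (by rw [hre]; norm_num)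
    have hD := hdec s hs0 hs1
    rw [hE] at hD
    have hg := gam_ne_zero r1 r2 P.b_pos (s := s) (by rw [hre]; norm_num) (by rw [hre]; norm_num)
    have hc1 := P.c1_ne
    have e3 : P.c1⁻¹ * (gam r1 r2 P.b s)⁻¹ * (P.c1 * (gam r1 r2 P.b s * ∑' q, ((P.lam q : ℝ) : ℂ) ^ (-s))) = ∑' q, ((P.lam q : ℝ) : ℂ) ^ (-s) := by
      field_simp
    rw [e3] at hD
    symm
    calc _ = (H s / s + ρ / (s - 1)) * gw v η s := by push_cast; ring
      _ = _ := by rw [← hD]; ring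
  -- the line -1/8
  have line1 : HasSum (fun q => ((P.c2 / P.c1) * ((P.mu q)⁻¹ : ℝ)) * ∫ t : ℝ, GK r1 r2 P.b (((-(1/8) : ℝ):ℂ) + t * Complex.I) / (((-(1/8) : ℝ):ℂ) + t * Complex.I) * gw (v + Real.log (P.mu q)) η (((-(1/8) : ℝ):ℂ) + t * Complex.I))
      (∫ t : ℝ, (H ((-(1/8):ℝ) + t * Complex.I) * gw v η ((-(1/8):ℝ) + t * Complex.I) / ((-(1/8):ℝ) + t * Complex.I - (0:ℝ)) +
        ρ * gw v η ((-(1/8):ℝ) + t * Complex.I) / ((-(1/8):ℝ) + t * Complex.I - (1:ℝ)))) := by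
    set F : Q' → ℝ → ℂ := fun q t => ((P.c2 / P.c1) * ((P.mu q)⁻¹ : ℝ)) * (GK r1 r2 P.b (((-(1/8) : ℝ):ℂ) + t * Complex.I) / (((-(1/8) : ℝ):ℂ) + t * Complex.I) * gw (v + Real.log (P.mu q)) η (((-(1/8) : ℝ):ℂ) + t * Complex.I)) with hF
    have hFe : ∀ q t, F q t = ((P.mu q : ℝ) : ℂ) ^ (-(1 - (((-(1/8) : ℝ):ℂ) + t * Complex.I))) * ((P.c2 / P.c1) * (GK r1 r2 P.b (((-(1/8) : ℝ):ℂ) + t * Complex.I) / (((-(1/8) : ℝ):ℂ) + t * Complex.I) * gw v η (((-(1/8) : ℝ):ℂ) + t * Complex.I))) := by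
      intro q t
      simp only [hF]
      rw [gw_add, cpow_eq_exp (P.mu_pos q)]
      have : ((P.mu q)⁻¹ : ℝ) = Real.exp (- Real.log (P.mu q)) := by rw [Real.exp_neg, Real.exp_log (P.mu_pos q)]
      rw [this, Complex.ofReal_exp]
      set s : ℂ := (((-(1/8) : ℝ):ℂ) + t * Complex.I)
      rw [show ((Real.log (P.mu q) : ℝ):ℂ) * (-(1 - s)) = ((-Real.log (P.mu q) : ℝ):ℂ) + Real.log (P.mu q) * s by push_cast; ring, Complex.exp_add]
      ring
    have hFi : ∀ q, Integrable (F q) := fun q => (kern_integrable r1 r2 P.b_pos (c := -(1/8)) (by norm_num) (by norm_num [abs_of_pos]) _ hη).const_mul _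
    have hFn : ∀ q, ∫ t, ‖F q t‖ = P.mu q ^ (-(9/8):ℝ) * ∫ t : ℝ, ‖((P.c2 / P.c1) * (GK r1 r2 P.b (((-(1/8) : ℝ):ℂ) + t * Complex.I) / (((-(1/8) : ℝ):ℂ) + t * Complex.I) * gw v η (((-(1/8) : ℝ):ℂ) + t * Complex.I)))‖ := by
      intro q
      rw [← integral_const_mul]
      congr 1; ext t
      rw [hFe, norm_mul, Complex.norm_cpow_eq_rpow_re_of_pos (P.mu_pos q)]
      congr 2
      simp; norm_num
    have hs := hasSum_integral_of_summable_integral_norm hFi (by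
      simp only [hFn]
      exact (P.mu_sum (9/8) (by norm_num)).mul_right _)
    have e1 : ∀ q, ∫ t, F q t = ((P.c2 / P.c1) * ((P.mu q)⁻¹ : ℝ)) * ∫ t : ℝ, GK r1 r2 P.b (((-(1/8) : ℝ):ℂ) + t * Complex.I) / (((-(1/8) : ℝ):ℂ) + t * Complex.I) * gw (v + Real.log (P.mu q)) η (((-(1/8) : ℝ):ℂ) + t * Complex.I) := by
      intro q
      rw [← integral_const_mul]
    simp only [e1] at hs
    refine Eq.subst (motive := fun z => HasSum _ z) ?_ hs
    apply integral_congr_ae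
    refine Eventually.of_forall (fun t => ?_)
    simp only [hFe]
    rw [tsum_mul_right]
    set s : ℂ := ((-(1/8) : ℝ):ℂ) + t * Complex.I with hsdef
    have hre : s.re = -(1/8) := by simp [hsdef]
    have hs0 : s ≠ 0 := by intro h; rw [h] at hre; simp at hre
    have hs1 : s ≠ 1 := by intro h; rw [h] at hre; norm_num at hre
    have hE := P.eq2 (1 - s) (by simp [hre])
    rw [sub_sub_cancel, gam_one_sub r1 r2 P.b_pos (s := s) (by rw [hre]; norm_num) (by rw [hre]; norm_num) (by rw [hre]; norm_num)] at hE
    have hD := hdec s hs0 hs1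
    rw [hE] at hD
    have hg := gam_ne_zero r1 r2 P.b_pos (s := s) (by rw [hre]; norm_num) (by rw [hre]; norm_num)
    have hc1 := P.c1_ne
    have e3 : P.c1⁻¹ * (gam r1 r2 P.b s)⁻¹ * (P.c2 * (GK r1 r2 P.b s * gam r1 r2 P.b s * ∑' q, ((P.mu q : ℝ) : ℂ) ^ (-(1 - s)))) = P.c2 / P.c1 * GK r1 r2 P.b s * ∑' q, ((P.mu q : ℝ) : ℂ) ^ (-(1 - s)) := by
      field_simp
    rw [e3] at hD
    symm
    calc _ = (H s / s + ρ / (s - 1)) * gw v η s := by push_cast; ring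
      _ = _ := by rw [← hD]; ring
  -- shift
  have hρg : ∀ s : ℂ, -(1/8) ≤ s.re → s.re ≤ 2 → 2 ≤ |s.im| → ‖(fun _ : ℂ => ρ) s‖ ≤ ‖ρ‖ * Real.exp (0 * |s.im|) := by
    intro s _ _ _; simp
  have p0 := pole_shift (a := -(1/8)) (b := 2) (p := 0) (by norm_num) (by norm_num) hHd hk hHg v hη
  have p1 := pole_shift (a := -(1/8)) (b := 2) (p := 1) (by norm_num) (by norm_num) (differentiable_const ρ) le_rfl hρg v hη
  rw [integral_add (pole_integrable (a := -(1/8)) (b := 2) (by norm_num) le_rfl (by norm_num) hHd hHg v hη)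
    (pole_integrable (a := -(1/8)) (b := 2) (by norm_num) le_rfl (by norm_num) (differentiable_const ρ) hρg v hη)] at line2
  rw [integral_add (pole_integrable (a := -(1/8)) (b := 2) le_rfl (by norm_num) (by norm_num) hHd hHg v hη)
    (pole_integrable (a := -(1/8)) (b := 2) le_rfl (by norm_num) (by norm_num) (differentiable_const ρ) hρg v hη)] at line1
  have hsumC : Summable (fun q => ((Phi η (v - Real.log (P.lam q)) : ℝ) : ℂ)) := by
    have := line2.summable.mul_left ((2 * Real.pi : ℂ)⁻¹)
    refine this.congr (fun q => ?_)
    rw [← mul_assoc, inv_mul_cancel₀ hπ, one_mul]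
  have hsum : Summable (fun q => Phi η (v - Real.log (P.lam q))) := by exact_mod_cast hsumC
  refine ⟨hsum, ?_⟩
  have t2 := line2.tsum_eq
  have t1 := line1.tsum_eq
  rw [tsum_mul_left, ← Complex.ofReal_tsum] at t2
  set R : ℂ := ∑' q, ((P.c2 / P.c1) * ((P.mu q)⁻¹ : ℝ)) * ∫ t : ℝ, GK r1 r2 P.b (((-(1/8) : ℝ):ℂ) + t * Complex.I) / (((-(1/8) : ℝ):ℂ) + t * Complex.I) * gw (v + Real.log (P.mu q)) η (((-(1/8) : ℝ):ℂ) + t * Complex.I) with hR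
  have hηm : 1 ≤ η ^ (-m) := by
    apply Real.one_le_rpow_of_pos_of_le_one_of_nonpos hη hη1; rw [hm]; linarith
  have hRb : ‖R‖ ≤ ‖P.c2 / P.c1‖ * (CK * S) * η ^ (-m) := by
    have hle : ∀ q, ‖((P.c2 / P.c1) * ((P.mu q)⁻¹ : ℝ)) * ∫ t : ℝ, GK r1 r2 P.b (((-(1/8) : ℝ):ℂ) + t * Complex.I) / (((-(1/8) : ℝ):ℂ) + t * Complex.I) * gw (v + Real.log (P.mu q)) η (((-(1/8) : ℝ):ℂ) + t * Complex.I)‖ ≤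
       (‖P.c2 / P.c1‖ * CK * η ^ (-m)) * ((P.mu q)⁻¹ * Real.exp (-(1/8) * |(v + (r1 + 2 * r2 : ℝ) * Real.log η) + Real.log (P.mu q)|)) := by
      intro q
      rw [norm_mul, norm_mul, Complex.norm_real, Real.norm_eq_abs, abs_of_pos (inv_pos.mpr (P.mu_pos q))]
      have := hKer (v + Real.log (P.mu q)) η hη hη1
      have hp := inv_pos.mpr (P.mu_pos q)
      calc _ ≤ ‖P.c2 / P.c1‖ * (P.mu q)⁻¹ * (CK * η ^ (-m) * Real.exp (-(1/8) * |v + Real.log (P.mu q) + (r1 + 2 * r2 : ℝ) * Real.log η|)) := by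
            gcongr
        _ = _ := by
            rw [show v + Real.log (P.mu q) + (r1 + 2 * r2 : ℝ) * Real.log η = (v + (r1 + 2 * r2 : ℝ) * Real.log η) + Real.log (P.mu q) by ring]
            ring
    have hfs : ∀ F : Finset Q', ∑ q ∈ F, ‖((P.c2 / P.c1) * ((P.mu q)⁻¹ : ℝ)) * ∫ t : ℝ, GK r1 r2 P.b (((-(1/8) : ℝ):ℂ) + t * Complex.I) / (((-(1/8) : ℝ):ℂ) + t * Complex.I) * gw (v + Real.log (P.mu q)) η (((-(1/8) : ℝ):ℂ) + t * Complex.I)‖ ≤ ‖P.c2 / P.c1‖ * (CK * S) * η ^ (-m) := by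
      intro F
      refine (Finset.sum_le_sum (fun q _ => hle q)).trans ?_
      rw [← Finset.mul_sum]
      calc _ ≤ (‖P.c2 / P.c1‖ * CK * η ^ (-m)) * S := by gcongr; exact hW _ F
        _ = _ := by ring
    rw [hR]
    refine (norm_tsum_le_tsum_norm (summable_of_sum_le (fun q => norm_nonneg _) hfs)).trans ?_
    exact Real.tsum_le_of_sum_le (fun q => norm_nonneg _) hfs
  set T : ℝ := ∑' q, Phi η (v - Real.log (P.lam q)) with hT
  have hg0 : gw v η ((0:ℝ):ℂ) = 1 := by rw [gw]; simp
  have hg1 : gw v η ((1:ℝ):ℂ) = ((Real.exp (v + η^2/2) : ℝ) : ℂ) := by rw [gw]; push_cast; simp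
  rw [hg0, mul_one] at p0
  rw [hg1] at p1
  have main : (2 * Real.pi : ℂ) * (T : ℂ) = 2 * Real.pi * (H 0 + ρ * (Real.exp (v + η^2/2) : ℝ)) + R := by
    rw [t2, t1]
    rw [Complex.ofReal_zero] at p0
    simp only [Complex.ofReal_zero] 
    linear_combination p0 + p1
  have main2 : (T : ℂ) = H 0 + ρ * (Real.exp (v + η^2/2) : ℝ) + R / (2 * Real.pi) := by
    apply mul_left_cancel₀ hπ
    rw [main]; field_simp
  have main3 : T = (H 0).re + ρ.re * Real.exp (v + η^2/2) + (R / (2 * Real.pi)).re := by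
    have := congrArg Complex.re main2
    rw [Complex.add_re, Complex.add_re, Complex.re_mul_ofReal, Complex.ofReal_re] at this
    exact this
  have hR2 : |(R / (2 * Real.pi)).re| ≤ ‖P.c2 / P.c1‖ * (CK * S) * η ^ (-m) := by
    refine (Complex.abs_re_le_norm _).trans (le_trans ?_ hRb)
    rw [norm_div]
    apply div_le_self (norm_nonneg _)
    rw [norm_mul, Complex.norm_real, Real.norm_eq_abs, abs_of_pos Real.pi_pos]
    have := Real.pi_gt_three
    norm_num; linarith
  have hH0 : |(H 0).re| ≤ ‖H 0‖ * η ^ (-m) := (Complex.abs_re_le_norm _).trans (le_mul_of_one_le_right (norm_nonneg _) hηm)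
  have hex : |Real.exp (v + η^2/2) - Real.exp v| ≤ 2 * (Real.exp v * η) := by
    rw [Real.exp_add, abs_of_nonneg (by
      have := Real.one_le_exp (show 0 ≤ η^2/2 by positivity)
      nlinarith [Real.exp_pos v])]
    have h1 : |η^2/2| ≤ 1 := by rw [abs_of_nonneg (by positivity)]; nlinarith
    have := Real.abs_exp_sub_one_le h1
    rw [abs_le] at this
    rw [abs_of_nonneg (by positivity)] at this
    have h2 : Real.exp (η^2/2) - 1 ≤ 2 * η := by nlinarith [this.2]
    nlinarith [Real.exp_pos v]
  have : T - ρ.re * Real.exp v = ρ.re * (Real.exp (v + η^2/2) - Real.exp v) + (H 0).re + (R / (2 * Real.pi)).re := by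
    rw [main3]; ring
  rw [this]
  refine (abs_add_le _ _).trans ((add_le_add (abs_add_le _ _) le_rfl).trans ?_)
  rw [abs_mul]
  have hpos : 0 < Real.exp v * η := by positivity
  have hpos2 : 0 < η ^ (-m) := by positivity
  have f1 : |ρ.re| * |Real.exp (v + η^2/2) - Real.exp v| ≤ |ρ.re| * (2 * (Real.exp v * η)) := by gcongr
  have q1 : 0 ≤ |ρ.re| * 2 * η ^ (-m) := by positivity
  have q2 : 0 ≤ (‖H 0‖ + ‖P.c2 / P.c1‖ * (CK * S)) * (Real.exp v * η) := by positivity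
  calc _ ≤ |ρ.re| * (2 * (Real.exp v * η)) + ‖H 0‖ * η ^ (-m) + ‖P.c2 / P.c1‖ * (CK * S) * η ^ (-m) := by
        linarith
    _ ≤ _ := by linarith

theorem FEData.count {Q Q' : Type} {r1 r2 : ℕ} (P : FEData Q Q' r1 r2) (hn : 2 ≤ r1 + 2 * r2) :
    ∃ ρ C : ℝ, 0 ≤ C ∧ ∀ X : ℝ, 1 ≤ X → {q | P.lam q ≤ X}.Finite ∧
      |({q | P.lam q ≤ X}.ncard : ℝ) - ρ * X| ≤ C * X ^ (1 - 2 / ((r1 + 2 * r2 : ℝ) + 1)) := by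
  obtain ⟨ρ, C, hC, h⟩ := P.smooth hn
  have hn' : (2:ℝ) ≤ r1 + 2 * r2 := by exact_mod_cast hn
  set n : ℝ := (r1 + 2 * r2 : ℝ) with hnn
  obtain ⟨C', hC', h'⟩ := tauber (fun q => Real.log (P.lam q)) (m := (n-1)/2) (by linarith) hC h
  refine ⟨ρ, C' * 2, by positivity, fun X hX => ?_⟩
  have hX0 : 0 < X := by linarith
  have hη : X ^ (-(2/(n+1))) ≤ 1 := Real.rpow_le_one_of_one_le_of_nonpos hX (by rw [neg_nonpos]; positivity)
  have := h' (Real.log X) (X ^ (-(2/(n+1)))) (by positivity) hη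
  have hset : {q | Real.log (P.lam q) ≤ Real.log X} = {q | P.lam q ≤ X} := by
    ext q
    exact Real.log_le_log_iff (P.lam_pos q) hX0
  rw [hset, Real.exp_log hX0] at this
  refine ⟨this.1, this.2.trans (le_of_eq ?_)⟩
  have e1 : X * X ^ (-(2/(n+1))) = X ^ (1 - 2/(n+1)) := by
    rw [sub_eq_add_neg, Real.rpow_add hX0, Real.rpow_one]
  have e2 : (X ^ (-(2/(n+1)))) ^ (-((n-1)/2)) = X ^ (1 - 2/(n+1)) := by
    rw [← Real.rpow_mul hX0.le]
    congr 1
    have : n + 1 ≠ 0 := by linarith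
    field_simp; ring
  rw [e1, e2]; ring

end Landau
end

section
open Filter Topology MeasureTheory Set
open scoped BigOperators

namespace Landau

section
variable {ι J : Type} [Fintype ι] [Fintype J]

lemma summable_pi_prod (u : ι → ℤ → ℝ) (h0 : ∀ i k, 0 ≤ u i k) (hs : ∀ i, Summable (u i)) :
    Summable fun k : ι → ℤ => ∏ i, u i (k i) := by
  classical
  refine summable_of_sum_le (c := ∏ i, ∑' k, u i k)
    (fun k => Finset.prod_nonneg fun i _ => h0 i _) fun F => ?_
  calc ∑ k ∈ F, ∏ i, u i (k i)
      ≤ ∑ k ∈ Fintype.piFinset fun i => F.image fun k => k i, ∏ i, u i (k i) := by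
        refine Finset.sum_le_sum_of_subset_of_nonneg ?_
          fun k _ _ => Finset.prod_nonneg fun i _ => h0 i _
        intro k hk
        rw [Fintype.mem_piFinset]
        exact fun i => Finset.mem_image_of_mem _ hk
    _ = ∏ i, ∑ k ∈ F.image (fun k => k i), u i k := (Finset.prod_univ_sum _ _).symm
    _ ≤ _ := Finset.prod_le_prod (fun i _ => Finset.sum_nonneg fun k _ => h0 i _)
        fun i _ => (hs i).sum_le_tsum _ fun k _ => h0 i k

lemma summable_gauss_int {c : ℝ} (hc : 0 < c) : Summable fun k : ℤ => Real.exp (-(c * (k:ℝ)^2)) := by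
  have h : Summable fun k : ℤ => Real.exp (-(c * |(k:ℝ)|)) := by
    have h1 : Summable fun n : ℕ => Real.exp (-(c * (n:ℝ))) := by
      have := Real.summable_exp_nat_mul_iff.2 (neg_lt_zero.2 hc)
      refine this.congr fun n => ?_
      congr 1; ring
    refine Summable.of_nat_of_neg ?_ ?_
    · simpa using h1
    · simpa using h1
  refine h.of_nonneg_of_le (fun k => (Real.exp_pos _).le) fun k => ?_
  apply Real.exp_le_exp.2
  have : |(k:ℝ)| ≤ (k:ℝ)^2 := by
    rw [← sq_abs]
    rcases eq_or_ne k 0 with rfl | hk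
    · simp
    · have : (1:ℝ) ≤ |(k:ℝ)| := by exact_mod_cast Int.one_le_abs hk
      nlinarith
  nlinarith

/-- Quadratic lower bound for a positive diagonal form composed with an injective map. -/
lemma quad_lower (M : (ι → ℝ) ≃ₗ[ℝ] (J → ℝ)) (s : J → ℝ) (hs : ∀ j, 0 < s j) :
    ∃ c > 0, ∀ x : ι → ℝ, c * ∑ i, (x i)^2 ≤ ∑ j, (s j * M x j)^2 := by
  classical
  -- sup-norm lower bound
  obtain ⟨C, hC, hb⟩ : ∃ C > 0, ∀ x : ι → ℝ, ‖x‖ ≤ C * ‖M x‖ := by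
    let L := M.symm.toContinuousLinearEquiv
    refine ⟨‖(L : (J → ℝ) →L[ℝ] (ι → ℝ))‖ + 1, by positivity, fun x => ?_⟩
    have := (L : (J → ℝ) →L[ℝ] (ι → ℝ)).le_opNorm (M x)
    have e : (L : (J → ℝ) →L[ℝ] (ι → ℝ)) (M x) = x := by simp [L]
    rw [e] at this
    nlinarith [norm_nonneg (M x)]
  obtain ⟨δ, hδ, hsδ⟩ : ∃ δ > 0, ∀ j, δ ≤ s j := by
    rcases isEmpty_or_nonempty J with h | h
    · exact ⟨1, one_pos, fun j => (h.false j).elim⟩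
    · obtain ⟨j, hj⟩ := Finite.exists_min s
      exact ⟨s j, hs j, hj⟩
  refine ⟨δ^2 / (C^2 * (Fintype.card ι + 1)), by positivity, fun x => ?_⟩
  have h1 : ‖M x‖^2 * δ^2 ≤ ∑ j, (s j * M x j)^2 := by
    rcases isEmpty_or_nonempty J with h | h
    · have : ‖M x‖ = 0 := by simp [Subsingleton.elim (M x) 0]
      simp [this]
    · obtain ⟨j, hj⟩ := Finite.exists_max (fun j => ‖M x j‖)
      have hj2 : ‖M x‖ = ‖M x j‖ := le_antisymm
        ((pi_norm_le_iff_of_nonneg (norm_nonneg _)).2 hj) (norm_le_pi_norm _ j)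
      rw [hj2]
      refine le_trans ?_ (Finset.single_le_sum (f := fun j => (s j * M x j)^2)
        (fun j _ => sq_nonneg _) (Finset.mem_univ j))
      simp only [Real.norm_eq_abs, sq_abs, mul_pow]
      have := pow_le_pow_left₀ hδ.le (hsδ j) 2
      nlinarith [sq_nonneg (M x j)]
  have h2 : ∑ i, (x i)^2 ≤ (Fintype.card ι + 1) * ‖x‖^2 := by
    calc ∑ i, (x i)^2 ≤ ∑ i : ι, ‖x‖^2 := Finset.sum_le_sum fun i _ => by
          rw [← sq_abs]; exact pow_le_pow_left₀ (abs_nonneg _) (norm_le_pi_norm x i) 2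
      _ ≤ _ := by simp; nlinarith [sq_nonneg ‖x‖]
  have h3 : ‖x‖^2 ≤ C^2 * ‖M x‖^2 := by
    rw [← mul_pow]; exact pow_le_pow_left₀ (norm_nonneg _) (hb x) 2
  rw [div_mul_eq_mul_div, div_le_iff₀ (by positivity)]
  calc δ^2 * ∑ i, (x i)^2 ≤ δ^2 * ((Fintype.card ι + 1) * (C^2 * ‖M x‖^2)) := by
        gcongr; exact h2.trans (by gcongr)
    _ = (‖M x‖^2 * δ^2) * (C^2 * (Fintype.card ι + 1)) := by ring
    _ ≤ _ := by gcongr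

/-- Multidimensional Poisson summation. -/
theorem poisson_pi (g : (ι → ℝ) → ℂ) (hg : Continuous g)
    (B : (ι → ℝ) → ℝ) (hB : Continuous B) (u : (ι → ℤ) → ℝ) (hu : Summable u) (hu0 : ∀ k, 0 ≤ u k)
    (hb : ∀ x k, ‖g (x + fun i => (k i : ℝ))‖ ≤ B x * u k)
    (G : (ι → ℤ) → ℂ) (hG : Summable G)
    (hIntg : Integrable g)
    (hGe : ∀ n, G n = ∫ x : ι → ℝ, Complex.exp (-(2 * Real.pi * Complex.I * ∑ i, (n i : ℂ) * (x i:ℂ))) * g x) :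
    ∑' k : ι → ℤ, g (fun i => (k i : ℝ)) = ∑' n, G n := by
  classical
  set P : (ι → ℝ) → ℂ := fun x => ∑' k : ι → ℤ, g (x + fun i => (k i : ℝ)) with hP
  have hPc : Continuous P := by
    rw [continuous_iff_continuousAt]
    intro x
    obtain ⟨U, hU, hUb⟩ : ∃ U ∈ 𝓝 x, ∀ y ∈ U, B y ≤ B x + 1 :=
      ⟨{y | B y < B x + 1}, (isOpen_lt hB continuous_const).mem_nhds (by simp), fun y hy => le_of_lt hy⟩
    have : ContinuousOn P U := by
      refine continuousOn_tsum (u := fun k => (B x + 1) * u k) (fun k => ?_) (hu.mul_left _) ?_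
      · exact (hg.comp (by fun_prop)).continuousOn
      · intro k y hy
        exact (hb y k).trans (mul_le_mul_of_nonneg_right (hUb y hy) (hu0 k))
    exact this.continuousAt hU
  have hper : ∀ x (m : ι → ℤ), P (x + fun i => (m i : ℝ)) = P x := by
    intro x m
    simp only [hP]
    rw [← (Equiv.addLeft m).tsum_eq (fun k : ι → ℤ => g (x + fun i => (k i : ℝ)))]
    refine tsum_congr fun k => ?_
    congr 1
    ext i; simp; ring
  let mk : (ι → ℝ) → UnitAddTorus ι := Pi.map fun _ => ((↑) : ℝ → UnitAddCircle)
  have hmk : IsOpenQuotientMap mk := IsOpenQuotientMap.piMap fun i =>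
    QuotientAddGroup.isOpenQuotientMap_mk
  have hfact : ∀ x y, mk x = mk y → P x = P y := by
    intro x y hxy
    have : ∀ i, ∃ m : ℤ, x i = y i + m := by
      intro i
      have h1 : ((x i : ℝ) : UnitAddCircle) = (y i : ℝ) := congrFun hxy i
      rw [QuotientAddGroup.eq] at h1
      obtain ⟨m, hm⟩ := AddSubgroup.mem_zmultiples_iff.1 h1
      refine ⟨-m, ?_⟩
      simp at hm ⊢
      linarith
    choose m hm using this
    rw [← hper y m]
    congr 1; ext i; exact hm i
  let F : C(UnitAddTorus ι, ℂ) :=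
    ⟨fun t => P (Function.surjInv hmk.surjective t), by
      rw [hmk.isQuotientMap.continuous_iff]
      convert! hPc using 1
      ext x
      exact hfact _ _ (Function.surjInv_eq hmk.surjective _)⟩
  have hF : ∀ x, F (mk x) = P x := fun x => hfact _ _ (Function.surjInv_eq hmk.surjective _)
  set D : Set (ι → ℝ) := {x | ∀ i, x i ∈ Ioc (0:ℝ) (0 + 1)} with hD
  have hDm : MeasurableSet D := MeasurableSet.univ_pi' (fun i => measurableSet_Ioc)
  let e : (ι → ℤ) → (ι → ℝ) → ℂ := fun n x => Complex.exp (-(2 * Real.pi * Complex.I * ∑ i, (n i : ℂ) * (x i:ℂ)))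
  have he : ∀ n x, UnitAddTorus.mFourier (-n) (mk x) = e n x := by
    intro n x
    simp only [UnitAddTorus.mFourier, ContinuousMap.coe_mk, mk, Pi.map_apply, fourier_coe_apply, e,
      Pi.neg_apply]
    rw [← Complex.exp_sum]
    congr 1
    rw [Finset.mul_sum, ← Finset.sum_neg_distrib]
    refine Finset.sum_congr rfl fun i _ => ?_
    push_cast; ring
  have heper : ∀ n x (k : ι → ℤ), e n (x + fun i => (k i : ℝ)) = e n x := by
    intro n x k
    rw [← he, ← he]
    congr 1
    ext i
    simp [mk]
  have hec : ∀ n, Continuous (e n) := fun n => by fun_prop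
  have hen : ∀ n x, ‖e n x‖ = 1 := by
    intro n x
    simp only [e]
    rw [show (-(2 * Real.pi * Complex.I * ∑ i, (n i : ℂ) * (x i:ℂ)) : ℂ)
      = ((-(2 * Real.pi * ∑ i, (n i : ℝ) * x i) : ℝ) : ℂ) * Complex.I by push_cast; ring]
    exact Complex.norm_exp_ofReal_mul_I _
  obtain ⟨CB, hCB⟩ : ∃ CB, ∀ x ∈ D, B x ≤ CB := by
    have hc : IsCompact (Set.pi univ fun _ : ι => Icc (0:ℝ) 1) := isCompact_univ_pi fun _ => isCompact_Icc
    obtain ⟨C, hC⟩ := (hc.image hB).bddAbove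
    refine ⟨C, fun x hx => hC ⟨x, ?_, rfl⟩⟩
    intro i _
    have := hx i
    simp at this
    exact ⟨this.1.le, this.2⟩
  have hDfin : volume D < ⊤ := by
    have : D ⊆ Set.pi univ fun _ : ι => Icc (0:ℝ) 1 := by
      intro x hx i _
      have := hx i
      simp at this
      exact ⟨this.1.le, this.2⟩
    exact (measure_mono this).trans_lt (isCompact_univ_pi fun _ => isCompact_Icc).measure_lt_top
  have hcoef : ∀ n, UnitAddTorus.mFourierCoeff F n = G n := by
    intro n
    rw [UnitAddTorus.mFourierCoeff_eq_integral F n (fun _ => 0), hGe]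
    have h1 : ∀ x : ι → ℝ, UnitAddTorus.mFourier (-n) (fun i => (x i : UnitAddCircle)) • F (fun i => (x i : UnitAddCircle))
        = ∑' k : ι → ℤ, e n (x + fun i => (k i : ℝ)) * g (x + fun i => (k i : ℝ)) := by
      intro x
      change UnitAddTorus.mFourier (-n) (mk x) • F (mk x) = _
      rw [he, hF, smul_eq_mul, hP]
      simp only [heper]
      rw [tsum_mul_left]
    simp_rw [h1]
    -- swap
    have hswap : HasSum (fun k : ι → ℤ => ∫ x in D, e n (x + fun i => (k i : ℝ)) * g (x + fun i => (k i : ℝ)))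
        (∫ x in D, ∑' k : ι → ℤ, e n (x + fun i => (k i : ℝ)) * g (x + fun i => (k i : ℝ))) := by
      have hi : ∀ k : ι → ℤ, ∀ x ∈ D, ‖e n (x + fun i => (k i : ℝ)) * g (x + fun i => (k i : ℝ))‖ ≤ CB * u k := by
        intro k x hx
        rw [norm_mul, hen, one_mul]
        exact (hb x k).trans (mul_le_mul_of_nonneg_right (hCB x hx) (hu0 k))
      have hIntg' : ∀ k : ι → ℤ, Integrable (fun x => e n (x + fun i => (k i : ℝ)) * g (x + fun i => (k i : ℝ))) (volume.restrict D) := by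
        intro k
        refine Measure.integrableOn_of_bounded hDfin.ne ?_ (M := CB * u k) ((ae_restrict_mem hDm).mono fun x hx => hi k x hx)
        have : Continuous fun x => e n (x + fun i => (k i : ℝ)) * g (x + fun i => (k i : ℝ)) :=
          ((hec n).comp (by fun_prop)).mul (hg.comp (by fun_prop))
        exact this.aestronglyMeasurable
      refine hasSum_integral_of_summable_integral_norm hIntg' ?_
      refine ((hu.mul_left CB).mul_right (volume.real D)).of_nonneg_of_le (fun k => integral_nonneg fun x => norm_nonneg _) fun k => ?_
      have := norm_setIntegral_le_of_norm_le_const (f := fun x => ‖e n (x + fun i => (k i : ℝ)) * g (x + fun i => (k i : ℝ))‖)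
        (C := CB * u k) hDfin (fun x hx => by rw [norm_norm]; exact hi k x hx)
      rw [Real.norm_of_nonneg (integral_nonneg fun x => norm_nonneg _)] at this
      exact this
    rw [← hswap.tsum_eq]
    -- unfold
    let s : (ι → ℤ) → Set (ι → ℝ) := fun k => (fun x => x + fun i => (-(k i:ℝ))) ⁻¹' D
    have hs1 : ∀ k, MeasurableSet (s k) := fun k => hDm.preimage (by fun_prop)
    have hs2 : Pairwise (Function.onFun Disjoint s) := by
      intro k l hkl
      rw [Function.onFun, Set.disjoint_left]
      intro x hx hy
      apply hkl
      ext i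
      have a := hx i
      have b := hy i
      simp at a b
      have c1 : (k i : ℝ) < l i + 1 := by linarith
      have c2 : (l i : ℝ) < k i + 1 := by linarith
      norm_cast at c1 c2
      omega
    have hs3 : (⋃ k, s k) = univ := by
      rw [eq_univ_iff_forall]
      intro x
      rw [mem_iUnion]
      refine ⟨fun i => ⌈x i⌉ - 1, fun i => ?_⟩
      have a := Int.ceil_lt_add_one (x i)
      have b := Int.le_ceil (x i)
      simp
      constructor <;> linarith
    have hint2 : Integrable fun x => e n x * g x := by
      refine hIntg.bdd_mul (c := 1) (hec n).aestronglyMeasurable (Eventually.of_forall fun x => (hen n x).le)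
    have hun := hasSum_integral_iUnion hs1 hs2 (f := fun x => e n x * g x) (μ := volume) (by rw [hs3]; exact hint2.integrableOn)
    rw [hs3, setIntegral_univ] at hun
    rw [← hun.tsum_eq]
    refine tsum_congr fun k => ?_
    have hmp : MeasurePreserving (fun x : ι → ℝ => x + fun i => (-(k i:ℝ))) := measurePreserving_add_right volume _
    have := hmp.setIntegral_preimage_emb (MeasurableEquiv.addRight (fun i => (-(k i:ℝ)))).measurableEmbedding
      (fun x => e n (x + fun i => (k i : ℝ)) * g (x + fun i => (k i : ℝ))) D
    rw [← this]
    refine setIntegral_congr_fun (hs1 k) fun x _ => ?_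
    have : x + (fun i => (-(k i:ℝ))) + (fun i => (k i : ℝ)) = x := by ext i; simp
    simp only [this]
  have hsum : Summable (UnitAddTorus.mFourierCoeff F) := by
    rw [show UnitAddTorus.mFourierCoeff F = G from funext hcoef]; exact hG
  have := UnitAddTorus.hasSum_mFourier_series_apply_of_summable hsum (mk 0)
  rw [hF] at this
  have h2 := this.tsum_eq
  simp only [hP, zero_add] at h2
  rw [← h2]
  refine tsum_congr fun n => ?_
  rw [hcoef]
  have : UnitAddTorus.mFourier n (mk 0) = 1 := by
    have := he (-n) 0
    rw [neg_neg] at this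
    rw [this]; simp [e]
  rw [this]; simp

end
end Landau
end

section
open Filter Topology MeasureTheory Set
open scoped BigOperators

namespace Landau

section
variable {ι J : Type} [Fintype ι] [Fintype J]

lemma gauss_bound (M : (ι → ℝ) ≃ₗ[ℝ] (J → ℝ)) (s : J → ℝ) (hs : ∀ j, 0 < s j) :
    ∃ c > 0, ∀ x : ι → ℝ, Real.exp (-Real.pi * ∑ j, (s j * M x j)^2) ≤ ∏ i, Real.exp (-(c * (x i)^2)) := by
  obtain ⟨c, hc, h⟩ := quad_lower M s hs
  refine ⟨Real.pi * c, by positivity, fun x => ?_⟩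
  rw [← Real.exp_sum]
  apply Real.exp_le_exp.2
  rw [Finset.sum_neg_distrib, ← Finset.mul_sum]
  nlinarith [h x, Real.pi_pos]

lemma gauss_summable (M : (ι → ℝ) ≃ₗ[ℝ] (J → ℝ)) (s : J → ℝ) (hs : ∀ j, 0 < s j) :
    Summable fun k : ι → ℤ => Real.exp (-Real.pi * ∑ j, (s j * M (fun i => (k i:ℝ)) j)^2) := by
  obtain ⟨c, hc, h⟩ := gauss_bound M s hs
  refine Summable.of_nonneg_of_le (fun k => (Real.exp_pos _).le) (fun k => h _)
    (summable_pi_prod (fun i k => Real.exp (-(c * (k:ℝ)^2))) (fun i k => (Real.exp_pos _).le)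
      fun i => summable_gauss_int hc)

theorem theta_FE (M M' : (ι → ℝ) ≃ₗ[ℝ] (J → ℝ))
    (hMM : ∀ x y, ∑ j, M x j * M' y j = ∑ i, x i * y i) :
    ∃ κ0 : ℝ, 0 < κ0 ∧ ∀ s : J → ℝ, (∀ j, 0 < s j) →
      ∑' k : ι → ℤ, Real.exp (-Real.pi * ∑ j, (s j * M (fun i => (k i:ℝ)) j)^2)
      = κ0 * (∏ j, s j)⁻¹ *
        ∑' k : ι → ℤ, Real.exp (-Real.pi * ∑ j, ((s j)⁻¹ * M' (fun i => (k i:ℝ)) j)^2) := by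
  classical
  let ML := M.toContinuousLinearEquiv
  have hH : (Measure.map ML (volume : Measure (ι → ℝ))).IsAddHaarMeasure :=
    ContinuousLinearEquiv.isAddHaarMeasure_map ML volume
  have hc := Measure.isAddLeftInvariant_eq_smul (Measure.map ML (volume : Measure (ι → ℝ))) (volume : Measure (J → ℝ))
  have hcp := Measure.addHaarScalarFactor_pos_of_isAddHaarMeasure (Measure.map ML (volume : Measure (ι → ℝ))) (volume : Measure (J → ℝ))
  generalize Measure.addHaarScalarFactor (Measure.map ML (volume : Measure (ι → ℝ))) (volume : Measure (J → ℝ)) = c at hc hcp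
  have hcpos : 0 < (c:ℝ) := hcp
  refine ⟨(c:ℝ), hcpos, fun s hs => ?_⟩
  -- change of variables
  have hcv : ∀ f : (J → ℝ) → ℂ, ∫ x, f (M x) = ((c:ℝ) : ℂ) * ∫ y, f y := by
    intro f
    have h1 : ∫ y, f y ∂(Measure.map ML (volume : Measure (ι → ℝ))) = ∫ x, f (ML x) :=
      ML.toHomeomorph.measurableEmbedding.integral_map f
    rw [hc, integral_smul_nnreal_measure] at h1
    rw [← Complex.real_smul]; exact h1.symm
  set g : (ι → ℝ) → ℂ := fun x => ((Real.exp (-Real.pi * ∑ j, (s j * M x j)^2) : ℝ) : ℂ) with hg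
  have hMc : Continuous fun x => M x := ML.continuous
  have hgc : Continuous g := by
    have : ∀ j, Continuous fun x => M x j := fun j => (continuous_apply j).comp hMc
    fun_prop
  obtain ⟨d, hd, hdb⟩ := gauss_bound M s hs
  have hgi : Integrable g := by
    have h1 : Integrable fun x : ι → ℝ => ∏ i, Real.exp (-d * (x i)^2) :=
      Integrable.fintype_prod (f := fun (_ : ι) (x : ℝ) => Real.exp (-d * x^2)) (μ := fun _ => volume) fun i => integrable_exp_neg_mul_sq hd
    refine h1.mono' hgc.aestronglyMeasurable (Eventually.of_forall fun x => ?_)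
    rw [hg]; simp only [Complex.norm_real, Real.norm_eq_abs, abs_of_pos (Real.exp_pos _)]
    refine (hdb x).trans (le_of_eq ?_)
    simp
  set G : (ι → ℤ) → ℂ := fun n => (((c:ℝ) * (∏ j, s j)⁻¹ * Real.exp (-Real.pi * ∑ j, ((s j)⁻¹ * M' (fun i => (n i:ℝ)) j)^2) : ℝ) : ℂ) with hG
  have hGs : Summable G := by
    rw [hG]
    apply Complex.ofRealCLM.summable
    exact (gauss_summable M' (fun j => (s j)⁻¹) (fun j => inv_pos.2 (hs j))).mul_left _
  have hP := poisson_pi g hgc (fun x => ∏ i, Real.exp (d * (x i)^2)) (by fun_prop)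
    (fun k => ∏ i, Real.exp (-(d/2 * (k i:ℝ)^2)))
    (summable_pi_prod (fun i k => Real.exp (-(d/2 * (k:ℝ)^2))) (fun i k => (Real.exp_pos _).le)
      fun i => summable_gauss_int (half_pos hd))
    (fun k => Finset.prod_nonneg fun i _ => (Real.exp_pos _).le) (fun x k => by
      simp only [hg, Complex.norm_real, Real.norm_eq_abs, abs_of_pos (Real.exp_pos _)]
      refine (hdb _).trans ?_
      rw [← Finset.prod_mul_distrib]
      refine Finset.prod_le_prod (fun i _ => (Real.exp_pos _).le) fun i _ => ?_
      rw [← Real.exp_add]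
      apply Real.exp_le_exp.2
      simp only [Pi.add_apply]
      nlinarith [sq_nonneg (2 * x i + k i), hd]) G hGs hgi (fun n => by
      have h1 : ∀ x : ι → ℝ, Complex.exp (-(2 * Real.pi * Complex.I * ∑ i, (n i : ℂ) * (x i:ℂ))) * g x
          = (fun y : J → ℝ => Complex.exp (-∑ j, ((Real.pi * (s j)^2 : ℝ) : ℂ) * (y j:ℂ)^2
            + ∑ j, (-(2 * Real.pi * Complex.I * (M' (fun i => (n i:ℝ)) j : ℝ))) * (y j : ℂ))) (M x) := by
        intro x
        have h2 : ∑ i, (n i : ℂ) * (x i:ℂ) = ∑ j, ((M x j : ℝ):ℂ) * ((M' (fun i => (n i:ℝ)) j : ℝ) : ℂ) := by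
          have := hMM x (fun i => (n i:ℝ))
          have h3 : ((∑ j, M x j * M' (fun i => (n i:ℝ)) j : ℝ) : ℂ) = ((∑ i, x i * (n i : ℝ) : ℝ) : ℂ) := by rw [this]
          push_cast at h3
          rw [h3]
          exact Finset.sum_congr rfl fun i _ => mul_comm _ _
        simp only [hg, h2]
        push_cast
        rw [← Complex.exp_add]
        congr 1
        rw [Finset.mul_sum, Finset.mul_sum, add_comm, ← Finset.sum_neg_distrib, ← Finset.sum_neg_distrib]
        congr 1
        · exact Finset.sum_congr rfl fun j _ => by ring
        · exact Finset.sum_congr rfl fun j _ => by ring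
      refine Eq.trans ?_ ((integral_congr_ae (Eventually.of_forall h1)).trans (hcv (fun y : J → ℝ => Complex.exp (-∑ j, ((Real.pi * (s j)^2 : ℝ) : ℂ) * (y j:ℂ)^2
            + ∑ j, (-(2 * Real.pi * Complex.I * (M' (fun i => (n i:ℝ)) j : ℝ))) * (y j : ℂ))))).symm
      rw [GaussianFourier.integral_cexp_neg_sum_mul_add (fun j => by
        rw [Complex.ofReal_re]; have := hs j; positivity)]
      simp only [hG]
      push_cast
      rw [mul_assoc]
      congr 1
      rw [Finset.mul_sum, Complex.exp_sum, ← Finset.prod_inv_distrib, ← Finset.prod_mul_distrib]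
      refine Finset.prod_congr rfl fun j _ => ?_
      have hsj := hs j
      have hsc : (s j : ℂ) ≠ 0 := by exact_mod_cast hsj.ne'
      have hpi : (Real.pi : ℂ) ≠ 0 := by exact_mod_cast Real.pi_ne_zero
      congr 1
      · have : (Real.pi : ℂ) / (Real.pi * (s j : ℂ)^2) = (((s j)⁻¹ ^ 2 : ℝ) : ℂ) := by
          push_cast; field_simp
        rw [this, show (1/2 : ℂ) = ((1/2 : ℝ) : ℂ) by push_cast; ring, ← Complex.ofReal_cpow (by positivity),
          ← Real.sqrt_eq_rpow, Real.sqrt_sq (by positivity)]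
        push_cast; rfl
      · congr 1
        field_simp
        rw [Complex.I_sq]; ring)
  have hP2 : ((∑' k : ι → ℤ, Real.exp (-Real.pi * ∑ j, (s j * M (fun i => (k i:ℝ)) j)^2) : ℝ) : ℂ) =
      (((c:ℝ) * (∏ j, s j)⁻¹ *
        ∑' k : ι → ℤ, Real.exp (-Real.pi * ∑ j, ((s j)⁻¹ * M' (fun i => (k i:ℝ)) j)^2) : ℝ) : ℂ) := by
    rw [← tsum_mul_left, Complex.ofReal_tsum, Complex.ofReal_tsum]
    exact hP
  exact_mod_cast hP2

end
end Landau
end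

section
open Filter Topology MeasureTheory Set
open scoped BigOperators

namespace Landau

open NumberField NumberField.InfinitePlace NumberField.mixedEmbedding nonZeroDivisors
open scoped Classical Pointwise

section
variable {K : Type} [Field K] [NumberField K]

/-- Gaussian attached to a vector of scales at the infinite places. -/
noncomputable def Et (t : InfinitePlace K → ℝ) (x : K) : ℝ :=
  Real.exp (-Real.pi * ∑ w : InfinitePlace K, (w.mult : ℝ) * (t w * w x)^2)

lemma sum_places (f : InfinitePlace K → ℝ) :
    ∑ w, f w = ∑ w : {w : InfinitePlace K // IsReal w}, f w + ∑ w : {w : InfinitePlace K // IsComplex w}, f w := by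
  classical
  rw [← Fintype.sum_subtype_add_sum_subtype (fun w : InfinitePlace K => IsReal w)]
  congr 1
  refine Fintype.sum_equiv (Equiv.subtypeEquivRight fun w => not_isReal_iff_isComplex (w := w)) _ _ fun w => rfl

lemma prod_places (f : InfinitePlace K → ℝ) :
    ∏ w, f w = (∏ w : {w : InfinitePlace K // IsReal w}, f w) * ∏ w : {w : InfinitePlace K // IsComplex w}, f w := by
  classical
  rw [← Fintype.prod_subtype_mul_prod_subtype (fun w : InfinitePlace K => IsReal w)]
  congr 1
  refine Fintype.prod_equiv (Equiv.subtypeEquivRight fun w => not_isReal_iff_isComplex (w := w)) _ _ fun w => rfl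

/-- weights for the trace pairing in real coordinates -/
noncomputable def trw : index K → ℝ := fun j => match j with
  | Sum.inl _ => 1
  | Sum.inr ⟨_, i⟩ => if i = 0 then 2 else -2

lemma real_emb (w : {w : InfinitePlace K // IsReal w}) (x : K) :
    ((embedding_of_isReal w.2 x : ℝ) : ℂ) = w.1.embedding x := by
  rw [embedding_of_isReal_apply]

lemma trace_coords (x y : K) :
    ∑ j, (stdBasis K).repr (mixedEmbedding K x) j * (trw j * (stdBasis K).repr (mixedEmbedding K y) j)
      = ((Algebra.trace ℚ K (x * y) : ℚ) : ℝ) := by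
  classical
  have h1 : ((Algebra.trace ℚ K (x * y) : ℚ) : ℂ) = ∑ φ : K →+* ℂ, φ (x * y) := by
    have := trace_eq_sum_embeddings (K := ℚ) (L := K) ℂ (x := x * y)
    rw [eq_ratCast] at this
    rw [this]
    exact Fintype.sum_equiv (RingHom.equivRatAlgHom (R := K) (S := ℂ)).symm _ _ fun σ => rfl
  have h2 : ∑ φ : K →+* ℂ, φ (x * y) = ∑ j, indexEquiv K j (x * y) :=
    (Equiv.sum_comp (indexEquiv K) fun φ => φ (x * y)).symm
  apply Complex.ofReal_injective
  rw [Complex.ofReal_ratCast, h1, h2]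
  push_cast
  simp only [Fintype.sum_sum_type, Fintype.sum_prod_type, Fin.sum_univ_two,
    indexEquiv_apply_isReal, indexEquiv_apply_isComplex_fst, indexEquiv_apply_isComplex_snd,
    stdBasis_apply_isReal, stdBasis_apply_isComplex_fst, stdBasis_apply_isComplex_snd, trw,
    mixedEmbedding_apply_isReal, mixedEmbedding_apply_isComplex, real_emb]
  congr 1
  · refine Finset.sum_congr rfl fun w _ => ?_
    rw [map_mul]; simp
  · refine Finset.sum_congr rfl fun w _ => ?_
    rw [ComplexEmbedding.conjugate_coe_eq, map_mul, map_mul]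
    apply Complex.ext
    · simp; ring
    · simp; ring

lemma tsum_span {ι : Type} [Fintype ι] (b : Module.Basis ι ℚ K) (S : Set K)
    (hS : ∀ x, x ∈ Submodule.span ℤ (Set.range b) ↔ x ∈ S) :
    ∃ e : (ι → ℤ) ≃ S, ∀ k, (e k : K) = ∑ i, (k i : ℚ) • b i := by
  have hz : ∀ k : ι → ℤ, ∑ i, (k i : ℚ) • b i = ∑ i, k i • b i := fun k =>
    Finset.sum_congr rfl fun i _ => by rw [Int.cast_smul_eq_zsmul]
  refine ⟨Equiv.ofBijective (fun k => ⟨∑ i, (k i : ℚ) • b i, ?_⟩) ⟨?_, ?_⟩, fun k => rfl⟩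
  · rw [← hS, hz]
    exact Submodule.sum_mem _ fun i _ => Submodule.smul_mem _ _ (Submodule.subset_span ⟨i, rfl⟩)
  · intro k l hkl
    have := congrArg Subtype.val hkl
    simp only at this
    have h2 := congrArg (fun x => b.repr x) this
    ext i
    have h3 := DFunLike.congr_fun h2 i
    simp only [b.repr_sum_self] at h3
    exact_mod_cast h3
  · rintro ⟨x, hx⟩
    rw [← hS, Submodule.mem_span_range_iff_exists_fun] at hx
    obtain ⟨c, hc⟩ := hx
    exact ⟨c, Subtype.ext (by simp only [hz]; exact hc)⟩

/-- scale in coordinates -/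
noncomputable def sco (t : InfinitePlace K → ℝ) : index K → ℝ := fun j => match j with
  | Sum.inl w => t w.1
  | Sum.inr ⟨w, _⟩ => Real.sqrt 2 * t w.1

lemma sum_sco (t : InfinitePlace K → ℝ) (x : K) :
    ∑ j, (sco t j * (stdBasis K).repr (mixedEmbedding K x) j)^2
      = ∑ w : InfinitePlace K, (w.mult : ℝ) * (t w * w x)^2 := by
  classical
  rw [sum_places]
  simp only [Fintype.sum_sum_type, Fintype.sum_prod_type, Fin.sum_univ_two,
    stdBasis_apply_isReal, stdBasis_apply_isComplex_fst, stdBasis_apply_isComplex_snd, sco,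
    mixedEmbedding_apply_isReal, mixedEmbedding_apply_isComplex]
  congr 1
  · refine Finset.sum_congr rfl fun w _ => ?_
    rw [mult_isReal, ← norm_embedding_of_isReal w.2, Real.norm_eq_abs, mul_pow, mul_pow, sq_abs]; simp
  · refine Finset.sum_congr rfl fun w _ => ?_
    rw [mult_isComplex, ← norm_embedding_eq, mul_pow (t w) _ 2, Complex.sq_norm, Complex.normSq_apply]
    have := Real.sq_sqrt (show (0:ℝ) ≤ 2 by norm_num)
    simp only [mul_pow, this]; push_cast; ring

lemma sum_sco' (t : InfinitePlace K → ℝ) (x : K) :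
    ∑ j, ((sco t j)⁻¹ * (trw j * (stdBasis K).repr (mixedEmbedding K x) j))^2
      = ∑ w : InfinitePlace K, (w.mult : ℝ) * ((t w)⁻¹ * w x)^2 := by
  classical
  rw [sum_places]
  simp only [Fintype.sum_sum_type, Fintype.sum_prod_type, Fin.sum_univ_two,
    stdBasis_apply_isReal, stdBasis_apply_isComplex_fst, stdBasis_apply_isComplex_snd, sco, trw,
    mixedEmbedding_apply_isReal, mixedEmbedding_apply_isComplex]
  congr 1
  · refine Finset.sum_congr rfl fun w _ => ?_
    rw [mult_isReal, ← norm_embedding_of_isReal w.2, Real.norm_eq_abs, mul_pow, mul_pow (t w)⁻¹, sq_abs]; simp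
  · refine Finset.sum_congr rfl fun w _ => ?_
    rw [mult_isComplex, ← norm_embedding_eq, mul_pow (t w)⁻¹ _ 2, Complex.sq_norm, Complex.normSq_apply]
    have := Real.sq_sqrt (show (0:ℝ) ≤ 2 by norm_num)
    simp only [mul_pow, this, mul_inv, inv_pow]; push_cast
    simp
    ring

lemma prod_sco (t : InfinitePlace K → ℝ) :
    ∏ j, sco t j = 2 ^ (nrComplexPlaces K) * ∏ w : InfinitePlace K, t w ^ w.mult := by
  classical
  rw [prod_places]
  simp only [Fintype.prod_sum_type, Fintype.prod_prod_type, Fin.prod_univ_two, sco]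
  have h1 : ∏ w : {w : InfinitePlace K // IsReal w}, t w.1 ^ w.1.mult = ∏ w : {w : InfinitePlace K // IsReal w}, t w.1 :=
    Finset.prod_congr rfl fun w _ => by rw [mult_isReal, pow_one]
  have h2 : ∏ w : {w : InfinitePlace K // IsComplex w}, (Real.sqrt 2 * t w.1 * (Real.sqrt 2 * t w.1))
      = 2 ^ (nrComplexPlaces K) * ∏ w : {w : InfinitePlace K // IsComplex w}, t w.1 ^ w.1.mult := by
    rw [nrComplexPlaces, ← Finset.card_univ, ← Finset.prod_const, ← Finset.prod_mul_distrib]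
    refine Finset.prod_congr rfl fun w _ => ?_
    rw [mult_isComplex]
    have := Real.sq_sqrt (show (0:ℝ) ≤ 2 by norm_num)
    calc _ = (Real.sqrt 2)^2 * (t w.1)^2 := by ring
      _ = _ := by rw [this]
  rw [h1, h2]; ring

theorem theta_K (J : (Ideal (𝓞 K))⁰) :
    (∀ t : InfinitePlace K → ℝ, (∀ w, 0 < t w) → Summable fun α : {x : 𝓞 K // x ∈ (J : Ideal (𝓞 K))} => Et t (α.1 : K)) ∧
    ∃ (J' : (Ideal (𝓞 K))⁰) (a : 𝓞 K) (κ0 : ℝ), a ≠ 0 ∧ 0 < κ0 ∧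
    ∀ t : InfinitePlace K → ℝ, (∀ w, 0 < t w) →
      ∑' α : {x : 𝓞 K // x ∈ (J : Ideal (𝓞 K))}, Et t (α.1 : K)
       = κ0 * (∏ w, t w ^ w.mult)⁻¹ *
        ∑' β : {x : 𝓞 K // x ∈ (J' : Ideal (𝓞 K))}, Et (fun w => (t w)⁻¹) ((β.1 : K) / (a : K)) := by
  classical
  set I := FractionalIdeal.mk0 K J with hI
  let b := basisOfFractionalIdeal K I
  let b' := b.traceDual
  let Id := FractionalIdeal.dual ℤ ℚ (I : FractionalIdeal (𝓞 K)⁰ K)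
  have hI0 : (I : FractionalIdeal (𝓞 K)⁰ K) ≠ 0 := Units.ne_zero I
  have hb : ∀ x, x ∈ Submodule.span ℤ (Set.range b) ↔ x ∈ ((I : FractionalIdeal (𝓞 K)⁰ K) : Set K) := fun x =>
    mem_span_basisOfFractionalIdeal K
  have hb' : ∀ x, x ∈ Submodule.span ℤ (Set.range b') ↔ x ∈ (Id : Set K) := by
    intro x
    have := Submodule.traceDual_span_of_basis (K := ℚ) ℤ ((I : FractionalIdeal (𝓞 K)⁰ K) : Submodule (𝓞 K) K) b (by
      ext x; rw [hb]; rfl)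
    rw [← this]
    change _ ↔ x ∈ ((Id : FractionalIdeal (𝓞 K)⁰ K) : Submodule (𝓞 K) K)
    rw [FractionalIdeal.coe_dual _ _ hI0]
    rfl
  obtain ⟨e, he⟩ := tsum_span b _ hb
  obtain ⟨e', he'⟩ := tsum_span b' _ hb'
  -- J as a set
  let eJ : ((I : FractionalIdeal (𝓞 K)⁰ K) : Set K) ≃ {x : 𝓞 K // x ∈ (J : Ideal (𝓞 K))} := by
    refine (Equiv.ofBijective (fun α : {x : 𝓞 K // x ∈ (J : Ideal (𝓞 K))} =>
      (⟨(α.1 : K), (FractionalIdeal.mem_coeIdeal _).2 ⟨α.1, α.2, rfl⟩⟩ : ((I : FractionalIdeal (𝓞 K)⁰ K) : Set K))) ⟨?_, ?_⟩).symm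
    · intro α β h
      refine Subtype.ext (RingOfIntegers.ext ?_)
      have h2 := congrArg Subtype.val h
      exact h2
    · rintro ⟨x, hx⟩
      obtain ⟨y, hy, rfl⟩ := (FractionalIdeal.mem_coeIdeal _).1 hx
      exact ⟨⟨y, hy⟩, rfl⟩
  have heJ : ∀ x, ((eJ x).1 : K) = x.1 := by
    intro x
    have := eJ.symm_apply_apply x
    exact congrArg Subtype.val this
  -- dual set
  set a : 𝓞 K := Id.den.1 with ha
  have ha0 : a ≠ 0 := nonZeroDivisors.coe_ne_zero _
  have haK : (a : K) ≠ 0 := RingOfIntegers.coe_ne_zero_iff.2 ha0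
  have hId0 : Id ≠ 0 := FractionalIdeal.dual_ne_zero ℤ ℚ hI0
  have hnum : Id.num ≠ 0 := by
    intro h
    exact hId0 ((FractionalIdeal.num_eq_zero_iff).1 h)
  have hmem : ∀ β : 𝓞 K, β ∈ Id.num ↔ (β : K) / a ∈ (Id : Set K) := by
    intro β
    have h1 : β ∈ Id.num ↔ (β : K) ∈ Id.den • (Id : Submodule (𝓞 K) K) := by
      rw [FractionalIdeal.num]; rfl
    rw [h1]
    constructor
    · rintro ⟨x, hx, hxb⟩
      have : (β : K) / a = x := by
        rw [← hxb, div_eq_iff haK, mul_comm]; rfl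
      rw [this]; exact hx
    · intro h
      exact ⟨_, h, by change (a : K) * ((β : K)/a) = β; field_simp⟩
  let eJ' : (Id : Set K) ≃ {x : 𝓞 K // x ∈ Id.num} := by
    refine (Equiv.ofBijective (fun β : {x : 𝓞 K // x ∈ Id.num} =>
      (⟨(β.1 : K) / a, (hmem β.1).1 β.2⟩ : (Id : Set K))) ⟨?_, ?_⟩).symm
    · intro α β h
      refine Subtype.ext (RingOfIntegers.ext ?_)
      have h2 : (α.1 : K) / a = (β.1 : K) / a := congrArg Subtype.val h
      field_simp at h2
      exact h2
    · rintro ⟨x, hx⟩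
      have h3 : (Id.den • x) ∈ Id.den • (Id : Submodule (𝓞 K) K) := Submodule.smul_mem_pointwise_smul _ _ _ hx
      rw [FractionalIdeal.den_mul_self_eq_num] at h3
      obtain ⟨y, hy, hyx⟩ := h3
      refine ⟨⟨y, hy⟩, Subtype.ext ?_⟩
      have h4 : (y : K) = a * x := hyx
      change (y : K) / a = x
      rw [h4]; field_simp
  have heJ' : ∀ x, ((eJ' x).1 : K) / a = x.1 := by
    intro x
    have := eJ'.symm_apply_apply x
    exact congrArg Subtype.val this
  -- linear maps
  let ML : (Module.Free.ChooseBasisIndex ℤ I → ℝ) ≃ₗ[ℝ] (index K → ℝ) :=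
    (fractionalIdealLatticeBasis K I).equivFun.symm.trans (stdBasis K).equivFun
  have hML : ∀ x j, ML x j = ∑ i, x i * (stdBasis K).repr (mixedEmbedding K (b i)) j := by
    intro x j
    simp only [ML, LinearEquiv.trans_apply, Module.Basis.equivFun_symm_apply, map_sum, map_smul,
      fractionalIdealLatticeBasis_apply, Finset.sum_apply, Pi.smul_apply, smul_eq_mul,
      Module.Basis.equivFun_apply]
    rfl
  let ML0 : (Module.Free.ChooseBasisIndex ℤ I → ℝ) →ₗ[ℝ] (index K → ℝ) :=
    { toFun := fun y j => ∑ l, y l * (trw j * (stdBasis K).repr (mixedEmbedding K (b' l)) j)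
      map_add' := by
        intro x y; ext j
        simp only [Pi.add_apply, add_mul, Finset.sum_add_distrib]
      map_smul' := by
        intro c x; ext j
        simp only [Pi.smul_apply, smul_eq_mul, Finset.mul_sum, RingHom.id_apply, mul_assoc] }
  have hdual : ∀ i l, ((Algebra.trace ℚ K (b i * b' l) : ℚ) : ℝ) = if i = l then 1 else 0 := by
    intro i l
    have h1 := Module.Basis.trace_mul_traceDual b i l
    rw [h1]
    split_ifs <;> simp
  have hpair : ∀ x y, ∑ j, ML x j * ML0 y j = ∑ i, x i * y i := by
    intro x y
    calc ∑ j, ML x j * ML0 y j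
        = ∑ j, ∑ i, ∑ l, x i * y l * ((stdBasis K).repr (mixedEmbedding K (b i)) j * (trw j * (stdBasis K).repr (mixedEmbedding K (b' l)) j)) := by
          refine Finset.sum_congr rfl fun j _ => ?_
          rw [hML]
          simp only [ML0, LinearMap.coe_mk, AddHom.coe_mk]
          rw [Finset.sum_mul_sum]
          refine Finset.sum_congr rfl fun i _ => Finset.sum_congr rfl fun l _ => by ring
      _ = ∑ i, ∑ l, x i * y l * ∑ j, ((stdBasis K).repr (mixedEmbedding K (b i)) j * (trw j * (stdBasis K).repr (mixedEmbedding K (b' l)) j)) := by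
          rw [Finset.sum_comm]
          refine Finset.sum_congr rfl fun i _ => ?_
          rw [Finset.sum_comm]
          refine Finset.sum_congr rfl fun l _ => ?_
          rw [Finset.mul_sum]
      _ = _ := by
          refine Finset.sum_congr rfl fun i _ => ?_
          simp only [trace_coords, hdual]
          simp
  have hinj : Function.Injective ML0 := by
    rw [injective_iff_map_eq_zero]
    intro y hy
    have := hpair y y
    rw [hy] at this
    simp only [Pi.zero_apply, mul_zero, Finset.sum_const_zero] at this
    have h2 := (Finset.sum_eq_zero_iff_of_nonneg (fun i _ => mul_self_nonneg (y i))).1 this.symm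
    ext i
    exact mul_self_eq_zero.1 (h2 i (Finset.mem_univ i))
  let ML' := LinearMap.linearEquivOfInjective ML0 hinj ML.finrank_eq
  have hML' : ∀ y, ML' y = ML0 y := fun y => rfl
  obtain ⟨κ0, hκ, hFE⟩ := theta_FE ML ML' hpair
  have hMLk : ∀ (k : Module.Free.ChooseBasisIndex ℤ I → ℤ) j, ML (fun i => (k i:ℝ)) j = (stdBasis K).repr (mixedEmbedding K (e k).1) j := by
    intro k j
    rw [hML, he]
    rw [map_sum, map_sum, Finsupp.finsetSum_apply]
    refine Finset.sum_congr rfl fun i _ => ?_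
    rw [Int.cast_smul_eq_zsmul, map_zsmul, map_zsmul, Finsupp.smul_apply, zsmul_eq_mul]
  have hMLk' : ∀ (k : Module.Free.ChooseBasisIndex ℤ I → ℤ) j, ML' (fun i => (k i:ℝ)) j = trw j * (stdBasis K).repr (mixedEmbedding K (e' k).1) j := by
    intro k j
    rw [hML', he']
    simp only [ML0, LinearMap.coe_mk, AddHom.coe_mk]
    rw [map_sum, map_sum, Finsupp.finsetSum_apply, Finset.mul_sum]
    refine Finset.sum_congr rfl fun i _ => ?_
    rw [Int.cast_smul_eq_zsmul, map_zsmul, map_zsmul, Finsupp.smul_apply, zsmul_eq_mul]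
    ring
  have hspos : ∀ t : InfinitePlace K → ℝ, (∀ w, 0 < t w) → ∀ j, 0 < sco t j := by
    intro t ht j
    rcases j with w | ⟨w, i⟩
    · exact ht _
    · exact mul_pos (by positivity) (ht _)
  have hsumL : ∀ (t : InfinitePlace K → ℝ) (k : Module.Free.ChooseBasisIndex ℤ I → ℤ),
      Real.exp (-Real.pi * ∑ j, (sco t j * ML (fun i => (k i:ℝ)) j)^2) = Et t ((eJ (e k)).1 : K) := by
    intro t k
    rw [heJ, Et, ← sum_sco]
    simp only [hMLk]
  have hsumR : ∀ (t : InfinitePlace K → ℝ) (k : Module.Free.ChooseBasisIndex ℤ I → ℤ),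
      Real.exp (-Real.pi * ∑ j, ((sco t j)⁻¹ * ML' (fun i => (k i:ℝ)) j)^2) = Et (fun w => (t w)⁻¹) (((eJ' (e' k)).1 : K) / a) := by
    intro t k
    rw [heJ', Et, ← sum_sco']
    simp only [hMLk']
  refine ⟨fun t ht => ?_, ⟨Id.num, mem_nonZeroDivisors_of_ne_zero hnum⟩, a, κ0 * (2 ^ (nrComplexPlaces K))⁻¹, ha0, by positivity, fun t ht => ?_⟩
  · have := gauss_summable ML (sco t) (hspos t ht)
    simp only [hsumL] at this
    exact ((e.trans eJ).summable_iff (f := fun α : {x : 𝓞 K // x ∈ (J : Ideal (𝓞 K))} => Et t (α.1 : K))).1 this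
  · have h := hFE (sco t) (hspos t ht)
    simp only [hsumL, hsumR] at h
    rw [← (e.trans eJ).tsum_eq, ← (e'.trans eJ').tsum_eq]
    simp only [Equiv.trans_apply]
    rw [h, prod_sco, mul_inv]
    ring

end
end Landau
end

section
open Filter Topology MeasureTheory Set
open scoped BigOperators

namespace Landau

/-- one-variable kernel -/
noncomputable def Em (m : ℕ) (σ : ℝ) : ℝ := Real.exp (-(Real.pi * m * σ ^ (2 / (m:ℝ))))

/-- its Mellin transform -/
noncomputable def Mm (m : ℕ) (s : ℂ) : ℂ :=
  ((m:ℂ)/2) * (((1 / (Real.pi * m) : ℝ) : ℂ) ^ (s * m / 2) * Complex.Gamma (s * m / 2))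

lemma Em_pos (m : ℕ) (σ : ℝ) : 0 < Em m σ := Real.exp_pos _

lemma Em_meas (m : ℕ) : Measurable (Em m) := by
  unfold Em; fun_prop

lemma Em_anti (m : ℕ) {x y : ℝ} (hx : 0 ≤ x) (hxy : x ≤ y) : Em m y ≤ Em m x := by
  unfold Em
  apply Real.exp_le_exp.2
  have : x ^ (2 / (m:ℝ)) ≤ y ^ (2/(m:ℝ)) := Real.rpow_le_rpow hx hxy (by positivity)
  have := mul_le_mul_of_nonneg_left this (by positivity : 0 ≤ Real.pi * m)
  linarith

lemma Em_mellin (m : ℕ) (hm : 0 < m) {s : ℂ} (hs : 0 < s.re) :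
    HasMellin (fun x => (Em m x : ℂ)) s (Mm m s) := by
  have hm' : (0:ℝ) < m := by exact_mod_cast hm
  have hr : 0 < Real.pi * m := by positivity
  have h2 : (2 / (m:ℝ)) ≠ 0 := by positivity
  have hs2 : s / ((2 / (m:ℝ) : ℝ) : ℂ) = s * m / 2 := by
    have : (m:ℂ) ≠ 0 := by exact_mod_cast hm'.ne'
    push_cast; field_simp
  have hs3 : 0 < (s * m / 2).re := by
    have : (s * m / 2) = (((m:ℝ)/2 : ℝ) : ℂ) * s := by push_cast; ring
    rw [this, Complex.re_ofReal_mul]; positivity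
  have e : (fun x => (Em m x : ℂ)) = fun x => (fun z : ℝ => Complex.exp (-(((Real.pi * m : ℝ):ℂ) * z))) (x ^ (2 / (m:ℝ))) := by
    funext x; simp [Em]
  have hval := Complex.integral_cpow_mul_exp_neg_mul_Ioi hs3 hr
  have hIntg : MellinConvergent (fun z : ℝ => Complex.exp (-(((Real.pi * m : ℝ):ℂ) * z))) (s * m / 2) := by
    by_contra h
    have h0 := integral_undef h
    have : ∫ t : ℝ in Ioi 0, (t:ℂ) ^ (s * m / 2 - 1) * Complex.exp (-(((Real.pi * m : ℝ):ℂ) * t)) = 0 := h0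
    rw [this] at hval
    symm at hval
    rw [mul_eq_zero] at hval
    rcases hval with h | h
    · rw [Complex.cpow_eq_zero_iff] at h
      have : (1 / ((Real.pi * m : ℝ) : ℂ)) ≠ 0 := one_div_ne_zero (by exact_mod_cast hr.ne')
      exact this h.1
    · exact Complex.Gamma_ne_zero_of_re_pos hs3 h
  constructor
  · rw [e]
    refine (MellinConvergent.comp_rpow (f := fun z : ℝ => Complex.exp (-(((Real.pi * m : ℝ):ℂ) * z))) h2).2 ?_
    rw [hs2]
    exact hIntg
  · rw [e, mellin_comp_rpow (fun z : ℝ => Complex.exp (-(((Real.pi * m : ℝ):ℂ) * z))), hs2]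
    unfold mellin Mm
    simp only [smul_eq_mul]
    rw [hval, abs_of_pos (by positivity), Complex.real_smul]
    push_cast
    congr 1
    · field_simp

lemma exp_change (f : ℝ → ℂ) {s M : ℂ} (h : HasMellin f s M) :
    Integrable (fun y : ℝ => f (Real.exp y) * Complex.exp (s * y)) ∧
    ∫ y : ℝ, f (Real.exp y) * Complex.exp (s * y) = M := by
  have hd : ∀ x ∈ univ, HasDerivWithinAt Real.exp (Real.exp x) univ x := fun x _ => (Real.hasDerivAt_exp x).hasDerivWithinAt
  have hi : univ.image Real.exp = Ioi 0 := by rw [Set.image_univ, Real.range_exp]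
  have key : ∀ y : ℝ, |Real.exp y| • (((Real.exp y : ℝ):ℂ) ^ (s - 1) • f (Real.exp y)) = f (Real.exp y) * Complex.exp (s * y) := by
    intro y
    rw [abs_of_pos (Real.exp_pos _), Complex.real_smul, smul_eq_mul, ← mul_assoc, mul_comm (f _)]
    congr 1
    rw [Complex.cpow_def_of_ne_zero (by exact_mod_cast (Real.exp_pos y).ne'), ← Complex.ofReal_log (Real.exp_pos y).le, Real.log_exp,
      Complex.ofReal_exp, ← Complex.exp_add]
    congr 1; ring
  constructor
  · have := (integrableOn_image_iff_integrableOn_abs_deriv_smul MeasurableSet.univ hd Real.exp_injective.injOn (fun t : ℝ => (t:ℂ)^(s-1) • f t)).1 (by rw [hi]; exact h.1)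
    simp only [key] at this
    rwa [integrableOn_univ] at this
  · rw [← h.2, mellin, ← hi, integral_image_eq_integral_abs_deriv_smul MeasurableSet.univ hd Real.exp_injective.injOn]
    simp only [key, Measure.restrict_univ]

lemma Em_exp (m : ℕ) (hm : 0 < m) {s : ℂ} (hs : 0 < s.re) :
    Integrable (fun y : ℝ => (Em m (Real.exp y) : ℂ) * Complex.exp (s * y)) ∧
    ∫ y : ℝ, (Em m (Real.exp y) : ℂ) * Complex.exp (s * y) = Mm m s :=
  exp_change (fun x => (Em m x : ℂ)) (Em_mellin m hm hs)

lemma Em_decay (m : ℕ) (hm : 0 < m) (N : ℕ) : ∃ C : ℝ, 0 < C ∧ ∀ σ : ℝ, 0 < σ → Em m σ ≤ C * σ ^ (-(2*N:ℝ)) := by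
  have hm' : (0:ℝ) < m := by exact_mod_cast hm
  have hr : 0 < Real.pi * m := by positivity
  refine ⟨(N*m).factorial / (Real.pi * m)^(N*m), by positivity, fun σ hσ => ?_⟩
  set z := Real.pi * m * σ ^ (2/(m:ℝ)) with hz
  have hz0 : 0 < z := by positivity
  have h1 := Real.pow_div_factorial_le_exp z hz0.le (N*m)
  have h2 : z ^ (N*m) = (Real.pi * m)^(N*m) * σ ^ (2*N:ℝ) := by
    rw [hz, mul_pow, ← Real.rpow_natCast (σ ^ (2/(m:ℝ))), ← Real.rpow_mul hσ.le]
    congr 2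
    push_cast; field_simp
  have hf : (0:ℝ) < (N*m).factorial := by positivity
  have hpp : 0 < (Real.pi * m)^(N*m) := by positivity
  have hs : 0 < σ ^ (2*N:ℝ) := by positivity
  rw [Em, ← hz, Real.exp_neg, Real.rpow_neg hσ.le, ← div_eq_mul_inv]
  rw [h2] at h1
  rw [inv_le_comm₀ (Real.exp_pos _) (by positivity)]
  refine le_trans (le_of_eq ?_) h1
  field_simp

section
variable {ι : Type} [Fintype ι]

/-- integrand of the multi-variable kernel -/
noncomputable def Hi (m0 : ℕ) (m : ι → ℕ) (x : ℝ) (y : ι → ℝ) : ℝ :=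
  (∏ i, Em (m i) (Real.exp (y i))) * Em m0 (x * Real.exp (-∑ i, y i))

noncomputable def Hh (m0 : ℕ) (m : ι → ℕ) (x : ℝ) : ℝ := ∫ y, Hi m0 m x y

variable (m0 : ℕ) (m : ι → ℕ)

lemma Hi_pos (x : ℝ) (y : ι → ℝ) : 0 < Hi m0 m x y :=
  mul_pos (Finset.prod_pos fun i _ => Em_pos _ _) (Em_pos _ _)

lemma Hi_meas : Measurable (fun p : ℝ × (ι → ℝ) => Hi m0 m p.1 p.2) := by
  unfold Hi
  refine Measurable.mul ?_ ?_
  · exact Finset.measurable_prod _ fun i _ => (Em_meas _).comp (by fun_prop)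
  · exact (Em_meas _).comp (by fun_prop)

lemma Hi_meas' (x : ℝ) : Measurable (Hi m0 m x) := by
  unfold Hi
  refine Measurable.mul ?_ ?_
  · exact Finset.measurable_prod _ fun i _ => (Em_meas _).comp (by fun_prop)
  · exact (Em_meas _).comp (by fun_prop)

lemma prod_int (hm : ∀ i, 0 < m i) {s : ℂ} (hs : 0 < s.re) :
    Integrable (fun y : ι → ℝ => ∏ i, ((Em (m i) (Real.exp (y i)) : ℂ) * Complex.exp (s * y i))) ∧
    ∫ y : ι → ℝ, ∏ i, ((Em (m i) (Real.exp (y i)) : ℂ) * Complex.exp (s * y i)) = ∏ i, Mm (m i) s := by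
  constructor
  · exact Integrable.fintype_prod (fun i => (Em_exp (m i) (hm i) hs).1)
  · rw [integral_fintype_prod_volume_eq_prod (fun i (y : ℝ) => ((Em (m i) (Real.exp y) : ℂ) * Complex.exp (s * y)))]
    exact Finset.prod_congr rfl fun i _ => (Em_exp (m i) (hm i) hs).2

lemma prod_int_real (hm : ∀ i, 0 < m i) {σ : ℝ} (hs : 0 < σ) :
    Integrable (fun y : ι → ℝ => (∏ i, Em (m i) (Real.exp (y i))) * Real.exp (σ * ∑ i, y i)) := by
  have := (prod_int m hm (s := (σ:ℂ)) (by simpa using hs)).1.re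
  refine this.congr (Eventually.of_forall fun y => ?_)
  have : ∏ i, ((Em (m i) (Real.exp (y i)) : ℂ) * Complex.exp ((σ:ℂ) * y i)) =
    (((∏ i, Em (m i) (Real.exp (y i))) * Real.exp (σ * ∑ i, y i) : ℝ) : ℂ) := by
    rw [Finset.mul_sum, Real.exp_sum, ← Finset.prod_mul_distrib]
    push_cast; rfl
  change RCLike.re (∏ i, ((Em (m i) (Real.exp (y i)) : ℂ) * Complex.exp ((σ:ℂ) * y i))) = _
  rw [this]; exact Complex.ofReal_re _

lemma Hi_int (hm0 : 0 < m0) (hm : ∀ i, 0 < m i) {x : ℝ} (hx : 0 < x) : Integrable (Hi m0 m x) := by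
  obtain ⟨C, hC, hb⟩ := Em_decay m0 hm0 1
  refine ((prod_int_real m hm (σ := 2) two_pos).const_mul (C * x ^ (-2:ℝ))).mono' (Hi_meas' m0 m x).aestronglyMeasurable
    (Eventually.of_forall fun y => ?_)
  rw [Real.norm_of_nonneg (Hi_pos m0 m x y).le, Hi]
  have hP : 0 < ∏ i, Em (m i) (Real.exp (y i)) := Finset.prod_pos fun i _ => Em_pos _ _
  have h := hb (x * Real.exp (-∑ i, y i)) (by positivity)
  rw [Real.mul_rpow hx.le (Real.exp_pos _).le, ← Real.exp_mul] at h
  calc _ ≤ (∏ i, Em (m i) (Real.exp (y i))) * _ := mul_le_mul_of_nonneg_left h hP.le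
    _ = _ := by norm_num; rw [mul_comm (∑ i, y i) 2]; ring

lemma Hh_decay (hm0 : 0 < m0) (hm : ∀ i, 0 < m i) (N : ℕ) (hN : 0 < N) : ∃ C : ℝ, 0 ≤ C ∧ ∀ x : ℝ, 0 < x → Hh m0 m x ≤ C * x ^ (-(2*N:ℝ)) := by
  obtain ⟨C, hC, hb⟩ := Em_decay m0 hm0 N
  have hN' : (0:ℝ) < 2 * N := by positivity
  have hi := prod_int_real m hm hN'
  refine ⟨C * ∫ y : ι → ℝ, (∏ i, Em (m i) (Real.exp (y i))) * Real.exp (2*N * ∑ i, y i), ?_, fun x hx => ?_⟩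
  · refine mul_nonneg hC.le (integral_nonneg fun y => ?_)
    exact mul_nonneg (Finset.prod_nonneg fun i _ => (Em_pos _ _).le) (Real.exp_pos _).le
  · rw [mul_right_comm, ← integral_const_mul]
    refine integral_mono (Hi_int m0 m hm0 hm hx) (hi.const_mul _) fun y => ?_
    have hP : 0 < ∏ i, Em (m i) (Real.exp (y i)) := Finset.prod_pos fun i _ => Em_pos _ _
    have h := hb (x * Real.exp (-∑ i, y i)) (by positivity)
    rw [Real.mul_rpow hx.le (Real.exp_pos _).le, ← Real.exp_mul] at h
    calc Hi m0 m x y ≤ (∏ i, Em (m i) (Real.exp (y i))) * _ := mul_le_mul_of_nonneg_left h hP.le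
      _ = _ := by
        have : -(∑ i, y i) * -(2 * (N:ℝ)) = 2 * N * ∑ i, y i := by ring
        rw [this]; ring

lemma Hh_anti (hm0 : 0 < m0) (hm : ∀ i, 0 < m i) {x x' : ℝ} (hx : 0 < x) (hxx : x ≤ x') : Hh m0 m x' ≤ Hh m0 m x := by
  refine integral_mono (Hi_int m0 m hm0 hm (hx.trans_le hxx)) (Hi_int m0 m hm0 hm hx) fun y => ?_
  refine mul_le_mul_of_nonneg_left (Em_anti _ (by positivity) ?_) (Finset.prod_nonneg fun i _ => (Em_pos _ _).le)
  exact mul_le_mul_of_nonneg_right hxx (Real.exp_pos _).le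

lemma Hh_nonneg (x : ℝ) : 0 ≤ Hh m0 m x := integral_nonneg fun y => (Hi_pos m0 m x y).le

lemma Hh_mellin (hm0 : 0 < m0) (hm : ∀ i, 0 < m i) {s : ℂ} (hs : 0 < s.re) :
    HasMellin (fun x => (Hh m0 m x : ℂ)) s (Mm m0 s * ∏ i, Mm (m i) s) := by
  -- the double integrand
  let F : ℝ × (ι → ℝ) → ℂ := fun p => (p.1 : ℂ) ^ (s - 1) * (Hi m0 m p.1 p.2 : ℂ)
  have hx : ∀ y : ι → ℝ, HasMellin (fun x => (Em m0 (x * Real.exp (-∑ i, y i)) : ℂ)) s (Complex.exp (s * ((∑ i, y i : ℝ):ℂ)) * Mm m0 s) := by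
    intro y
    have h := Em_mellin m0 hm0 hs
    have hp := Real.exp_pos (-∑ i, y i)
    constructor
    · have := (MellinConvergent.comp_mul_left (f := fun x => (Em m0 x : ℂ)) (s := s) hp).2 h.1
      simpa only [mul_comm] using this
    · rw [mellin_comp_mul_right (fun x => (Em m0 x : ℂ)) s hp, h.2, smul_eq_mul]
      congr 1
      rw [Complex.cpow_def_of_ne_zero (by exact_mod_cast hp.ne'), ← Complex.ofReal_log hp.le, Real.log_exp]
      congr 1; push_cast; ring
  have hFe : ∀ y x, F (x, y) = ((∏ i, Em (m i) (Real.exp (y i)) : ℝ) : ℂ) * ((x:ℂ)^(s-1) * (Em m0 (x * Real.exp (-∑ i, y i)) : ℂ)) := by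
    intro y x; simp only [F, Hi]; push_cast; ring
  have hFm : AEStronglyMeasurable F ((volume.restrict (Ioi 0)).prod volume) := by
    apply Measurable.aestronglyMeasurable
    exact (by fun_prop : Measurable fun p : ℝ × (ι → ℝ) => (p.1 : ℂ) ^ (s - 1)).mul (Complex.measurable_ofReal.comp (Hi_meas m0 m))
  have hinner : ∀ y : ι → ℝ, ∫ x in Ioi (0:ℝ), F (x, y) = (∏ i, ((Em (m i) (Real.exp (y i)) : ℂ) * Complex.exp (s * y i))) * Mm m0 s := by
    intro y
    simp only [hFe]
    rw [integral_const_mul]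
    have := (hx y).2
    simp only [mellin, smul_eq_mul] at this
    rw [this, Finset.prod_mul_distrib, ← Complex.exp_sum, ← Finset.mul_sum]
    push_cast; ring
  have hIntg : Integrable F ((volume.restrict (Ioi 0)).prod volume) := by
    rw [integrable_prod_iff' hFm]
    constructor
    · refine Eventually.of_forall fun y => ?_
      simp only [hFe]
      exact ((hx y).1 : IntegrableOn _ _ _).const_mul _
    · -- norms are the same integral at the real point re s
      have hre : 0 < ((s.re : ℂ)).re := by simpa using hs
      have hi := (prod_int_real m hm hs).const_mul (∫ x in Ioi (0:ℝ), x ^ (s.re - 1) * Em m0 x)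
      refine hi.congr (Eventually.of_forall fun y => ?_)
      have hp := Real.exp_pos (-∑ i, y i)
      have e1 : ∀ x ∈ Ioi (0:ℝ), ‖F (x, y)‖ = (∏ i, Em (m i) (Real.exp (y i))) * Real.exp (s.re * ∑ i, y i) * Real.exp (-∑ i, y i)*
          ((x * Real.exp (-∑ i, y i)) ^ (s.re - 1) * Em m0 (x * Real.exp (-∑ i, y i))) := by
        intro x hx
        rw [hFe, norm_mul, norm_mul, Complex.norm_real, Complex.norm_real, Complex.norm_cpow_eq_rpow_re_of_pos hx,
          Real.norm_of_nonneg (Finset.prod_nonneg fun i _ => (Em_pos _ _).le), Real.norm_of_nonneg (Em_pos _ _).le,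
          Real.mul_rpow (le_of_lt hx) hp.le, ← Real.exp_mul, Complex.sub_re, Complex.one_re]
        have : Real.exp (s.re * ∑ i, y i) * Real.exp (-∑ i, y i) * Real.exp (-(∑ i, y i) * (s.re - 1)) = 1 := by
          rw [← Real.exp_add, ← Real.exp_add]
          have : s.re * ∑ i, y i + -∑ i, y i + -(∑ i, y i) * (s.re - 1) = 0 := by ring
          rw [this, Real.exp_zero]
        linear_combination -(∏ i, Em (m i) (Real.exp (y i))) * x ^ (s.re - 1) * Em m0 (x * Real.exp (-∑ i, y i)) * this
      change _ = ∫ x in Ioi (0:ℝ), ‖F (x, y)‖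
      rw [setIntegral_congr_fun measurableSet_Ioi e1, integral_const_mul,
        integral_comp_mul_right_Ioi (fun z => z ^ (s.re - 1) * Em m0 z) 0 hp, zero_mul, smul_eq_mul]
      field_simp
  have hHx : ∀ x : ℝ, ∫ y : ι → ℝ, F (x, y) = (x:ℂ)^(s-1) * (Hh m0 m x : ℂ) := by
    intro x
    simp only [F]
    rw [integral_const_mul, Hh, ← integral_complex_ofReal]
  constructor
  · have := hIntg.integral_prod_left
    simp only [hHx] at this
    exact this
  · rw [mellin]
    simp only [smul_eq_mul, ← hHx]
    rw [integral_integral_swap (f := fun x y => F (x, y)) hIntg]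
    simp only [hinner]
    rw [integral_mul_const, (prod_int m hm hs).2, mul_comm]

end

end Landau
end

section
open Filter Topology MeasureTheory Set
open scoped BigOperators

namespace Landau

open NumberField NumberField.InfinitePlace NumberField.mixedEmbedding nonZeroDivisors
open NumberField.Units NumberField.Units.dirichletUnitTheorem NumberField.mixedEmbedding.fundamentalCone
open scoped Classical Pointwise

section
variable {K : Type} [Field K] [NumberField K]

/-- fundamental domain of the unit lattice -/
noncomputable def Dm (K : Type) [Field K] [NumberField K] : Set (logSpace K) :=
  ZSpan.fundamentalDomain ((basisUnitLattice K).ofZLatticeBasis ℝ (unitLattice K))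

instance instVaddInv : VAddInvariantMeasure (unitLattice K) (logSpace K) volume :=
  ⟨fun c s _ => measure_preimage_add volume (c : logSpace K) s⟩

lemma Dm_fund : IsAddFundamentalDomain (unitLattice K) (Dm K) (volume : Measure (logSpace K)) :=
  ZLattice.isAddFundamentalDomain (basisUnitLattice K) volume

/-- logarithmic vector -/
noncomputable def Lgv (x : K) : logSpace K := fun w => (w.1.mult : ℝ) * Real.log (w.1 x)

lemma Lgv_mul {x y : K} (hx : x ≠ 0) (hy : y ≠ 0) : Lgv (x * y) = Lgv x + Lgv y := by
  funext w
  have h1 : w.1 x ≠ 0 := (map_ne_zero _).2 hx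
  have h2 : w.1 y ≠ 0 := (map_ne_zero _).2 hy
  simp only [Lgv, Pi.add_apply, map_mul]
  rw [Real.log_mul h1 h2]; ring

lemma Lgv_unit (u : (𝓞 K)ˣ) : Lgv ((u : 𝓞 K) : K) = logEmbedding K (Additive.ofMul u) := by
  funext w; rfl

lemma unit_rep (l : unitLattice K) : ∃ u : (𝓞 K)ˣ, logEmbedding K (Additive.ofMul u) = l := by
  obtain ⟨l, u, -, hu⟩ := l
  exact ⟨u, hu⟩

/-- a unit with given log vector -/
noncomputable def urep (l : unitLattice K) : (𝓞 K)ˣ := (unit_rep l).choose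
lemma urep_spec (l : unitLattice K) : logEmbedding K (Additive.ofMul (urep l)) = l := (unit_rep l).choose_spec

variable (J : (Ideal (𝓞 K))⁰)

/-- preimage of an element of `idealSet` -/
noncomputable def pre (a : idealSet K J) : 𝓞 K := (mem_idealSet.mp a.2).2.choose
lemma pre_mem (a : idealSet K J) : pre J a ∈ (J : Ideal (𝓞 K)) := (mem_idealSet.mp a.2).2.choose_spec.1
lemma pre_spec (a : idealSet K J) : mixedEmbedding K (pre J a : K) = a.1 := (mem_idealSet.mp a.2).2.choose_spec.2
lemma pre_ne (a : idealSet K J) : pre J a ≠ 0 := by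
  intro h
  have h1 := pre_spec J a
  have h2 := norm_pos_of_mem (mem_idealSet.mp a.2).1
  rw [← h1, h, norm_eq_norm] at h2
  simp at h2

lemma pre_ne' (a : idealSet K J) : (pre J a : K) ≠ 0 := RingOfIntegers.coe_ne_zero_iff.2 (pre_ne J a)

lemma norm_unit_mul (u : (𝓞 K)ˣ) (x : K) :
    mixedEmbedding.norm (mixedEmbedding K (((u : 𝓞 K) : K) * x)) = mixedEmbedding.norm (mixedEmbedding K x) := by
  rw [map_mul, map_mul, norm_unit, one_mul]

noncomputable def unf (p : idealSet K J × unitLattice K) : {x : 𝓞 K // x ∈ (J : Ideal (𝓞 K)) ∧ x ≠ 0} :=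
  ⟨(urep p.2 : 𝓞 K) * pre J p.1, Ideal.mul_mem_left _ _ (pre_mem J p.1), mul_ne_zero (Units.ne_zero _) (pre_ne J p.1)⟩

lemma log_dom (x : mixedSpace K) (l l' : logSpace K) (hl : l ∈ unitLattice K) (hl' : l' ∈ unitLattice K)
    (y : logSpace K) (h : l + y ∈ Dm K) (h' : l' + y ∈ Dm K) : l = l' := by
  let B := (basisUnitLattice K).ofZLatticeBasis ℝ (unitLattice K)
  have hB : Submodule.span ℤ (Set.range B) = unitLattice K := Module.Basis.ofZLatticeBasis_span ℝ (unitLattice K) _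
  have := (ZSpan.exist_unique_vadd_mem_fundamentalDomain B y).unique
    (y₁ := ⟨l, by rw [hB]; exact hl⟩) (y₂ := ⟨l', by rw [hB]; exact hl'⟩) h h'
  exact congrArg Subtype.val this

lemma unf_bij : Function.Bijective (unf J) := by
  constructor
  · rintro ⟨a, l⟩ ⟨b, m⟩ h
    have h1 : (urep l : 𝓞 K) * pre J a = (urep m : 𝓞 K) * pre J b := congrArg Subtype.val h
    have h1' : ((urep l : 𝓞 K) : K) * (pre J a : K) = ((urep m : 𝓞 K) : K) * (pre J b : K) := by
      exact_mod_cast congrArg (algebraMap (𝓞 K) K) h1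
    have h2 := congrArg (mixedEmbedding K) h1'
    rw [map_mul, map_mul, pre_spec, pre_spec] at h2
    have h3 : urep l • a.1 = urep m • b.1 := h2
    have ha := (mem_idealSet.mp a.2).1
    have hb := (mem_idealSet.mp b.2).1
    have h4 := congrArg logMap h3
    rw [logMap_unit_smul _ ha.2, logMap_unit_smul _ hb.2, urep_spec, urep_spec] at h4
    have h5 : l.1 = m.1 := by
      have hlm : (0 : logSpace K) = m.1 - l.1 ∨ True := Or.inr trivial
      have e1 : (l.1 - m.1) + logMap a.1 = logMap b.1 := by
        rw [sub_add_eq_add_sub, h4]; abel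
      have := log_dom a.1 0 (l.1 - m.1) (Submodule.zero_mem _) (Submodule.sub_mem _ l.2 m.2) (logMap a.1)
        (by rw [zero_add]; exact ha.1) (by rw [e1]; exact hb.1)
      exact (sub_eq_zero.1 this.symm)
    have h6 : l = m := Subtype.ext h5
    subst h6
    have h7 : a.1 = b.1 := by
      exact (MulAction.injective (urep l)) h3
    have : a = b := Subtype.ext h7
    rw [this]
  · rintro ⟨x, hx, hx0⟩
    have hxK : (x : K) ≠ 0 := RingOfIntegers.coe_ne_zero_iff.2 hx0
    have hn : mixedEmbedding.norm (mixedEmbedding K (x:K)) ≠ 0 := by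
      rw [norm_eq_norm]; simp [hxK]
    obtain ⟨u, hu⟩ := exists_unit_smul_mem hn
    let l : unitLattice K := ⟨logEmbedding K (Additive.ofMul u⁻¹), ⟨Additive.ofMul u⁻¹, trivial, rfl⟩⟩
    let v := (urep l)⁻¹
    have hv : v • mixedEmbedding K (x:K) ∈ fundamentalCone K := by
      refine ⟨?_, ?_⟩
      · rw [Set.mem_preimage, logMap_unit_smul _ hn]
        have : logEmbedding K (Additive.ofMul v) = logEmbedding K (Additive.ofMul u) := by
          simp only [v, ofMul_inv, map_neg, urep_spec, l, neg_neg]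
        rw [this, ← logMap_unit_smul _ hn]
        exact hu.1
      · rw [Set.mem_ofPred_eq, norm_unit_smul]; exact hn
    let a : idealSet K J := ⟨v • mixedEmbedding K (x:K), mem_idealSet.2 ⟨hv, (v : 𝓞 K) * x, Ideal.mul_mem_left _ _ hx, by
      change mixedEmbedding K (algebraMap (𝓞 K) K ((v : 𝓞 K) * x)) = _
      rw [map_mul, map_mul]; rfl⟩⟩
    refine ⟨(a, l), Subtype.ext ?_⟩
    change (urep l : 𝓞 K) * pre J a = x
    have h1 := pre_spec J a
    have h2 : pre J a = (v : 𝓞 K) * x := by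
      apply RingOfIntegers.ext
      apply mixedEmbedding_injective K
      rw [h1]
      change v • mixedEmbedding K (x:K) = mixedEmbedding K (algebraMap (𝓞 K) K ((v : 𝓞 K) * x))
      rw [map_mul, map_mul]; rfl
    rw [h2, ← mul_assoc]
    simp [v]

lemma affine_lint (s : ℝ) (hs : s = 1 ∨ s = -1) (c : logSpace K) (Φ : logSpace K → ENNReal) :
    ∫⁻ y : logSpace K, Φ (s • y + c) = ∫⁻ y, Φ y := by
  rcases hs with rfl | rfl
  · simp only [one_smul]
    exact lintegral_add_right_eq_self Φ c
  · simp only [neg_smul, one_smul]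
    rw [← lintegral_add_right_eq_self Φ c]
    exact lintegral_neg_eq_self (fun y => Φ (y + c)) (μ := volume)

theorem unfolding (Φ : ℝ → logSpace K → ENNReal) (s : ℝ) (hs : s = 1 ∨ s = -1) (c : logSpace K) :
    ∑' α : {x : 𝓞 K // x ∈ (J : Ideal (𝓞 K)) ∧ x ≠ 0},
      ∫⁻ y in Dm K, Φ (mixedEmbedding.norm (mixedEmbedding K (α.1 : K))) (s • y + (Lgv (α.1 : K) + c))
    = ∑' a : idealSet K J, ∫⁻ y, Φ (mixedEmbedding.norm a.1) y := by
  rw [← (Equiv.ofBijective _ (unf_bij J)).tsum_eq, ENNReal.tsum_prod']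
  refine tsum_congr fun a => ?_
  have h1 : ∀ l : unitLattice K, ∫⁻ y in Dm K, Φ (mixedEmbedding.norm (mixedEmbedding K (((Equiv.ofBijective _ (unf_bij J)) (a, l)).1 : K)))
        (s • y + (Lgv (((Equiv.ofBijective _ (unf_bij J)) (a, l)).1 : K) + c))
      = ∫⁻ y in Dm K, Φ (mixedEmbedding.norm a.1) (s • y + l.1 + (Lgv (pre J a : K) + c)) := by
    intro l
    have e : (((Equiv.ofBijective _ (unf_bij J)) (a, l)).1 : K) = ((urep l : 𝓞 K) : K) * (pre J a : K) := by
      change algebraMap (𝓞 K) K ((urep l : 𝓞 K) * pre J a) = _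
      rw [map_mul]
    rw [e, norm_unit_mul, pre_spec, Lgv_mul (RingOfIntegers.coe_ne_zero_iff.2 (Units.ne_zero _)) (pre_ne' J a), Lgv_unit, urep_spec]
    refine lintegral_congr fun y => ?_
    congr 1; abel
  simp only [h1]
  rw [← affine_lint s hs (Lgv (pre J a : K) + c) (Φ (mixedEmbedding.norm a.1)), Dm_fund.lintegral_eq_tsum'']
  have h2 : ∀ (l : unitLattice K) (y : logSpace K), s • (l +ᵥ y) = s • y + s • l.1 := by
    intro l y
    rw [Submodule.vadd_def, vadd_eq_add, smul_add, add_comm]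
  simp only [h2]
  rcases hs with rfl | rfl
  · simp only [one_smul]
  · rw [← (Equiv.neg (unitLattice K)).tsum_eq]
    simp [Equiv.neg_apply]

end
end Landau
end

section
open Filter Topology MeasureTheory Set
open scoped BigOperators

namespace Landau

section
variable {Q : Type}

lemma ps_point {X Z z α : ℝ} (hX : 0 < X) (hα : 0 < α) (h1 : X ≤ z) (h2 : z ≤ Z) :
    z ^ (-α) = Z ^ (-α) + α * ∫ u in X..Z, (if z ≤ u then u ^ (-α - 1) else 0) := by
  have hz : 0 < z := hX.trans_le h1
  have hIntg : IntervalIntegrable (fun u : ℝ => u ^ (-α - 1)) volume z Z :=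
    intervalIntegral.intervalIntegrable_rpow (Or.inr (by rw [Set.uIcc_of_le h2]; intro h; linarith [h.1]))
  have e : ∫ u in X..Z, (if z ≤ u then u ^ (-α - 1) else 0) = ∫ u in z..Z, u ^ (-α - 1) := by
    rw [intervalIntegral.integral_of_le (h1.trans h2), intervalIntegral.integral_of_le h2]
    have : (fun u : ℝ => if z ≤ u then u ^ (-α - 1) else 0) = (Ici z).indicator (fun u => u ^ (-α - 1)) := by
      funext u; simp [indicator]
    rw [this, setIntegral_indicator measurableSet_Ici]
    have h3 : (Ioc X Z ∩ Ici z : Set ℝ) =ᵐ[volume] (Ioc z Z : Set ℝ) := by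
      have h4 : Ioc z Z ⊆ Ioc X Z ∩ Ici z := fun u hu => ⟨⟨lt_of_le_of_lt h1 hu.1, hu.2⟩, hu.1.le⟩
      have h5 : Ioc X Z ∩ Ici z ⊆ Icc z Z := fun u hu => ⟨hu.2, hu.1.2⟩
      refine (ae_le_set.2 ?_).antisymm h4.eventuallyLE
      refine measure_mono_null (t := {z}) (fun u hu => ?_) (measure_singleton z)
      have := h5 hu.1
      by_contra h
      exact hu.2 ⟨lt_of_le_of_ne this.1 (Ne.symm h), this.2⟩
    exact setIntegral_congr_set h3
  rw [e, integral_rpow (Or.inr ⟨by linarith, by rw [Set.uIcc_of_le h2]; intro h; linarith [h.1]⟩)]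
  have : -α - 1 + 1 = -α := by ring
  rw [this]; field_simp; ring

lemma ps_main {f : Q → ℝ} {C β α X Z : ℝ} (hα : 0 < α)
    (hc : ∀ Y : ℝ, 0 < Y → ∀ F : Finset Q, (∀ q ∈ F, f q ≤ Y) → (F.card : ℝ) ≤ C * Y ^ β)
    (hX : 0 < X) (hXZ : X ≤ Z) (F : Finset Q) (h1 : ∀ q ∈ F, X ≤ f q) (h2 : ∀ q ∈ F, f q ≤ Z) :
    ∑ q ∈ F, f q ^ (-α) ≤ C * Z ^ (β - α) + α * (C * ∫ u in X..Z, u ^ (β - α - 1)) := by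
  have hZ : 0 < Z := hX.trans_le hXZ
  have h0 : (0:ℝ) ∉ Set.uIcc X Z := by rw [Set.uIcc_of_le hXZ]; intro h; linarith [h.1]
  have hii : ∀ q, IntervalIntegrable (fun u : ℝ => (if f q ≤ u then u ^ (-α - 1) else 0)) volume X Z := by
    intro q
    have : IntervalIntegrable (fun u : ℝ => u ^ (-α - 1)) volume X Z :=
      intervalIntegral.intervalIntegrable_rpow (Or.inr h0)
    have e : (fun u : ℝ => if f q ≤ u then u ^ (-α - 1) else 0) = (Ici (f q)).indicator (fun u => u ^ (-α - 1)) := by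
      funext u; simp [indicator]
    rw [e, intervalIntegrable_iff] at *
    exact this.indicator measurableSet_Ici
  have step : ∑ q ∈ F, f q ^ (-α) = F.card * Z ^ (-α) + α * ∫ u in X..Z, ∑ q ∈ F, (if f q ≤ u then u ^ (-α - 1) else 0) := by
    rw [intervalIntegral.integral_finsetSum fun q _ => hii q, Finset.mul_sum, ← nsmul_eq_mul, ← Finset.sum_const, ← Finset.sum_add_distrib]
    exact Finset.sum_congr rfl fun q hq => ps_point hX hα (h1 q hq) (h2 q hq)
  rw [step]
  have hA : (F.card : ℝ) * Z ^ (-α) ≤ C * Z ^ (β - α) := by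
    rw [sub_eq_add_neg, Real.rpow_add hZ, ← mul_assoc]
    exact mul_le_mul_of_nonneg_right (hc Z hZ F h2) (by positivity)
  have hB : ∫ u in X..Z, ∑ q ∈ F, (if f q ≤ u then u ^ (-α - 1) else 0) ≤ C * ∫ u in X..Z, u ^ (β - α - 1) := by
    rw [← intervalIntegral.integral_const_mul]
    refine intervalIntegral.integral_mono_on hXZ ?_ ?_ fun u hu => ?_
    · exact IntervalIntegrable.sum F (fun q _ => hii q) |>.congr (by intro u _; simp)
    · exact (intervalIntegral.intervalIntegrable_rpow (Or.inr h0)).const_mul C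
    · have hu0 : 0 < u := hX.trans_le hu.1
      rw [← Finset.sum_filter, Finset.sum_const, nsmul_eq_mul]
      have : β - α - 1 = β + (-α - 1) := by ring
      rw [this, Real.rpow_add hu0, ← mul_assoc]
      refine mul_le_mul_of_nonneg_right (hc u hu0 _ fun q hq => (Finset.mem_filter.1 hq).2) (by positivity)
  have := mul_le_mul_of_nonneg_left hB hα.le
  linarith

lemma ps_C_nonneg {f : Q → ℝ} {C β : ℝ}
    (hc : ∀ Y : ℝ, 0 < Y → ∀ F : Finset Q, (∀ q ∈ F, f q ≤ Y) → (F.card : ℝ) ≤ C * Y ^ β) : 0 ≤ C := by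
  have := hc 1 one_pos ∅ (by simp)
  simpa using this

/-- tails -/
lemma ps_tail {f : Q → ℝ} {C β α : ℝ} (hα : 0 < α) (hβ : β < α)
    (hc : ∀ Y : ℝ, 0 < Y → ∀ F : Finset Q, (∀ q ∈ F, f q ≤ Y) → (F.card : ℝ) ≤ C * Y ^ β) :
    ∃ C', 0 ≤ C' ∧ ∀ X : ℝ, 0 < X → ∀ F : Finset Q, (∀ q ∈ F, X ≤ f q) → ∑ q ∈ F, f q ^ (-α) ≤ C' * X ^ (β - α) := by
  have hC := ps_C_nonneg hc
  have hd : 0 < α - β := by linarith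
  refine ⟨C + α * (C / (α - β)), by positivity, fun X hX F hF => ?_⟩
  obtain ⟨Z, hZ⟩ : ∃ Z, X ≤ Z ∧ ∀ q ∈ F, f q ≤ Z := by
    obtain ⟨M, hM⟩ := (F.image f).bddAbove
    exact ⟨max X M, le_max_left _ _, fun q hq => (hM (Finset.mem_coe.2 (Finset.mem_image_of_mem f hq))).trans (le_max_right _ _)⟩
  have h := ps_main hα hc hX hZ.1 F hF hZ.2
  have h0 : (0:ℝ) ∉ Set.uIcc X Z := by rw [Set.uIcc_of_le hZ.1]; intro h; linarith [h.1]
  rw [integral_rpow (Or.inr ⟨by linarith, h0⟩)] at h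
  have e : β - α - 1 + 1 = -(α - β) := by ring
  have e' : β - α = -(α - β) := by ring
  rw [e, e'] at h
  have hZX : Z ^ (-(α-β)) ≤ X ^ (-(α-β)) := Real.rpow_le_rpow_of_nonpos hX hZ.1 (by linarith)
  have hZ0 : 0 ≤ Z ^ (-(α-β)) := Real.rpow_nonneg (hX.le.trans hZ.1) _
  have h3 : (Z ^ (-(α-β)) - X ^ (-(α-β))) / (-(α-β)) ≤ X ^ (-(α-β)) / (α - β) := by
    rw [div_neg, ← neg_div]
    exact div_le_div_of_nonneg_right (by linarith) hd.le
  rw [e']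
  calc _ ≤ _ := h
    _ ≤ C * X ^ (-(α-β)) + α * (C * (X ^ (-(α-β)) / (α - β))) := by gcongr
    _ = _ := by ring

lemma ps_summable {f : Q → ℝ} {C β α X : ℝ} (hα : 0 < α) (hβ : β < α) (hX : 0 < X)
    (hf : ∀ q, X ≤ f q)
    (hc : ∀ Y : ℝ, 0 < Y → ∀ F : Finset Q, (∀ q ∈ F, f q ≤ Y) → (F.card : ℝ) ≤ C * Y ^ β) :
    Summable fun q => f q ^ (-α) := by
  obtain ⟨C', -, h⟩ := ps_tail hα hβ hc
  exact summable_of_sum_le (fun q => Real.rpow_nonneg (hX.le.trans (hf q)) _) (fun F => h X hX F fun q _ => hf q)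

/-- initial sums, small exponent -/
lemma ps_init {f : Q → ℝ} {C β α : ℝ} (hα : 0 < α) (hβ : α < β) (hf : ∀ q, 1 ≤ f q)
    (hc : ∀ Y : ℝ, 0 < Y → ∀ F : Finset Q, (∀ q ∈ F, f q ≤ Y) → (F.card : ℝ) ≤ C * Y ^ β) :
    ∃ C', 0 ≤ C' ∧ ∀ X : ℝ, 1 ≤ X → ∀ F : Finset Q, (∀ q ∈ F, f q ≤ X) → ∑ q ∈ F, f q ^ (-α) ≤ C' * X ^ (β - α) := by
  have hC := ps_C_nonneg hc
  have hd : 0 < β - α := by linarith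
  refine ⟨C + α * (C / (β - α)), by positivity, fun X hX F hF => ?_⟩
  have h := ps_main hα hc one_pos hX F (fun q _ => hf q) hF
  rw [integral_rpow (Or.inl (by linarith))] at h
  have e : β - α - 1 + 1 = β - α := by ring
  rw [e, Real.one_rpow] at h
  have hX0 : 0 < X := by linarith
  calc _ ≤ _ := h
    _ ≤ C * X ^ (β-α) + α * (C * (X ^ (β-α) / (β - α))) := by gcongr; linarith
    _ = _ := by ring

lemma ps_init_eq {f : Q → ℝ} {C α : ℝ} (hα : 0 < α) (hf : ∀ q, 1 ≤ f q)
    (hc : ∀ Y : ℝ, 0 < Y → ∀ F : Finset Q, (∀ q ∈ F, f q ≤ Y) → (F.card : ℝ) ≤ C * Y ^ α) :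
    ∃ C', 0 ≤ C' ∧ ∀ X : ℝ, 1 ≤ X → ∀ F : Finset Q, (∀ q ∈ F, f q ≤ X) → ∑ q ∈ F, f q ^ (-α) ≤ C' * (1 + Real.log X) := by
  have hC := ps_C_nonneg hc
  refine ⟨C + α * C, by positivity, fun X hX F hF => ?_⟩
  have h := ps_main hα hc one_pos hX F (fun q _ => hf q) hF
  have e : ∀ u : ℝ, u ^ (α - α - 1) = u⁻¹ := fun u => by
    rw [sub_self, zero_sub, Real.rpow_neg_one]
  simp only [e] at h
  rw [integral_inv_of_pos one_pos (by linarith), div_one, sub_self, Real.rpow_zero] at h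
  have := Real.log_nonneg hX
  nlinarith [mul_nonneg hα.le hC, mul_nonneg hC this]

end
end Landau
end

section
open Filter Topology MeasureTheory Set
open scoped BigOperators

namespace Landau

open NumberField NumberField.InfinitePlace NumberField.mixedEmbedding nonZeroDivisors
open NumberField.Units NumberField.Units.dirichletUnitTheorem NumberField.mixedEmbedding.fundamentalCone
open scoped Classical Pointwise

section
variable {K : Type} [Field K] [NumberField K]

lemma fin_ideals (s : ℝ) : Finite {I : (Ideal (𝓞 K))⁰ // (Ideal.absNorm (I : Ideal (𝓞 K)) : ℝ) ≤ s} := by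
  rcases lt_or_ge s 0 with h | h
  · have : IsEmpty {I : (Ideal (𝓞 K))⁰ // (Ideal.absNorm (I : Ideal (𝓞 K)) : ℝ) ≤ s} :=
      ⟨fun I => by have := I.2; have h2 : (0:ℝ) ≤ Ideal.absNorm (I.1 : Ideal (𝓞 K)) := by positivity
                   linarith⟩
    infer_instance
  · simp_rw [← Nat.le_floor_iff h]
    exact Ideal.finite_setOfPred_absNorm_le₀ ⌊s⌋₊

lemma one_le_absNorm (I : (Ideal (𝓞 K))⁰) : (1:ℝ) ≤ Ideal.absNorm (I : Ideal (𝓞 K)) := by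
  exact_mod_cast Ideal.absNorm_pos_of_nonZeroDivisors I

lemma ideal_count_bound : ∃ C : ℝ, 0 ≤ C ∧ ∀ s : ℝ, 0 < s →
    (Nat.card {I : (Ideal (𝓞 K))⁰ // (Ideal.absNorm (I : Ideal (𝓞 K)) : ℝ) ≤ s} : ℝ) ≤ C * s := by
  have ht := NumberField.Ideal.tendsto_norm_le_div_atTop₀ K
  set L := (2 ^ nrRealPlaces K * (2 * Real.pi) ^ nrComplexPlaces K * regulator K * classNumber K) /
            (torsionOrder K * Real.sqrt |discr K|) with hL
  have h1 := (ht.eventually_lt_const (lt_add_one L))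
  obtain ⟨s0, hs0⟩ := eventually_atTop.1 h1
  set S := max s0 1
  set N := fun s : ℝ => (Nat.card {I : (Ideal (𝓞 K))⁰ // (Ideal.absNorm (I : Ideal (𝓞 K)) : ℝ) ≤ s} : ℝ) with hN
  refine ⟨max (L+1) (N S), le_max_of_le_right (by positivity), fun s hs => ?_⟩
  rcases lt_or_ge s 1 with h | h
  · have : IsEmpty {I : (Ideal (𝓞 K))⁰ // (Ideal.absNorm (I : Ideal (𝓞 K)) : ℝ) ≤ s} :=
      ⟨fun I => by have := I.2; have := one_le_absNorm I.1; linarith⟩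
    rw [Nat.card_of_isEmpty, Nat.cast_zero]
    exact mul_nonneg (le_max_of_le_right (by positivity)) hs.le
  · rcases le_total s0 s with h2 | h2
    · have := hs0 s h2
      rw [div_lt_iff₀ hs] at this
      exact this.le.trans (mul_le_mul_of_nonneg_right (le_max_left _ _) hs.le)
    · have : N s ≤ N S := by
        simp only [hN]
        have := fin_ideals (K := K) S
        exact_mod_cast Nat.card_le_card_of_injective
          (fun I : {I : (Ideal (𝓞 K))⁰ // (Ideal.absNorm (I : Ideal (𝓞 K)) : ℝ) ≤ s} =>
            (⟨I.1, I.2.trans (h2.trans (le_max_left _ _))⟩ : {I : (Ideal (𝓞 K))⁰ // (Ideal.absNorm (I : Ideal (𝓞 K)) : ℝ) ≤ S}))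
          (fun I J h => Subtype.ext (congrArg (fun z => z.1) h))
      have h0 : 0 ≤ N S := by positivity
      calc N s ≤ N S * 1 := by rw [mul_one]; exact this
        _ ≤ N S * s := mul_le_mul_of_nonneg_left h h0
        _ ≤ _ := mul_le_mul_of_nonneg_right (le_max_right _ _) hs.le

variable (J : (Ideal (𝓞 K))⁰)

lemma idealSet_norm_nat (a : idealSet K J) : mixedEmbedding.norm a.1 = (intNorm (idealSetEquiv K J a).val : ℝ) :=
  (intNorm_idealSetEquiv_apply a).symm

lemma idealSet_norm_one_le (a : idealSet K J) : 1 ≤ mixedEmbedding.norm a.1 := by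
  have h := norm_pos_of_mem (mem_idealSet.mp a.2).1
  rw [idealSet_norm_nat] at *
  exact_mod_cast h

lemma idealSet_fin (s : ℝ) : Finite {a : idealSet K J // mixedEmbedding.norm (a : mixedSpace K) ≤ s} := by
  have h : (((fun a : idealSet K J => intNorm (idealSetEquiv K J a).val) ⁻¹' (Set.Iic ⌊s⌋₊))).Finite := by
    refine Set.Finite.preimage' (Set.finite_Iic _) fun n _ => ?_
    have e := idealSetEquivNorm K J n
    have : Finite {I : (Ideal (𝓞 K))⁰ // (J : Ideal (𝓞 K)) ∣ I ∧ (I : Ideal (𝓞 K)).IsPrincipal ∧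
        Ideal.absNorm (I : Ideal (𝓞 K)) = n} := by
      have := fin_ideals (K := K) n
      exact Finite.of_injective (fun I : {I : (Ideal (𝓞 K))⁰ // (J : Ideal (𝓞 K)) ∣ I ∧ (I : Ideal (𝓞 K)).IsPrincipal ∧
        Ideal.absNorm (I : Ideal (𝓞 K)) = n} =>
        (⟨I.1, by exact_mod_cast I.2.2.2.le⟩ : {I : (Ideal (𝓞 K))⁰ // (Ideal.absNorm (I : Ideal (𝓞 K)) : ℝ) ≤ n}))
        (fun I J h => Subtype.ext (congrArg (fun z => z.1) h))
    have h2 := Finite.of_equiv _ e.symm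
    have h3 : {a : idealSet K J | mixedEmbedding.norm (a : mixedSpace K) = n}.Finite := h2
    refine h3.subset fun a ha => ?_
    simp only [Set.mem_preimage, Set.mem_singleton_iff] at ha
    change mixedEmbedding.norm a.1 = n
    rw [idealSet_norm_nat, ha]
  have h2 : {a : idealSet K J | mixedEmbedding.norm (a : mixedSpace K) ≤ s}.Finite := by
    refine h.subset fun a ha => ?_
    have ha' : mixedEmbedding.norm a.1 ≤ s := ha
    rw [idealSet_norm_nat] at ha'
    exact Nat.le_floor ha'
  exact h2

lemma idealSet_count : ∃ C : ℝ, 0 ≤ C ∧ ∀ Y : ℝ, 0 < Y → ∀ F : Finset (idealSet K J),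
    (∀ a ∈ F, mixedEmbedding.norm a.1 ≤ Y) → (F.card : ℝ) ≤ C * Y := by
  obtain ⟨C, hC, h⟩ := ideal_count_bound (K := K)
  refine ⟨C * torsionOrder K, by positivity, fun Y hY F hF => ?_⟩
  have h1 := card_isPrincipal_dvd_norm_le K J Y
  have hfin := idealSet_fin J Y
  have h2 : F.card ≤ Nat.card {a : idealSet K J // mixedEmbedding.norm (a : mixedSpace K) ≤ Y} := by
    rw [show F.card = Nat.card F by simp]
    exact Nat.card_le_card_of_injective (fun a : F => (⟨a.1, hF a.1 a.2⟩ : {a : idealSet K J // mixedEmbedding.norm (a : mixedSpace K) ≤ Y}))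
      (fun I J h => Subtype.ext (congrArg (fun z => z.1) h))
  have h3 : Nat.card {I : (Ideal (𝓞 K))⁰ // (J : Ideal (𝓞 K)) ∣ I ∧ (I : Ideal (𝓞 K)).IsPrincipal ∧
      (Ideal.absNorm (I : Ideal (𝓞 K)) : ℝ) ≤ Y} ≤ Nat.card {I : (Ideal (𝓞 K))⁰ // (Ideal.absNorm (I : Ideal (𝓞 K)) : ℝ) ≤ Y} := by
    have := fin_ideals (K := K) Y
    exact Nat.card_le_card_of_injective (fun I : {I : (Ideal (𝓞 K))⁰ // (J : Ideal (𝓞 K)) ∣ I ∧ (I : Ideal (𝓞 K)).IsPrincipal ∧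
      (Ideal.absNorm (I : Ideal (𝓞 K)) : ℝ) ≤ Y} => (⟨I.1, I.2.2.2⟩ : {I : (Ideal (𝓞 K))⁰ // (Ideal.absNorm (I : Ideal (𝓞 K)) : ℝ) ≤ Y}))
      (fun I J h => Subtype.ext (congrArg (fun z => z.1) h))
  have h4 : (F.card : ℝ) ≤ (Nat.card {I : (Ideal (𝓞 K))⁰ // (Ideal.absNorm (I : Ideal (𝓞 K)) : ℝ) ≤ Y} : ℝ) * torsionOrder K := by
    exact_mod_cast h2.trans (h1.symm.le.trans (Nat.mul_le_mul_right _ h3))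
  have ht : (0:ℝ) ≤ torsionOrder K := by positivity
  nlinarith [h Y hY, mul_le_mul_of_nonneg_right (h Y hY) ht]

lemma idealSet_summable {x : ℝ} (hx : 1 < x) : Summable fun a : idealSet K J => (mixedEmbedding.norm a.1) ^ (-x) := by
  obtain ⟨C, -, h⟩ := idealSet_count J
  exact ps_summable (β := 1) (by linarith) hx one_pos (idealSet_norm_one_le J) (C := C) (by simpa using h)

end
end Landau
end

section
open Filter Topology MeasureTheory Set
open scoped BigOperators

namespace Landau

open NumberField NumberField.InfinitePlace NumberField.mixedEmbedding nonZeroDivisors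
open NumberField.Units NumberField.Units.dirichletUnitTheorem NumberField.mixedEmbedding.fundamentalCone
open scoped Classical Pointwise

section
variable {K : Type} [Field K] [NumberField K]

lemma Em_pow (m : ℕ) (hm : 0 < m) {u : ℝ} (hu : 0 < u) : Em m (u ^ m) = Real.exp (-(Real.pi * m * u^2)) := by
  unfold Em
  have hm' : (m:ℝ) ≠ 0 := by positivity
  rw [← Real.rpow_natCast u m, ← Real.rpow_mul hu.le, mul_div_cancel₀ _ hm']
  norm_num

/-- kernel for the field -/
noncomputable def HK (K : Type) [Field K] [NumberField K] (x : ℝ) (y : logSpace K) : ℝ :=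
  Hi (w₀ : InfinitePlace K).mult (fun i : {w : InfinitePlace K // w ≠ w₀} => i.1.mult) x y

/-- integrated kernel for the field -/
noncomputable def HhK (K : Type) [Field K] [NumberField K] (x : ℝ) : ℝ :=
  Hh (w₀ : InfinitePlace K).mult (fun i : {w : InfinitePlace K // w ≠ w₀} => i.1.mult) x

lemma split_sum (f : InfinitePlace K → ℝ) : ∑ w, f w = f w₀ + ∑ i : {w : InfinitePlace K // w ≠ w₀}, f i.1 :=
  Fintype.sum_eq_add_sum_subtype_ne f w₀

lemma split_prod (f : InfinitePlace K → ℝ) : ∏ w, f w = f w₀ * ∏ i : {w : InfinitePlace K // w ≠ w₀}, f i.1 :=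
  Fintype.prod_eq_mul_prod_subtype_ne f w₀

lemma gauss_HK (u : InfinitePlace K → ℝ) (hu : ∀ w, 0 < u w) :
    Real.exp (-Real.pi * ∑ w : InfinitePlace K, (w.mult : ℝ) * (u w)^2)
      = HK K (∏ w, u w ^ w.mult) (fun i => (i.1.mult : ℝ) * Real.log (u i.1)) := by
  unfold HK Hi
  have e : ∀ w : InfinitePlace K, Real.exp ((w.mult : ℝ) * Real.log (u w)) = u w ^ w.mult := fun w => by
    rw [mul_comm, Real.exp_mul, Real.exp_log (hu w), Real.rpow_natCast]
  have e2 : (∏ w, u w ^ w.mult) * Real.exp (-∑ i : {w : InfinitePlace K // w ≠ w₀}, (i.1.mult : ℝ) * Real.log (u i.1))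
      = u w₀ ^ (w₀ : InfinitePlace K).mult := by
    rw [Real.exp_neg, Real.exp_sum, split_prod]
    simp only [e]
    have : (∏ i : {w : InfinitePlace K // w ≠ w₀}, u i.1 ^ i.1.mult) ≠ 0 :=
      Finset.prod_ne_zero_iff.2 fun i _ => (pow_pos (hu _) _).ne'
    field_simp
  rw [e2, Em_pow _ mult_pos (hu _)]
  simp only [e]
  have : ∀ i : {w : InfinitePlace K // w ≠ w₀}, Em i.1.mult (u i.1 ^ i.1.mult) = Real.exp (-(Real.pi * i.1.mult * (u i.1)^2)) :=
    fun i => Em_pow _ mult_pos (hu _)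
  simp only [this]
  rw [← Real.exp_sum, ← Real.exp_add, split_sum, mul_add, Finset.mul_sum]
  congr 1
  rw [add_comm]
  congr 1
  · exact Finset.sum_congr rfl fun i _ => by ring
  · ring

/-- scales parametrised by log coordinates -/
noncomputable def tt (τ : ℝ) (y : logSpace K) (w : InfinitePlace K) : ℝ :=
  Real.exp ((if h : w = w₀ then Real.log τ - ∑ i, y i else y ⟨w, h⟩) / w.mult)

lemma tt_pos (τ : ℝ) (y : logSpace K) (w : InfinitePlace K) : 0 < tt τ y w := Real.exp_pos _

lemma tt_log (τ : ℝ) (y : logSpace K) (i : {w : InfinitePlace K // w ≠ w₀}) :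
    (i.1.mult : ℝ) * Real.log (tt τ y i.1) = y i := by
  unfold tt
  have : (i.1.mult : ℝ) ≠ 0 := mult_coe_ne_zero
  rw [Real.log_exp, dif_neg i.2]
  field_simp

lemma tt_prod {τ : ℝ} (hτ : 0 < τ) (y : logSpace K) : ∏ w, tt τ y w ^ w.mult = τ := by
  have e : ∀ w : InfinitePlace K, tt τ y w ^ w.mult = Real.exp ((if h : w = w₀ then Real.log τ - ∑ i, y i else y ⟨w, h⟩)) := by
    intro w
    unfold tt
    have : (w.mult : ℝ) ≠ 0 := mult_coe_ne_zero
    rw [← Real.exp_nat_mul]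
    congr 1
    field_simp
  simp only [e]
  rw [split_prod, dif_pos rfl]
  have : ∏ i : {w : InfinitePlace K // w ≠ w₀}, Real.exp ((if h : i.1 = w₀ then Real.log τ - ∑ i, y i else y ⟨i.1, h⟩)) = Real.exp (∑ i, y i) := by
    rw [Real.exp_sum]
    exact Finset.prod_congr rfl fun i _ => by rw [dif_neg i.2]
  rw [this, ← Real.exp_add, sub_add_cancel, Real.exp_log hτ]

lemma norm_emb (x : K) : mixedEmbedding.norm (mixedEmbedding K x) = ∏ w : InfinitePlace K, w x ^ w.mult := by
  rw [mixedEmbedding.norm_apply]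
  simp only [normAtPlace_apply]

lemma Et_tt {τ : ℝ} (hτ : 0 < τ) (y : logSpace K) {x : K} (hx : x ≠ 0) :
    Et (tt τ y) x = HK K (τ * mixedEmbedding.norm (mixedEmbedding K x)) ((1:ℝ) • y + (Lgv x + 0)) := by
  have hu : ∀ w : InfinitePlace K, 0 < tt τ y w * w x := fun w => mul_pos (tt_pos _ _ _) (pos_iff.2 hx)
  have := gauss_HK (fun w => tt τ y w * w x) hu
  unfold Et
  rw [this]
  congr 1
  · simp only [mul_pow]
    rw [Finset.prod_mul_distrib, tt_prod hτ, norm_emb]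
  · funext i
    rw [Real.log_mul (tt_pos _ _ _).ne' (pos_iff.2 hx).ne', mul_add, tt_log]
    simp [Lgv]

lemma Et_tt_inv {τ : ℝ} (hτ : 0 < τ) (y : logSpace K) {x a : K} (hx : x ≠ 0) (ha : a ≠ 0) :
    Et (fun w => (tt τ y w)⁻¹) (x / a) = HK K (τ⁻¹ * (mixedEmbedding.norm (mixedEmbedding K x) / mixedEmbedding.norm (mixedEmbedding K a)))
      ((-1:ℝ) • y + (Lgv x + (- Lgv a))) := by
  have hxa : x / a ≠ 0 := div_ne_zero hx ha
  have hu : ∀ w : InfinitePlace K, 0 < (tt τ y w)⁻¹ * w (x/a) := fun w => mul_pos (inv_pos.2 (tt_pos _ _ _)) (pos_iff.2 hxa)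
  have := gauss_HK (fun w => (tt τ y w)⁻¹ * w (x/a)) hu
  unfold Et
  rw [this]
  congr 1
  · simp only [mul_pow, inv_pow, map_div₀, div_pow]
    rw [Finset.prod_mul_distrib, Finset.prod_inv_distrib, tt_prod hτ, norm_emb, norm_emb, Finset.prod_div_distrib]
  · funext i
    rw [Real.log_mul (inv_pos.2 (tt_pos _ _ _)).ne' (pos_iff.2 hxa).ne', mul_add, Real.log_inv, mul_neg, tt_log, map_div₀,
      Real.log_div (pos_iff.2 hx).ne' (pos_iff.2 ha).ne']
    simp [Lgv]; ring

lemma HK_pos (x : ℝ) (y : logSpace K) : 0 < HK K x y := Hi_pos _ _ _ _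

lemma HK_meas (x : ℝ) : Measurable (HK K x) := Hi_meas' _ _ _

lemma HhK_lint {x : ℝ} (hx : 0 < x) : ∫⁻ y, ENNReal.ofReal (HK K x y) = ENNReal.ofReal (HhK K x) := by
  unfold HhK Hh
  rw [ofReal_integral_eq_lintegral_ofReal]
  · rfl
  · exact Hi_int _ _ mult_pos (fun i => mult_pos) hx
  · exact Eventually.of_forall fun y => (HK_pos _ _).le

lemma norm_emb_pos {x : K} (hx : x ≠ 0) : 0 < mixedEmbedding.norm (mixedEmbedding K x) := by
  rw [norm_emb]; exact Finset.prod_pos fun w _ => pow_pos (pos_iff.2 hx) _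

variable (J : (Ideal (𝓞 K))⁰)

/-- splitting off the zero element -/
lemma tsum_split (f : K → ENNReal) : ∑' α : {x : 𝓞 K // x ∈ (J : Ideal (𝓞 K))}, f (α.1 : K)
    = f 0 + ∑' α : {x : 𝓞 K // x ∈ (J : Ideal (𝓞 K)) ∧ x ≠ 0}, f (α.1 : K) := by
  let z : {x : 𝓞 K // x ∈ (J : Ideal (𝓞 K))} := ⟨0, Ideal.zero_mem _⟩
  rw [← ENNReal.summable.tsum_add_tsum_compl (s := ({z} : Set _)) ENNReal.summable]
  congr 1
  · rw [tsum_singleton z (fun α : {x : 𝓞 K // x ∈ (J : Ideal (𝓞 K))} => f (α.1 : K))]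
    simp [z]
  · let e : {x : 𝓞 K // x ∈ (J : Ideal (𝓞 K)) ∧ x ≠ 0} ≃ (({z} : Set {x : 𝓞 K // x ∈ (J : Ideal (𝓞 K))})ᶜ : Set _) :=
      { toFun := fun x => ⟨⟨x.1, x.2.1⟩, fun h => x.2.2 (congrArg (fun u => u.1) (Set.mem_singleton_iff.1 h))⟩
        invFun := fun x => ⟨x.1.1, x.1.2, fun h => x.2 (Set.mem_singleton_iff.2 (Subtype.ext h))⟩
        left_inv := fun _ => rfl
        right_inv := fun _ => rfl }
    rw [← e.tsum_eq]
    rfl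

instance countOK : Countable (𝓞 K) := (RingOfIntegers.basis K).repr.toEquiv.countable_iff.2 inferInstance

lemma Et_nonneg (t : InfinitePlace K → ℝ) (x : K) : 0 ≤ Et t x := (Real.exp_pos _).le

lemma Et_zero (t : InfinitePlace K → ℝ) : Et t 0 = 1 := by simp [Et]

lemma lint_theta {τ : ℝ} (hτ : 0 < τ) :
    ∫⁻ y in Dm K, ∑' α : {x : 𝓞 K // x ∈ (J : Ideal (𝓞 K))}, ENNReal.ofReal (Et (tt τ y) (α.1 : K))
      = volume (Dm K) + ∑' a : idealSet K J, ENNReal.ofReal (HhK K (τ * mixedEmbedding.norm a.1)) := by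
  have hct : Countable {x : 𝓞 K // x ∈ (J : Ideal (𝓞 K)) ∧ x ≠ 0} := Subtype.countable
  have h1 : ∀ y : logSpace K, ∑' α : {x : 𝓞 K // x ∈ (J : Ideal (𝓞 K))}, ENNReal.ofReal (Et (tt τ y) (α.1 : K))
      = 1 + ∑' α : {x : 𝓞 K // x ∈ (J : Ideal (𝓞 K)) ∧ x ≠ 0},
        ENNReal.ofReal (HK K (τ * mixedEmbedding.norm (mixedEmbedding K (α.1:K))) ((1:ℝ) • y + (Lgv (α.1:K) + 0))) := by
    intro y
    rw [tsum_split J (fun x => ENNReal.ofReal (Et (tt τ y) x)), Et_zero, ENNReal.ofReal_one]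
    congr 1
    exact tsum_congr fun α => by rw [Et_tt hτ y (RingOfIntegers.coe_ne_zero_iff.2 α.2.2)]
  simp only [h1]
  rw [lintegral_add_left measurable_const, lintegral_tsum]
  · rw [unfolding J (fun n y => ENNReal.ofReal (HK K (τ * n) y)) 1 (Or.inl rfl) 0]
    congr 1
    · simp
    · refine tsum_congr fun a => HhK_lint (mul_pos hτ (lt_of_lt_of_le one_pos (idealSet_norm_one_le J a)))
  · intro α
    exact (ENNReal.measurable_ofReal.comp ((HK_meas _).comp (by fun_prop))).aemeasurable

lemma lint_theta_inv {τ : ℝ} (hτ : 0 < τ) {a : K} (ha : a ≠ 0) :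
    ∫⁻ y in Dm K, ∑' α : {x : 𝓞 K // x ∈ (J : Ideal (𝓞 K))}, ENNReal.ofReal (Et (fun w => (tt τ y w)⁻¹) ((α.1 : K) / a))
      = volume (Dm K) + ∑' b : idealSet K J, ENNReal.ofReal (HhK K (τ⁻¹ * (mixedEmbedding.norm b.1 / mixedEmbedding.norm (mixedEmbedding K a)))) := by
  have hct : Countable {x : 𝓞 K // x ∈ (J : Ideal (𝓞 K)) ∧ x ≠ 0} := Subtype.countable
  have h1 : ∀ y : logSpace K, ∑' α : {x : 𝓞 K // x ∈ (J : Ideal (𝓞 K))}, ENNReal.ofReal (Et (fun w => (tt τ y w)⁻¹) ((α.1 : K) / a))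
      = 1 + ∑' α : {x : 𝓞 K // x ∈ (J : Ideal (𝓞 K)) ∧ x ≠ 0},
        ENNReal.ofReal (HK K (τ⁻¹ * (mixedEmbedding.norm (mixedEmbedding K (α.1:K)) / mixedEmbedding.norm (mixedEmbedding K a))) ((-1:ℝ) • y + (Lgv (α.1:K) + (-Lgv a)))) := by
    intro y
    rw [tsum_split J (fun x => ENNReal.ofReal (Et (fun w => (tt τ y w)⁻¹) (x/a))), zero_div, Et_zero, ENNReal.ofReal_one]
    congr 1
    exact tsum_congr fun α => by rw [Et_tt_inv hτ y (RingOfIntegers.coe_ne_zero_iff.2 α.2.2) ha]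
  simp only [h1]
  rw [lintegral_add_left measurable_const, lintegral_tsum]
  · rw [unfolding J (fun n y => ENNReal.ofReal (HK K (τ⁻¹ * (n / mixedEmbedding.norm (mixedEmbedding K a))) y)) (-1) (Or.inr rfl) (-Lgv a)]
    congr 1
    · simp
    · refine tsum_congr fun b => HhK_lint (mul_pos (inv_pos.2 hτ) (div_pos (lt_of_lt_of_le one_pos (idealSet_norm_one_le J b)) (norm_emb_pos ha)))
  · intro α
    exact (ENNReal.measurable_ofReal.comp ((HK_meas _).comp (by fun_prop))).aemeasurable

lemma HhK_decay (N : ℕ) (hN : 0 < N) : ∃ C : ℝ, 0 ≤ C ∧ ∀ x > 0, HhK K x ≤ C * x^(-(2*N:ℝ)) :=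
  Hh_decay _ _ mult_pos (fun i => mult_pos) N hN

lemma HhK_nonneg (x : ℝ) : 0 ≤ HhK K x := Hh_nonneg _ _ _

lemma HhK_anti {x x' : ℝ} (hx : 0 < x) (hxx : x ≤ x') : HhK K x' ≤ HhK K x :=
  Hh_anti _ _ mult_pos (fun i => mult_pos) hx hxx

lemma norm_pos_idealSet (a : idealSet K J) : 0 < mixedEmbedding.norm a.1 :=
  lt_of_lt_of_le one_pos (idealSet_norm_one_le J a)

lemma HhK_summable {c : ℝ} (hc : 0 < c) : Summable fun a : idealSet K J => HhK K (c * mixedEmbedding.norm a.1) := by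
  obtain ⟨C, hC, h⟩ := HhK_decay (K := K) 1 one_pos
  refine Summable.of_nonneg_of_le (fun a => HhK_nonneg _) (fun a => ?_)
    ((idealSet_summable J (x := 2) (by norm_num)).mul_left (C * c^(-2:ℝ)))
  have := h _ (mul_pos hc (norm_pos_idealSet J a))
  refine this.trans (le_of_eq ?_)
  rw [Real.mul_rpow hc.le (norm_pos_idealSet J a).le]
  norm_num; ring

lemma vol_fin : volume (Dm K) ≠ ⊤ := by
  unfold Dm
  exact (Module.Basis.ofZLatticeBasis ℝ (unitLattice K) (basisUnitLattice K)|> fun b => (ZSpan.fundamentalDomain_isBounded b).measure_lt_top.ne)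

theorem theta_FEK : ∃ (J' : (Ideal (𝓞 K))⁰) (a₀ κ0 : ℝ), 0 < a₀ ∧ 0 < κ0 ∧ ∀ τ : ℝ, 0 < τ →
    (volume (Dm K)).toReal + ∑' a : idealSet K J, HhK K (τ⁻¹ * mixedEmbedding.norm a.1)
      = κ0 * τ * ((volume (Dm K)).toReal + ∑' b : idealSet K J', HhK K (τ * (mixedEmbedding.norm b.1 / a₀))) := by
  obtain ⟨hsum, J', a, κ0, ha, hκ, H⟩ := theta_K J
  have ha' : (a : K) ≠ 0 := RingOfIntegers.coe_ne_zero_iff.2 ha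
  have hsum' := (theta_K J').1
  refine ⟨J', mixedEmbedding.norm (mixedEmbedding K (a:K)), κ0, norm_emb_pos ha', hκ, fun τ hτ => ?_⟩
  have hτ' : 0 < τ⁻¹ := inv_pos.2 hτ
  have e1 := lint_theta J hτ'
  have e2 := lint_theta_inv J' hτ' ha'
  rw [inv_inv] at e2
  have key : ∀ y : logSpace K, ∑' α : {x : 𝓞 K // x ∈ (J : Ideal (𝓞 K))}, ENNReal.ofReal (Et (tt τ⁻¹ y) (α.1 : K))
      = ENNReal.ofReal (κ0 * τ) * ∑' α : {x : 𝓞 K // x ∈ (J' : Ideal (𝓞 K))}, ENNReal.ofReal (Et (fun w => (tt τ⁻¹ y w)⁻¹) ((α.1 : K) / (a:K))) := by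
    intro y
    have hs2 : Summable fun α : {x : 𝓞 K // x ∈ (J' : Ideal (𝓞 K))} => Et (fun w => (tt τ⁻¹ y w)⁻¹) ((α.1 : K) / (a:K)) := by
      have := hsum' (fun w => (tt τ⁻¹ y w)⁻¹ / w (a:K)) (fun w => div_pos (inv_pos.2 (tt_pos _ _ _)) (pos_iff.2 ha'))
      refine this.congr fun α => ?_
      unfold Et
      congr 2
      refine Finset.sum_congr rfl fun w _ => ?_
      rw [map_div₀]; congr 2; ring
    rw [← ENNReal.ofReal_tsum_of_nonneg (fun α => Et_nonneg _ _) (hsum _ (tt_pos _ _)),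
      ← ENNReal.ofReal_tsum_of_nonneg (fun α => Et_nonneg _ _) hs2, ← ENNReal.ofReal_mul (by positivity),
      H _ (tt_pos _ _), tt_prod hτ', inv_inv]
  simp only [key] at e1
  rw [lintegral_const_mul' _ _ ENNReal.ofReal_ne_top, e2] at e1
  have s1 := HhK_summable J hτ'
  have s2 : Summable fun b : idealSet K J' => HhK K (τ * (mixedEmbedding.norm b.1 / mixedEmbedding.norm (mixedEmbedding K (a:K)))) :=
    (HhK_summable J' (div_pos hτ (norm_emb_pos ha'))).congr fun b => by congr 1; ring
  rw [← ENNReal.ofReal_tsum_of_nonneg (fun α => HhK_nonneg _) s1,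
    ← ENNReal.ofReal_tsum_of_nonneg (fun α => HhK_nonneg _) s2] at e1
  have := congrArg ENNReal.toReal e1
  rw [ENNReal.toReal_mul, ENNReal.toReal_ofReal (by positivity), ENNReal.toReal_add vol_fin ENNReal.ofReal_ne_top,
    ENNReal.toReal_add vol_fin ENNReal.ofReal_ne_top, ENNReal.toReal_ofReal (tsum_nonneg fun _ => HhK_nonneg _),
    ENNReal.toReal_ofReal (tsum_nonneg fun _ => HhK_nonneg _)] at this
  exact this.symm

end
end Landau
end

section
open Filter Topology MeasureTheory Set
open scoped BigOperators

namespace Landau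

section
variable {Q : Type} (lam : Q → ℝ) (H : ℝ → ℝ) (V : ℝ)

/-- theta-type sum -/
noncomputable def Fth (τ : ℝ) : ℝ := V + ∑' q, H (τ * lam q)

variable {lam H}

lemma Fth_summable (hlam : ∀ q, 0 < lam q) (hsum : ∀ x : ℝ, 1 < x → Summable fun q => lam q ^ (-x))
    (hH0 : ∀ x, 0 ≤ H x) (hdec : ∀ N : ℕ, 0 < N → ∃ C : ℝ, 0 ≤ C ∧ ∀ x > 0, H x ≤ C * x^(-(2*N:ℝ)))
    {τ : ℝ} (hτ : 0 < τ) : Summable fun q => H (τ * lam q) := by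
  obtain ⟨C, hC, h⟩ := hdec 1 one_pos
  refine Summable.of_nonneg_of_le (fun a => hH0 _) (fun a => ?_)
    ((hsum 2 (by norm_num)).mul_left (C * τ^(-2:ℝ)))
  refine (h _ (mul_pos hτ (hlam a))).trans (le_of_eq ?_)
  rw [Real.mul_rpow hτ.le (hlam a).le]
  norm_num; ring

lemma Fth_anti (hlam : ∀ q, 0 < lam q) (hsum : ∀ x : ℝ, 1 < x → Summable fun q => lam q ^ (-x))
    (hH0 : ∀ x, 0 ≤ H x) (hdec : ∀ N : ℕ, 0 < N → ∃ C : ℝ, 0 ≤ C ∧ ∀ x > 0, H x ≤ C * x^(-(2*N:ℝ)))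
    (hanti : ∀ x x' : ℝ, 0 < x → x ≤ x' → H x' ≤ H x) : AntitoneOn (Fth lam H V) (Ioi 0) := by
  intro x hx y hy hxy
  refine add_le_add le_rfl (Summable.tsum_le_tsum (fun q => hanti _ _ (mul_pos hx (hlam q)) (mul_le_mul_of_nonneg_right hxy (hlam q).le))
    (Fth_summable hlam hsum hH0 hdec hy) (Fth_summable hlam hsum hH0 hdec hx))

lemma Fth_locint (hlam : ∀ q, 0 < lam q) (hsum : ∀ x : ℝ, 1 < x → Summable fun q => lam q ^ (-x))
    (hH0 : ∀ x, 0 ≤ H x) (hdec : ∀ N : ℕ, 0 < N → ∃ C : ℝ, 0 ≤ C ∧ ∀ x > 0, H x ≤ C * x^(-(2*N:ℝ)))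
    (hanti : ∀ x x' : ℝ, 0 < x → x ≤ x' → H x' ≤ H x) :
    LocallyIntegrableOn (fun τ => (Fth lam H V τ : ℂ)) (Ioi 0) := by
  rw [locallyIntegrableOn_iff isOpen_Ioi.isLocallyClosed]
  intro k hk hc
  have := AntitoneOn.integrableOn_isCompact (μ := volume) hc ((Fth_anti V hlam hsum hH0 hdec hanti).mono hk)
  exact this.ofReal

lemma Fth_decay (hlam : ∀ q, 0 < lam q) (hsum : ∀ x : ℝ, 1 < x → Summable fun q => lam q ^ (-x))
    (hH0 : ∀ x, 0 ≤ H x) (hdec : ∀ N : ℕ, 0 < N → ∃ C : ℝ, 0 ≤ C ∧ ∀ x > 0, H x ≤ C * x^(-(2*N:ℝ))) (r : ℝ) :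
    (fun τ => (Fth lam H V τ : ℂ) - (V : ℂ)) =O[atTop] (fun x : ℝ => x ^ r) := by
  obtain ⟨N, hN⟩ := exists_nat_gt (max 1 (-r))
  have hN1 : (1:ℝ) < N := (le_max_left _ _).trans_lt hN
  have hN2 : -r < N := (le_max_right _ _).trans_lt hN
  have hN0 : 0 < N := by exact_mod_cast (zero_lt_one.trans hN1)
  obtain ⟨C, hC, h⟩ := hdec N hN0
  have hs := hsum (2*N) (by linarith)
  refine Asymptotics.IsBigO.of_bound (C * ∑' q, lam q ^ (-(2*N:ℝ))) ?_
  filter_upwards [eventually_ge_atTop 1] with τ hτ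
  have hτ0 : 0 < τ := by linarith
  have e : (Fth lam H V τ : ℂ) - (V : ℂ) = ((∑' q, H (τ * lam q) : ℝ) : ℂ) := by
    unfold Fth; push_cast; ring
  rw [e, Complex.norm_real, Real.norm_of_nonneg (tsum_nonneg fun q => hH0 _), Real.norm_of_nonneg (by positivity)]
  calc ∑' q, H (τ * lam q) ≤ ∑' q, (C * τ^(-(2*N:ℝ))) * lam q ^ (-(2*N:ℝ)) := by
        refine Summable.tsum_le_tsum (fun q => ?_) (Fth_summable hlam hsum hH0 hdec hτ0) (hs.mul_left _)
        refine (h _ (mul_pos hτ0 (hlam q))).trans (le_of_eq ?_)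
        rw [Real.mul_rpow hτ0.le (hlam q).le]; ring
    _ = C * (∑' q, lam q ^ (-(2*N:ℝ))) * τ^(-(2*N:ℝ)) := by rw [tsum_mul_left]; ring
    _ ≤ _ := mul_le_mul_of_nonneg_left (Real.rpow_le_rpow_of_exponent_le hτ (by linarith))
        (mul_nonneg hC (tsum_nonneg fun q => Real.rpow_nonneg (hlam q).le _))

lemma Fth_mellin [Countable Q] (hlam : ∀ q, 0 < lam q) (hsum : ∀ x : ℝ, 1 < x → Summable fun q => lam q ^ (-x))
    (hH0 : ∀ x, 0 ≤ H x) {M : ℂ → ℂ} (hM : ∀ s : ℂ, 0 < s.re → HasMellin (fun x => (H x : ℂ)) s (M s))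
    {s : ℂ} (hs : 1 < s.re) :
    mellin (fun τ => (Fth lam H V τ : ℂ) - (V : ℂ)) s = M s * ∑' q, ((lam q : ℝ) : ℂ) ^ (-s) := by
  set F : Q → ℝ → ℂ := fun q t => (t : ℂ) ^ (s - 1) • (H (lam q * t) : ℂ) with hF
  have hs0 : 0 < s.re := by linarith
  have hIntg : ∀ q, Integrable (F q) (volume.restrict (Ioi 0)) := fun q =>
    (MellinConvergent.comp_mul_left (f := fun x => (H x : ℂ)) (s := s) (hlam q)).2 (hM s hs0).1
  have hval : ∀ q, ∫ t in Ioi 0, F q t = ((lam q : ℝ) : ℂ) ^ (-s) * M s := fun q => by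
    have := mellin_comp_mul_left (fun x => (H x : ℂ)) s (hlam q)
    rw [(hM s hs0).2, smul_eq_mul] at this
    exact this
  have hnorm : ∀ q, ∫ t in Ioi 0, ‖F q t‖ = lam q ^ (-s.re) * (M (s.re : ℂ)).re := fun q => by
    have h1 := mellin_comp_mul_left (fun x => (H x : ℂ)) (s.re : ℂ) (hlam q)
    rw [(hM _ (by simpa using hs0)).2, smul_eq_mul] at h1
    have h2 : ((∫ t in Ioi 0, ‖F q t‖ : ℝ) : ℂ) = mellin (fun t => (H (lam q * t) : ℂ)) (s.re : ℂ) := by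
      rw [mellin, ← integral_complex_ofReal]
      refine setIntegral_congr_fun measurableSet_Ioi fun t ht => ?_
      simp only [hF, smul_eq_mul, norm_mul, Complex.norm_real, Real.norm_of_nonneg (hH0 _)]
      rw [Complex.norm_cpow_eq_rpow_re_of_pos ht]
      push_cast
      rw [Complex.ofReal_cpow (le_of_lt ht)]
      simp
    rw [h1] at h2
    have h3 := congrArg Complex.re h2
    rw [Complex.ofReal_re] at h3
    rw [h3]
    have : ((lam q : ℝ) : ℂ) ^ (-(s.re : ℂ)) = ((lam q ^ (-s.re) : ℝ) : ℂ) := by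
      rw [Complex.ofReal_cpow (hlam q).le]; simp
    rw [this, Complex.re_ofReal_mul]
  have hsn : Summable fun q => ∫ t in Ioi 0, ‖F q t‖ := by
    simp only [hnorm]; exact (hsum _ hs).mul_right _
  have hS := (hasSum_integral_of_summable_integral_norm hIntg hsn).tsum_eq
  simp only [hval] at hS
  rw [tsum_mul_right, mul_comm] at hS
  rw [hS, mellin]
  refine setIntegral_congr_fun measurableSet_Ioi fun t ht => ?_
  simp only [hF, Fth, smul_eq_mul]
  rw [tsum_mul_left]
  congr 1
  push_cast
  rw [add_sub_cancel_left]
  exact tsum_congr fun q => by rw [mul_comm]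

lemma Lam0_bdd (P : WeakFEPair ℂ) (x y : ℝ) : ∃ M, ∀ s : ℂ, x ≤ s.re → s.re ≤ y → ‖P.Λ₀ s‖ ≤ M := by
  have hc : ∀ s : ℂ, IntegrableOn (fun t : ℝ => (t : ℂ) ^ (s - 1) • P.f_modif t) (Ioi 0) := fun s =>
    (P.isStrongFEPair_toStrongFEPair.hasMellin s).1
  have hr : ∀ (x : ℝ), IntegrableOn (fun t : ℝ => t ^ (x-1) * ‖P.f_modif t‖) (Ioi 0) := fun x => by
    refine (hc (x:ℂ)).norm.congr ?_
    filter_upwards [ae_restrict_mem measurableSet_Ioi] with t ht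
    rw [norm_smul, Complex.norm_cpow_eq_rpow_re_of_pos ht]
    simp
  refine ⟨∫ t in Ioi (0:ℝ), (t ^ (x-1) * ‖P.f_modif t‖ + t ^ (y-1) * ‖P.f_modif t‖), fun s h1 h2 => ?_⟩
  refine (norm_integral_le_integral_norm _).trans ?_
  refine setIntegral_mono_on (hc s).norm ((hr x).add (hr y)) measurableSet_Ioi fun t ht => ?_
  have ht' : (0:ℝ) < t := ht
  rw [norm_smul, Complex.norm_cpow_eq_rpow_re_of_pos ht', ← add_mul]
  refine mul_le_mul_of_nonneg_right ?_ (norm_nonneg _)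
  simp only [Complex.sub_re, Complex.one_re]
  rcases le_total t 1 with h | h
  · have := Real.rpow_le_rpow_of_exponent_ge ht' h (by linarith : x - 1 ≤ s.re - 1)
    have : 0 ≤ t^(y-1) := by positivity
    linarith
  · have := Real.rpow_le_rpow_of_exponent_le h (by linarith : s.re - 1 ≤ y - 1)
    have : 0 ≤ t^(x-1) := by positivity
    linarith

end

theorem mk_FE {Q Q' : Type} [Countable Q] [Countable Q'] (lam : Q → ℝ) (mu : Q' → ℝ) (H : ℝ → ℝ) (V κ0 : ℝ)
    (r1 r2 : ℕ) (b : ℝ) (hb : 0 < b) (c : ℂ) (hc : c ≠ 0)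
    (hlam : ∀ q, 0 < lam q) (hmu : ∀ q, 0 < mu q)
    (hsl : ∀ x : ℝ, 1 < x → Summable fun q => lam q ^ (-x))
    (hsm : ∀ x : ℝ, 1 < x → Summable fun q => mu q ^ (-x))
    (hH0 : ∀ x, 0 ≤ H x) (hdec : ∀ N : ℕ, 0 < N → ∃ C : ℝ, 0 ≤ C ∧ ∀ x > 0, H x ≤ C * x^(-(2*N:ℝ)))
    (hanti : ∀ x x' : ℝ, 0 < x → x ≤ x' → H x' ≤ H x)
    (hM : ∀ s : ℂ, 0 < s.re → HasMellin (fun x => (H x : ℂ)) s (c * gam r1 r2 b s))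
    (hκ : 0 < κ0)
    (hFE : ∀ τ : ℝ, 0 < τ → Fth lam H V τ⁻¹ = κ0 * τ * Fth mu H V τ)
    (Cm : ℝ) (hCm : 0 ≤ Cm) (hcount : ∀ Y : ℝ, 0 < Y → ∀ F : Finset Q', (∀ q ∈ F, mu q ≤ Y) → (F.card : ℝ) ≤ Cm * Y) :
    ∃ P : FEData Q Q' r1 r2, P.lam = lam := by
  let P : WeakFEPair ℂ :=
    { f := fun τ => (Fth lam H V τ : ℂ)
      g := fun τ => (Fth mu H V τ : ℂ)
      k := 1
      ε := (κ0 : ℂ)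
      f₀ := (V : ℂ)
      g₀ := (V : ℂ)
      hf_int := Fth_locint V hlam hsl hH0 hdec hanti
      hg_int := Fth_locint V hmu hsm hH0 hdec hanti
      hk := one_pos
      hε := by exact_mod_cast hκ.ne'
      h_feq := fun x hx => by
        rw [one_div, hFE x hx, Real.rpow_one]; push_cast; rfl
      hf_top := Fth_decay V hlam hsl hH0 hdec
      hg_top := Fth_decay V hmu hsm hH0 hdec }
  have hk : P.k = 1 := rfl
  have hL : ∀ s : ℂ, P.Λ s = P.Λ₀ s - (V:ℂ) / s - ((κ0 * V : ℝ) : ℂ) / (1 - s) := fun s => by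
    rw [WeakFEPair.Λ]
    change _ - (1 / s) • (V : ℂ) - ((κ0 : ℂ) / (((1:ℝ) : ℂ) - s)) • (V : ℂ) = _
    simp only [smul_eq_mul, Complex.ofReal_one]
    push_cast; ring
  have e1 : ∀ s : ℂ, 1 < s.re → P.Λ s = c * (gam r1 r2 b s * ∑' q, ((lam q : ℝ) : ℂ) ^ (-s)) := fun s hs => by
    have := (P.hasMellin (s := s) (by rw [hk]; exact hs)).2
    rw [← this]
    change mellin (fun τ => (Fth lam H V τ : ℂ) - (V : ℂ)) s = _
    rw [Fth_mellin V hlam hsl hH0 hM hs, mul_assoc]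
  have e2 : ∀ s : ℂ, 1 < s.re → P.Λ (1 - s) = (κ0 * c) * (gam r1 r2 b s * ∑' q, ((mu q : ℝ) : ℂ) ^ (-s)) := fun s hs => by
    have h1 := P.functional_equation s
    have := (P.symm.hasMellin (s := s) (by change (1:ℝ) < _; exact hs)).2
    rw [← this] at h1
    have h2 : mellin (fun τ => (Fth mu H V τ : ℂ) - (V : ℂ)) s = _ := Fth_mellin V hmu hsm hH0 hM hs
    change P.Λ (((1:ℝ):ℂ) - s) = (κ0 : ℂ) • mellin (fun τ => (Fth mu H V τ : ℂ) - (V : ℂ)) s at h1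
    rw [h2, Complex.ofReal_one, smul_eq_mul] at h1
    rw [h1]; ring
  exact ⟨
    { lam := lam, mu := mu, lam_pos := hlam, mu_pos := hmu, b := b, b_pos := hb
      L0 := P.Λ₀, A := V, B := ((κ0 * V : ℝ) : ℂ), c1 := c, c2 := κ0 * c, c1_ne := hc
      L0_diff := P.differentiable_Λ₀
      L0_bdd := Lam0_bdd P
      lam_sum := hsl, mu_sum := hsm
      eq1 := fun s hs => by rw [← e1 s hs, hL]
      eq2 := fun s hs => by
        rw [← e2 s hs, hL]
        congr 2; ring
      Cm := Cm, Cm_nn := hCm, mu_count := hcount }, rfl⟩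

end Landau
end

section
open Filter Topology MeasureTheory Set
open scoped BigOperators

namespace Landau

open NumberField NumberField.InfinitePlace NumberField.mixedEmbedding nonZeroDivisors
open NumberField.Units NumberField.Units.dirichletUnitTheorem NumberField.mixedEmbedding.fundamentalCone
open scoped Classical Pointwise

section
variable {K : Type} [Field K] [NumberField K]

lemma cpow_pos_exp {x : ℝ} (hx : 0 < x) (s : ℂ) : (x : ℂ) ^ s = Complex.exp ((Real.log x : ℂ) * s) := by
  rw [Complex.cpow_def_of_ne_zero (by exact_mod_cast hx.ne'), Complex.ofReal_log hx.le]

/-- conductor-like constant -/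
noncomputable def bb (r1 r2 : ℕ) : ℝ := Real.exp (r1 * (1/2 * Real.log (1 / Real.pi)) + r2 * Real.log (1 / (Real.pi * 2)))

lemma Mm_prod (r1 r2 : ℕ) (s : ℂ) : (Mm 1 s)^r1 * (Mm 2 s)^r2 = (1/2)^r1 * gam r1 r2 (bb r1 r2) s := by
  have hp := Real.pi_pos
  have h1 : Mm 1 s = 1/2 * (Complex.exp ((Real.log (1/Real.pi) : ℂ) * (s/2)) * Complex.Gamma (s/2)) := by
    unfold Mm
    rw [cpow_pos_exp (by positivity)]
    simp
  have h2 : Mm 2 s = Complex.exp ((Real.log (1/(Real.pi*2)) : ℂ) * s) * Complex.Gamma s := by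
    unfold Mm
    rw [cpow_pos_exp (by positivity)]
    have : s * ((2:ℕ):ℂ) / 2 = s := by push_cast; field_simp
    rw [this]
    simp
  rw [h1, h2, gam, bb, cpow_pos_exp (Real.exp_pos _), Real.log_exp]
  simp only [mul_pow, ← Complex.exp_nat_mul]
  have : Complex.exp (((r1 * (1/2 * Real.log (1 / Real.pi)) + r2 * Real.log (1 / (Real.pi * 2)) : ℝ) : ℂ) * s)
    = Complex.exp (r1 * ((Real.log (1/Real.pi) : ℂ) * (s/2))) * Complex.exp (r2 * ((Real.log (1/(Real.pi*2)) : ℂ) * s)) := by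
    rw [← Complex.exp_add]; congr 1; push_cast; ring
  rw [this]; ring

lemma Mm_places (s : ℂ) : Mm (w₀ : InfinitePlace K).mult s * ∏ i : {w : InfinitePlace K // w ≠ w₀}, Mm i.1.mult s
    = (1/2)^(nrRealPlaces K) * gam (nrRealPlaces K) (nrComplexPlaces K) (bb (nrRealPlaces K) (nrComplexPlaces K)) s := by
  rw [← Mm_prod, ← Fintype.prod_eq_mul_prod_subtype_ne (fun w : InfinitePlace K => Mm w.mult s) w₀,
    ← Fintype.prod_subtype_mul_prod_subtype (fun w : InfinitePlace K => IsReal w)]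
  congr 1
  · rw [Finset.prod_congr rfl (fun w _ => by rw [mult_isReal w] : ∀ w ∈ Finset.univ, Mm (w : {w : InfinitePlace K // IsReal w}).1.mult s = Mm 1 s)]
    rw [Finset.prod_const, Finset.card_univ]
  · have : ∀ w : {w : InfinitePlace K // ¬ IsReal w}, Mm w.1.mult s = Mm 2 s := fun w => by
      rw [mult, if_neg w.2]
    simp only [this]
    rw [Finset.prod_const, Finset.card_univ]
    congr 1
    exact Fintype.card_congr (Equiv.subtypeEquivRight fun w => not_isReal_iff_isComplex (w := w))

variable (J : (Ideal (𝓞 K))⁰)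

instance count_idealSet : Countable (idealSet K J) :=
  Function.Injective.countable (f := pre J) (fun a b h => Subtype.ext (by
    rw [← pre_spec J a, ← pre_spec J b, h]))

theorem class_count_aux : ∃ (J' : (Ideal (𝓞 K))⁰) (P : FEData (idealSet K J) (idealSet K J') (nrRealPlaces K) (nrComplexPlaces K)),
    P.lam = fun a => mixedEmbedding.norm a.1 := by
  obtain ⟨J', a₀, κ0, ha, hκ, hFE⟩ := theta_FEK J
  obtain ⟨C, hC, hcount⟩ := idealSet_count J'
  refine ⟨J', mk_FE (fun a : idealSet K J => mixedEmbedding.norm a.1) (fun b : idealSet K J' => mixedEmbedding.norm b.1 / a₀)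
    (HhK K) (volume (Dm K)).toReal κ0 (nrRealPlaces K) (nrComplexPlaces K) (bb (nrRealPlaces K) (nrComplexPlaces K)) (Real.exp_pos _)
    ((1/2)^(nrRealPlaces K)) (pow_ne_zero _ (by norm_num)) (norm_pos_idealSet J) (fun b => div_pos (norm_pos_idealSet J' b) ha)
    (fun x hx => idealSet_summable J hx) (fun x hx => ?_) HhK_nonneg HhK_decay (fun x x' => HhK_anti) (fun s hs => ?_) hκ hFE
    (C * a₀) (by positivity) (fun Y hY F hF => ?_)⟩
  · have := (idealSet_summable J' hx).mul_right (a₀ ^ (-x))⁻¹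
    refine this.congr fun b => ?_
    rw [Real.div_rpow (norm_pos_idealSet J' b).le ha.le]; rfl
  · rw [← Mm_places]
    exact Hh_mellin _ _ mult_pos (fun i => mult_pos) hs
  · have := hcount (Y * a₀) (by positivity) F (fun b hb => (div_le_iff₀ ha).1 (hF b hb))
    linarith

theorem class_count (hn : 2 ≤ nrRealPlaces K + 2 * nrComplexPlaces K) :
    ∃ ρ C : ℝ, 0 ≤ C ∧ ∀ X : ℝ, 1 ≤ X →
     |(Nat.card {a : idealSet K J // mixedEmbedding.norm (a : mixedSpace K) ≤ X} : ℝ) - ρ * X|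
       ≤ C * X ^ (1 - 2 / ((nrRealPlaces K + 2 * nrComplexPlaces K : ℝ) + 1)) := by
  obtain ⟨J', P, hP⟩ := class_count_aux J
  obtain ⟨ρ, C, hC, h⟩ := P.count hn
  refine ⟨ρ, C, hC, fun X hX => ?_⟩
  have := (h X hX).2
  rw [hP] at this
  exact this

end
end Landau
end

section
open Filter Topology MeasureTheory Set
open scoped BigOperators

namespace Landau

open NumberField NumberField.InfinitePlace NumberField.mixedEmbedding nonZeroDivisors
open NumberField.Units NumberField.Units.dirichletUnitTheorem NumberField.mixedEmbedding.fundamentalCone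
open scoped Classical Pointwise

section
variable {K : Type} [Field K] [NumberField K]

/-- the number of nonzero ideals of norm at most s -/
noncomputable def cntI (K : Type) [Field K] [NumberField K] (s : ℝ) : ℕ :=
  Nat.card {I : (Ideal (𝓞 K))⁰ // (Ideal.absNorm (I : Ideal (𝓞 K)) : ℝ) ≤ s}

lemma class_equiv {C : ClassGroup (𝓞 K)} {J : (Ideal (𝓞 K))⁰} {s : ℝ} (hJ : ClassGroup.mk0 J = C⁻¹) :
    Nat.card {I : (Ideal (𝓞 K))⁰ // Ideal.absNorm (I : Ideal (𝓞 K)) ≤ s ∧ ClassGroup.mk0 I = C}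
      = Nat.card {I : (Ideal (𝓞 K))⁰ // (J : Ideal (𝓞 K)) ∣ I ∧ Submodule.IsPrincipal (I : Ideal (𝓞 K)) ∧
        Ideal.absNorm (I : Ideal (𝓞 K)) ≤ s * Ideal.absNorm (J : Ideal (𝓞 K))} := by
  simp_rw [← nonZeroDivisors_dvd_iff_dvd_coe]
  refine Nat.card_congr ?_
  refine ((Equiv.dvd J).subtypeEquiv fun I ↦ ?_).trans
    (Equiv.subtypeSubtypeEquivSubtypeInter (fun I : (Ideal (𝓞 K))⁰ ↦ J ∣ I) _)
  rw [← ClassGroup.mk0_eq_one_iff (SetLike.coe_mem _)]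
  simp_rw [Equiv.dvd_apply, Submonoid.coe_mul, ← Submonoid.mul_def, _root_.map_mul, hJ,
    inv_mul_eq_one, Nat.cast_mul, mul_comm s, eq_comm, and_comm, and_congr_left_iff]
  exact fun _ ↦
    (mul_le_mul_iff_of_pos_left (Nat.cast_pos.mpr (Ideal.absNorm_pos_of_nonZeroDivisors J))).symm

lemma class_ideal_count (hn : 2 ≤ nrRealPlaces K + 2 * nrComplexPlaces K) (C : ClassGroup (𝓞 K)) :
    ∃ ρ D : ℝ, 0 ≤ D ∧ ∀ X : ℝ, 1 ≤ X →
     |(Nat.card {I : (Ideal (𝓞 K))⁰ // Ideal.absNorm (I : Ideal (𝓞 K)) ≤ X ∧ ClassGroup.mk0 I = C} : ℝ) - ρ * X|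
       ≤ D * X ^ (1 - 2 / ((nrRealPlaces K + 2 * nrComplexPlaces K : ℝ) + 1)) := by
  obtain ⟨J, hJ⟩ := ClassGroup.mk0_surjective C⁻¹
  obtain ⟨ρ, D, hD, h⟩ := class_count J hn
  set θ := (1 - 2 / ((nrRealPlaces K + 2 * nrComplexPlaces K : ℝ) + 1))
  set NJ : ℝ := ((Ideal.absNorm (J : Ideal (𝓞 K)) : ℕ) : ℝ) with hNJ
  have hN1 : 1 ≤ NJ := one_le_absNorm J
  have hw : (0:ℝ) < torsionOrder K := by exact_mod_cast Nat.pos_of_ne_zero (torsionOrder_ne_zero K)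
  refine ⟨ρ * NJ / torsionOrder K, D * NJ ^ θ / torsionOrder K, by positivity, fun X hX => ?_⟩
  have hXN : 1 ≤ X * NJ := by nlinarith
  have h1 := h _ hXN
  rw [← card_isPrincipal_dvd_norm_le, Nat.cast_mul] at h1
  rw [class_equiv hJ]
  rw [Real.mul_rpow (by linarith) (by linarith)] at h1
  set N : ℝ := (Nat.card {I : (Ideal (𝓞 K))⁰ // (J : Ideal (𝓞 K)) ∣ I ∧ Submodule.IsPrincipal (I : Ideal (𝓞 K)) ∧
        Ideal.absNorm (I : Ideal (𝓞 K)) ≤ X * Ideal.absNorm (J : Ideal (𝓞 K))} : ℝ)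
  have e : N - ρ * NJ / torsionOrder K * X = (N * torsionOrder K - ρ * (X * NJ)) / torsionOrder K := by
    field_simp
  rw [e, abs_div, abs_of_pos hw, div_le_iff₀ hw]
  refine h1.trans (le_of_eq ?_)
  field_simp

lemma landau_ge_two (hn : 2 ≤ nrRealPlaces K + 2 * nrComplexPlaces K) :
    ∃ ρ D : ℝ, 0 ≤ D ∧ ∀ X : ℝ, 1 ≤ X → |(cntI K X : ℝ) - ρ * X|
       ≤ D * X ^ (1 - 2 / ((nrRealPlaces K + 2 * nrComplexPlaces K : ℝ) + 1)) := by
  choose ρ D hD h using class_ideal_count (K := K) hn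
  refine ⟨∑ C, ρ C, ∑ C, D C, Finset.sum_nonneg fun C _ => hD C, fun s hs => ?_⟩
  have key : (cntI K s : ℝ) = ∑ C, (Nat.card {I : (Ideal (𝓞 K))⁰ // Ideal.absNorm (I : Ideal (𝓞 K)) ≤ s ∧ ClassGroup.mk0 I = C} : ℝ) := by
    unfold cntI
    have : Fintype {I : (Ideal (𝓞 K))⁰ // Ideal.absNorm (I : Ideal (𝓞 K)) ≤ s} :=
      @Fintype.ofFinite _ (fin_ideals s)
    let e := fun C : ClassGroup (𝓞 K) ↦ Equiv.subtypeSubtypeEquivSubtypeInter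
      (fun I : (Ideal (𝓞 K))⁰ ↦ Ideal.absNorm I.1 ≤ s) (fun I ↦ ClassGroup.mk0 I = C)
    simp_rw [← Nat.card_congr (e _), Nat.card_eq_fintype_card, Fintype.subtype_card]
    rw [Fintype.card, Finset.card_eq_sum_card_fiberwise (f := fun I ↦ ClassGroup.mk0 I.1)
      (t := Finset.univ) (fun _ _ ↦ Finset.mem_univ _), Nat.cast_sum]
  rw [key, Finset.sum_mul, Finset.sum_mul, ← Finset.sum_sub_distrib]
  exact (Finset.abs_sum_le_sum_abs _ _).trans (Finset.sum_le_sum fun C _ => h C s hs)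

lemma absNorm_nat (hn : Module.finrank ℚ K = 1) (m : ℕ) : Ideal.absNorm (Ideal.span {(m : 𝓞 K)}) = m := by
  rw [Ideal.absNorm_span_singleton]
  have : Algebra.norm ℤ (m : 𝓞 K) = (m:ℤ) := by
    have := Algebra.norm_algebraMap_of_basis (RingOfIntegers.basis K) (m : ℤ)
    rw [← Module.finrank_eq_card_basis (RingOfIntegers.basis K), RingOfIntegers.rank, hn, pow_one] at this
    simpa using this
  rw [this]; simp

lemma ideal_eq_span (hn : Module.finrank ℚ K = 1) (I : (Ideal (𝓞 K))⁰) :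
    (I : Ideal (𝓞 K)) = Ideal.span {((Ideal.absNorm (I : Ideal (𝓞 K)) : ℕ) : 𝓞 K)} := by
  set m := Ideal.absNorm (I : Ideal (𝓞 K)) with hm
  have hm0 : 0 < m := Ideal.absNorm_pos_of_nonZeroDivisors I
  have h1 : Ideal.span {((m : ℕ) : 𝓞 K)} ≤ (I : Ideal (𝓞 K)) := by
    rw [Ideal.span_singleton_le_iff_mem]; exact Ideal.absNorm_mem _
  obtain ⟨L, hL⟩ := Ideal.dvd_iff_le.2 h1
  have h2 := congrArg Ideal.absNorm hL
  rw [absNorm_nat hn, map_mul, ← hm] at h2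
  have h3 : Ideal.absNorm L = 1 := by
    have : m * 1 = m * Ideal.absNorm L := by rw [mul_one]; exact h2
    exact (Nat.eq_of_mul_eq_mul_left hm0 this).symm
  rw [Ideal.absNorm_eq_one_iff] at h3
  rw [hL, h3, Ideal.mul_top]

lemma cntI_one (hn : Module.finrank ℚ K = 1) {s : ℝ} (hs : 0 ≤ s) : cntI K s = ⌊s⌋₊ := by
  unfold cntI
  have : Nat.card (Finset.Icc 1 ⌊s⌋₊) = ⌊s⌋₊ := by rw [Nat.card_eq_fintype_card, Fintype.card_coe, Nat.card_Icc, Nat.add_sub_cancel]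
  rw [← this]
  refine Nat.card_congr (Equiv.ofBijective (fun I => ⟨Ideal.absNorm (I.1 : Ideal (𝓞 K)), ?_⟩) ⟨?_, ?_⟩)
  · rw [Finset.mem_Icc]
    exact ⟨Ideal.absNorm_pos_of_nonZeroDivisors I.1, Nat.le_floor I.2⟩
  · intro I I' h
    have h' : Ideal.absNorm (I.1 : Ideal (𝓞 K)) = Ideal.absNorm (I'.1 : Ideal (𝓞 K)) := congrArg (fun u => u.1) h
    apply Subtype.ext; apply Subtype.ext
    rw [ideal_eq_span hn I.1, ideal_eq_span hn I'.1, h']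
  · rintro ⟨m, hm⟩
    rw [Finset.mem_Icc] at hm
    have hne : Ideal.span {(m : 𝓞 K)} ≠ 0 := by
      intro h
      have := absNorm_nat (K := K) hn m
      rw [h, Ideal.zero_eq_bot, Ideal.absNorm_bot] at this
      omega
    refine ⟨⟨⟨Ideal.span {(m : 𝓞 K)}, mem_nonZeroDivisors_of_ne_zero hne⟩, ?_⟩, ?_⟩
    · change ((Ideal.absNorm (Ideal.span {(m : 𝓞 K)}) : ℕ) : ℝ) ≤ s
      rw [absNorm_nat hn]
      exact (Nat.le_floor_iff hs).1 hm.2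
    · exact Subtype.ext (absNorm_nat hn m)

/-- Landau's theorem -/
theorem landau : ∃ D : ℝ, 0 ≤ D ∧ ∀ X : ℝ, 1 ≤ X → |(cntI K X : ℝ) - 
    ((2 ^ nrRealPlaces K * (2 * Real.pi) ^ nrComplexPlaces K * regulator K * classNumber K) /
            (torsionOrder K * Real.sqrt |discr K|)) * X| ≤ D * X ^ (1 - 2 / ((Module.finrank ℚ K : ℝ) + 1)) := by
  have hr := card_add_two_mul_card_eq_rank K
  have hr' : (nrRealPlaces K + 2 * nrComplexPlaces K : ℝ) = Module.finrank ℚ K := by exact_mod_cast hr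
  have hpos : 0 < Module.finrank ℚ K := Module.finrank_pos
  have main : ∃ ρ D : ℝ, 0 ≤ D ∧ ∀ X : ℝ, 1 ≤ X → |(cntI K X : ℝ) - ρ * X|
       ≤ D * X ^ (1 - 2 / ((Module.finrank ℚ K : ℝ) + 1)) := by
    rcases Nat.lt_or_ge (Module.finrank ℚ K) 2 with h | h
    · have h1 : Module.finrank ℚ K = 1 := by omega
      refine ⟨1, 1, zero_le_one, fun X hX => ?_⟩
      rw [cntI_one h1 (by linarith), h1]
      norm_num
      rw [abs_sub_comm, abs_le]
      have := Nat.floor_le (show 0 ≤ X by linarith)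
      have := Nat.lt_floor_add_one X
      constructor <;> linarith
    · rw [← hr']
      exact landau_ge_two (by rw [hr]; exact h)
  obtain ⟨ρ, D, hD, h⟩ := main
  set θ := (1 - 2 / ((Module.finrank ℚ K : ℝ) + 1)) with hθ
  have hlim := NumberField.Ideal.tendsto_norm_le_div_atTop₀ K
  have hθ1 : θ < 1 := by
    have : 0 < 2 / ((Module.finrank ℚ K : ℝ) + 1) := by positivity
    linarith
  have hlim2 : Tendsto (fun s : ℝ => (cntI K s : ℝ) / s) atTop (𝓝 ρ) := by
    rw [tendsto_iff_norm_sub_tendsto_zero]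
    have h0 : Tendsto (fun s : ℝ => D * s ^ (-(1-θ))) atTop (𝓝 0) := by
      simpa using (tendsto_rpow_neg_atTop (show 0 < 1 - θ by linarith)).const_mul D
    refine squeeze_zero' (Eventually.of_forall fun s => norm_nonneg _) ?_ h0
    filter_upwards [eventually_ge_atTop 1] with s hs
    have hs0 : 0 < s := by linarith
    have e : (cntI K s : ℝ) / s - ρ = ((cntI K s : ℝ) - ρ * s) / s := by field_simp
    rw [e, norm_div, Real.norm_eq_abs, Real.norm_of_nonneg hs0.le, div_le_iff₀ hs0]
    refine (h s hs).trans (le_of_eq ?_)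
    rw [mul_assoc, ← Real.rpow_add_one hs0.ne']
    congr 2; ring
  have := tendsto_nhds_unique hlim2 hlim
  rw [← this]
  exact ⟨D, hD, h⟩

end
end Landau
end

section
open Filter Topology MeasureTheory Set
open scoped BigOperators

namespace Landau

section
variable {I : Type}

lemma prod_hasSum : ∀ (k : ℕ) (f : Fin k → I → ℝ), (∀ i j, 0 ≤ f i j) → (∀ i, Summable (f i)) →
    HasSum (fun b : Fin k → I => ∏ i, f i (b i)) (∏ i, ∑' j, f i j) := by
  intro k
  induction k with
  | zero =>
    intro f _ _
    simp only [Finset.univ_eq_empty, Finset.prod_empty]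
    exact hasSum_unique (fun _ : Fin 0 → I => (1:ℝ))
  | succ k ih =>
    intro f hf hs
    have h1 := ih (fun i => f i.succ) (fun i => hf _) (fun i => hs _)
    have hg : 0 ≤ (fun b : Fin k → I => ∏ i, f (Fin.succ i) (b i)) :=
      fun b => Finset.prod_nonneg fun i _ => hf _ _
    have hf0 : 0 ≤ f 0 := fun j => hf 0 j
    have hsm := Summable.mul_of_nonneg (hs 0) h1.summable hf0 hg
    have h2 := (hs 0).hasSum.mul h1 hsm
    rw [Fin.prod_univ_succ]
    rw [← (Fin.consEquiv (fun _ : Fin (k+1) => I)).hasSum_iff]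
    have hfun : (fun b : Fin (k+1) → I => ∏ i, f i (b i)) ∘ (Fin.consEquiv (fun _ : Fin (k+1) => I))
        = fun x : I × (Fin k → I) => f 0 x.1 * ∏ i, f (Fin.succ i) (x.2 i) := by
      funext x
      rw [Function.comp_apply, Fin.prod_univ_succ]
      rfl
    rw [hfun]
    exact h2

/-- weighted product -/
noncomputable def wM (N : I → ℝ) {k : ℕ} (e : Fin k → ℝ) (b : Fin k → I) : ℝ := ∏ i, N (b i) ^ (e i)

lemma wM_one_le {N : I → ℝ} (hN : ∀ j, 1 ≤ N j) {k : ℕ} {e : Fin k → ℝ} (he : ∀ i, 0 ≤ e i) (b : Fin k → I) :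
    1 ≤ wM N e b :=
  by
    unfold wM
    have := Finset.prod_le_prod (s := Finset.univ) (f := fun _ : Fin k => (1:ℝ)) (g := fun i => N (b i) ^ (e i))
      (fun _ _ => zero_le_one) (fun i _ => Real.one_le_rpow (hN _) (he i))
    simpa using this

lemma wM_rpow {N : I → ℝ} (hN : ∀ j, 1 ≤ N j) {k : ℕ} (e : Fin k → ℝ) (b : Fin k → I) (α : ℝ) :
    (wM N e b) ^ (-α) = ∏ i, N (b i) ^ (-(e i * α)) := by
  unfold wM
  have h0 : ∀ j, 0 ≤ N j := fun j => zero_le_one.trans (hN j)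
  rw [← Real.finsetProd_rpow _ _ (fun i _ => Real.rpow_nonneg (h0 _) _)]
  refine Finset.prod_congr rfl fun i _ => ?_
  rw [← Real.rpow_mul (h0 _)]
  congr 1; ring

lemma N_summable {N : I → ℝ} (hN : ∀ j, 1 ≤ N j) {C : ℝ}
    (hc : ∀ Y : ℝ, 0 < Y → ∀ F : Finset I, (∀ q ∈ F, N q ≤ Y) → (F.card : ℝ) ≤ C * Y ^ (1:ℝ))
    {s : ℝ} (hs : 1 < s) : Summable fun j => N j ^ (-s) :=
  ps_summable (by linarith) hs one_pos hN hc

lemma wM_hasSum {N : I → ℝ} (hN : ∀ j, 1 ≤ N j) {C : ℝ}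
    (hc : ∀ Y : ℝ, 0 < Y → ∀ F : Finset I, (∀ q ∈ F, N q ≤ Y) → (F.card : ℝ) ≤ C * Y ^ (1:ℝ))
    {k : ℕ} (e : Fin k → ℝ) (α : ℝ) (he : ∀ i, 1 < e i * α) :
    HasSum (fun b => (wM N e b) ^ (-α)) (∏ i, ∑' j, N j ^ (-(e i * α))) := by
  simp_rw [wM_rpow hN]
  exact prod_hasSum k (fun i j => N j ^ (-(e i * α))) (fun i j => Real.rpow_nonneg (zero_le_one.trans (hN j)) _)
    (fun i => N_summable hN hc (he i))

lemma wM_count {N : I → ℝ} (hN : ∀ j, 1 ≤ N j) {C : ℝ}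
    (hc : ∀ Y : ℝ, 0 < Y → ∀ F : Finset I, (∀ q ∈ F, N q ≤ Y) → (F.card : ℝ) ≤ C * Y ^ (1:ℝ))
    {k : ℕ} (e : Fin (k+1) → ℝ) (he0 : 0 < e 0) (he : ∀ i : Fin k, e 0 < e i.succ) :
    ∃ C' : ℝ, ∀ Y : ℝ, 0 < Y → ∀ F : Finset (Fin (k+1) → I), (∀ q ∈ F, wM N e q ≤ Y) →
      (F.card : ℝ) ≤ C' * Y ^ (1 / e 0) := by
  classical
  have hC := ps_C_nonneg hc
  have h0 : ∀ j, 0 ≤ N j := fun j => zero_le_one.trans (hN j)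
  set e' : Fin k → ℝ := fun i => e i.succ with he'
  have hsum := wM_hasSum hN hc e' (1 / e 0) (fun i => by
    rw [mul_one_div, lt_div_iff₀ he0, one_mul]; exact he i)
  refine ⟨C * ∏ i, ∑' j, N j ^ (-(e' i * (1 / e 0))), fun Y hY F hF => ?_⟩
  have hM' : ∀ b : Fin k → I, 0 < wM N e' b := fun b =>
    lt_of_lt_of_le one_pos (wM_one_le hN (fun i => (he0.trans (he i)).le) b)
  have h1 : ∀ b ∈ F.image Fin.tail, ((F.filter fun q => Fin.tail q = b).card : ℝ)
      ≤ C * Y ^ (1 / e 0) * (wM N e' b) ^ (-(1 / e 0)) := by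
    intro b _
    have hinj : Set.InjOn (fun q : Fin (k+1) → I => q 0) (F.filter fun q => Fin.tail q = b) := by
      intro p hp q hq hpq
      have hp := (Finset.mem_filter.1 (Finset.mem_coe.1 hp)).2
      have hq := (Finset.mem_filter.1 (Finset.mem_coe.1 hq)).2
      rw [← Fin.cons_self_tail p, ← Fin.cons_self_tail q, hp, hq]
      simp only at hpq
      rw [hpq]
    rw [← Finset.card_image_of_injOn hinj]
    have hq : 0 < Y / wM N e' b := div_pos hY (hM' b)
    refine (hc ((Y / wM N e' b) ^ (1 / e 0)) (by positivity) _ ?_).trans (le_of_eq ?_)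
    · intro j hj
      obtain ⟨q, hqF, rfl⟩ := Finset.mem_image.1 hj
      obtain ⟨hqF, hqb⟩ := Finset.mem_filter.1 hqF
      have h2 := hF q hqF
      have h3 : wM N e q = N (q 0) ^ (e 0) * wM N e' b := by
        unfold wM
        rw [Fin.prod_univ_succ, ← hqb]; rfl
      rw [h3, ← le_div_iff₀ (hM' b)] at h2
      have h4 := Real.rpow_le_rpow (Real.rpow_nonneg (h0 _) _) h2 (one_div_pos.2 he0).le
      rwa [← Real.rpow_mul (h0 _), mul_one_div_cancel he0.ne', Real.rpow_one] at h4
    · rw [Real.rpow_one, Real.div_rpow hY.le (hM' b).le, Real.rpow_neg (hM' b).le]; ring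
  rw [Finset.card_eq_sum_card_image Fin.tail F]
  push_cast
  calc _ ≤ ∑ b ∈ F.image Fin.tail, C * Y ^ (1 / e 0) * (wM N e' b) ^ (-(1 / e 0)) := Finset.sum_le_sum h1
    _ = C * Y ^ (1 / e 0) * ∑ b ∈ F.image Fin.tail, (wM N e' b) ^ (-(1 / e 0)) := by rw [Finset.mul_sum]
    _ ≤ C * Y ^ (1 / e 0) * ∏ i, ∑' j, N j ^ (-(e' i * (1 / e 0))) := by
        refine mul_le_mul_of_nonneg_left ?_ (by positivity)
        rw [← hsum.tsum_eq]
        exact hsum.summable.sum_le_tsum _ (fun b _ => (Real.rpow_pos_of_pos (hM' b) _).le)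
    _ = _ := by ring

end

end Landau
end

section
open Filter Topology MeasureTheory Set
open scoped BigOperators

namespace Landau

section
variable {Q : Type}

/-- generic error term -/
noncomputable def Rgen (H θ x : ℝ) : ℝ :=
  if H / (H + 1) < θ then x ^ ((1 / H) * θ)
  else if H / (H + 1) = θ then x ^ ((1 / H) * θ) * Real.log x
  else x ^ (1 / (H + 1))

lemma log_ge_one {x : ℝ} (hx : Real.exp 1 ≤ x) : 1 ≤ Real.log x := by
  rw [Real.le_log_iff_exp_le ((Real.exp_pos 1).trans_le hx)]; exact hx

lemma one_le_of_exp {x : ℝ} (hx : Real.exp 1 ≤ x) : 1 ≤ x :=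
  (Real.one_le_exp zero_le_one).trans hx

lemma Rgen_ge {H θ x : ℝ} (hH : 0 < H) (hx : Real.exp 1 ≤ x) : x ^ (1 / (H + 1)) ≤ Rgen H θ x := by
  have h1 := one_le_of_exp hx
  have hl := log_ge_one hx
  have hk : 1 / (H + 1) = (1 / H) * (H / (H + 1)) := by field_simp
  unfold Rgen
  split_ifs with h2 h3
  · refine Real.rpow_le_rpow_of_exponent_le h1 ?_
    rw [hk]
    exact mul_le_mul_of_nonneg_left h2.le (by positivity)
  · rw [hk, h3]
    exact le_mul_of_one_le_right (Real.rpow_nonneg (by linarith) _) hl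
  · exact le_rfl

lemma err_sum {f : Q → ℝ} {C H θ : ℝ} (hH : 0 < H) (hθ : 0 ≤ θ) (hf : ∀ q, 1 ≤ f q)
    (hc : ∀ Y : ℝ, 0 < Y → ∀ F : Finset Q, (∀ q ∈ F, f q ≤ Y) → (F.card : ℝ) ≤ C * Y ^ (1 / (H + 1))) :
    ∃ E : ℝ, 0 ≤ E ∧ ∀ x : ℝ, Real.exp 1 ≤ x → ∀ S : Finset Q, (∀ q ∈ S, f q ≤ x) →
      x ^ ((1 / H) * θ) * ∑ q ∈ S, f q ^ (-((1 / H) * θ)) ≤ E * Rgen H θ x := by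
  have hC := ps_C_nonneg hc
  have hk : 1 / (H + 1) = (1 / H) * (H / (H + 1)) := by field_simp
  have hHi : 0 < 1 / H := by positivity
  have hHq : 0 < H / (H + 1) := by positivity
  rcases lt_trichotomy (H / (H + 1)) θ with h | h | h
  · obtain ⟨C', hC', ht⟩ := ps_tail (α := (1 / H) * θ) (mul_pos hHi (hHq.trans h))
      (by rw [hk]; exact mul_lt_mul_of_pos_left h hHi) hc
    refine ⟨C', hC', fun x hx S hS => ?_⟩
    have h1 := one_le_of_exp hx
    have := ht 1 one_pos S (fun q _ => hf q)
    rw [Real.one_rpow, mul_one] at this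
    rw [Rgen, if_pos h, mul_comm C']
    exact mul_le_mul_of_nonneg_left this (Real.rpow_nonneg (by linarith) _)
  · have e : 1 / (H + 1) = (1 / H) * θ := by rw [hk, h]
    rw [e] at hc
    obtain ⟨C', hC', ht⟩ := ps_init_eq (by rw [← e]; positivity) hf hc
    refine ⟨C' * 2, by positivity, fun x hx S hS => ?_⟩
    have h1 := one_le_of_exp hx
    have hl := log_ge_one hx
    have := ht x h1 S hS
    rw [Rgen, if_neg (by rw [h]; exact lt_irrefl _), if_pos h]
    calc _ ≤ x ^ ((1 / H) * θ) * (C' * (2 * Real.log x)) := by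
          refine mul_le_mul_of_nonneg_left (this.trans ?_) (Real.rpow_nonneg (by linarith) _)
          exact mul_le_mul_of_nonneg_left (by linarith) hC'
      _ = _ := by ring
  · have e : (1 / H) * θ < 1 / (H + 1) := by rw [hk]; exact mul_lt_mul_of_pos_left h hHi
    rcases hθ.eq_or_lt with h0 | h0
    · refine ⟨C, hC, fun x hx S hS => ?_⟩
      have h1 := one_le_of_exp hx
      rw [Rgen, if_neg (by linarith), if_neg (by linarith), ← h0]
      simpa using hc x (by linarith) S hS
    · obtain ⟨C', hC', ht⟩ := ps_init (mul_pos hHi h0) e hf hc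
      refine ⟨C', hC', fun x hx S hS => ?_⟩
      have h1 := one_le_of_exp hx
      have := ht x h1 S hS
      rw [Rgen, if_neg (by linarith), if_neg (by linarith)]
      calc _ ≤ x ^ ((1 / H) * θ) * (C' * x ^ (1 / (H + 1) - (1 / H) * θ)) :=
            mul_le_mul_of_nonneg_left this (Real.rpow_nonneg (by linarith) _)
        _ = C' * (x ^ ((1 / H) * θ) * x ^ (1 / (H + 1) - (1 / H) * θ)) := by ring
        _ = _ := by rw [← Real.rpow_add (by linarith)]; congr 2; ring

lemma main_estimate {f : Q → ℝ} {C H θ κ D : ℝ} {cnt : ℝ → ℝ} (hH : 0 < H) (hθ : 0 ≤ θ) (hD : 0 ≤ D)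
    (hf : ∀ q, 1 ≤ f q)
    (hc : ∀ Y : ℝ, 0 < Y → ∀ F : Finset Q, (∀ q ∈ F, f q ≤ Y) → (F.card : ℝ) ≤ C * Y ^ (1 / (H + 1)))
    (hcnt : ∀ X : ℝ, 1 ≤ X → |cnt X - κ * X| ≤ D * X ^ θ) :
    ∃ E : ℝ, ∀ x : ℝ, Real.exp 1 ≤ x → ∀ S : Finset Q, (∀ q, q ∈ S ↔ f q ≤ x) →
      |∑ q ∈ S, cnt ((x / f q) ^ (1 / H)) - κ * (∑' q, f q ^ (-(1 / H))) * x ^ (1 / H)| ≤ E * Rgen H θ x := by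
  have hC := ps_C_nonneg hc
  have hHi : 0 < 1 / H := by positivity
  have hlt : 1 / (H + 1) < 1 / H := one_div_lt_one_div_of_lt hH (by linarith)
  obtain ⟨E1, hE1, h1⟩ := err_sum hH hθ hf hc
  obtain ⟨C2, hC2, h2⟩ := ps_tail hHi hlt hc
  have hs := ps_summable hHi hlt one_pos hf hc
  refine ⟨D * E1 + |κ| * C2, fun x hx S hS => ?_⟩
  have hx1 := one_le_of_exp hx
  have hx0 : 0 < x := by linarith
  have hf0 : ∀ q, 0 < f q := fun q => one_pos.trans_le (hf q)
  set Tt := ∑' q, f q ^ (-(1 / H)) with hTt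
  have hpt : ∀ q ∈ S, |cnt ((x / f q) ^ (1 / H)) - κ * (x ^ (1 / H) * f q ^ (-(1 / H)))| ≤
      D * (x ^ ((1 / H) * θ) * f q ^ (-((1 / H) * θ))) := by
    intro q hq
    have hq1 : 1 ≤ x / f q := by rw [le_div_iff₀ (hf0 q), one_mul]; exact (hS q).1 hq
    have h3 := hcnt ((x / f q) ^ (1 / H)) (Real.one_le_rpow hq1 hHi.le)
    rw [← Real.rpow_mul (by linarith)] at h3
    have e : ∀ a : ℝ, (x / f q) ^ a = x ^ a * f q ^ (-a) := fun a => by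
      rw [Real.div_rpow hx0.le (hf0 q).le, Real.rpow_neg (hf0 q).le]; rfl
    rw [e ((1/H) * θ)] at h3
    rw [← e (1/H)]
    exact h3
  have hA : |∑ q ∈ S, cnt ((x / f q) ^ (1 / H)) - κ * x ^ (1 / H) * ∑ q ∈ S, f q ^ (-(1 / H))|
      ≤ D * (E1 * Rgen H θ x) := by
    rw [Finset.mul_sum, ← Finset.sum_sub_distrib]
    refine (Finset.abs_sum_le_sum_abs _ _).trans ?_
    calc _ ≤ ∑ q ∈ S, D * (x ^ ((1 / H) * θ) * f q ^ (-((1 / H) * θ))) :=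
          Finset.sum_le_sum fun q hq => by rw [mul_assoc]; exact hpt q hq
      _ = D * (x ^ ((1 / H) * θ) * ∑ q ∈ S, f q ^ (-((1 / H) * θ))) := by
          rw [Finset.mul_sum, Finset.mul_sum]
      _ ≤ _ := mul_le_mul_of_nonneg_left (h1 x hx S fun q hq => (hS q).1 hq) hD
  have hB1 : ∑ q ∈ S, f q ^ (-(1 / H)) ≤ Tt :=
    hs.sum_le_tsum _ (fun q _ => (Real.rpow_pos_of_pos (hf0 q) _).le)
  have hB2 : Tt ≤ ∑ q ∈ S, f q ^ (-(1 / H)) + C2 * x ^ (1 / (H + 1) - 1 / H) := by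
    classical
    refine hs.tsum_le_of_sum_le fun F => ?_
    rw [← Finset.sum_inter_add_sum_sdiff F S]
    refine add_le_add (Finset.sum_le_sum_of_subset_of_nonneg Finset.inter_subset_right
      (fun q _ _ => (Real.rpow_pos_of_pos (hf0 q) _).le)) (h2 x hx0 _ fun q hq => ?_)
    have := (Finset.mem_sdiff.1 hq).2
    rw [hS] at this
    linarith
  have hB : |κ * x ^ (1 / H) * ∑ q ∈ S, f q ^ (-(1 / H)) - κ * Tt * x ^ (1 / H)|
      ≤ |κ| * (C2 * Rgen H θ x) := by
    have e : κ * x ^ (1 / H) * ∑ q ∈ S, f q ^ (-(1 / H)) - κ * Tt * x ^ (1 / H)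
      = κ * (x ^ (1 / H) * (∑ q ∈ S, f q ^ (-(1 / H)) - Tt)) := by ring
    rw [e, abs_mul]
    refine mul_le_mul_of_nonneg_left ?_ (abs_nonneg _)
    rw [abs_mul, abs_of_pos (Real.rpow_pos_of_pos hx0 _), abs_sub_comm, abs_of_nonneg (by linarith)]
    calc _ ≤ x ^ (1 / H) * (C2 * x ^ (1 / (H + 1) - 1 / H)) :=
          mul_le_mul_of_nonneg_left (by linarith) (Real.rpow_nonneg hx0.le _)
      _ = C2 * (x ^ (1 / H) * x ^ (1 / (H + 1) - 1 / H)) := by ring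
      _ = C2 * x ^ (1 / (H + 1)) := by rw [← Real.rpow_add hx0]; congr 2; ring
      _ ≤ _ := mul_le_mul_of_nonneg_left (Rgen_ge hH hx) hC2
  calc _ ≤ _ := abs_sub_le _ (κ * x ^ (1 / H) * ∑ q ∈ S, f q ^ (-(1 / H))) _
    _ ≤ _ := add_le_add hA hB
    _ = _ := by ring

end

end Landau
end

section
open Filter Topology MeasureTheory Set
open scoped BigOperators

namespace Landau

open NumberField NumberField.InfinitePlace nonZeroDivisors
open NumberField.Units

section
variable {K : Type} [Field K] [NumberField K]

/-- the norm of a nonzero ideal as a real number -/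
noncomputable def nI (I : (Ideal (𝓞 K))⁰) : ℝ := (Ideal.absNorm (I : Ideal (𝓞 K)) : ℝ)

lemma nI_count : ∃ C : ℝ, ∀ Y : ℝ, 0 < Y → ∀ F : Finset (Ideal (𝓞 K))⁰, (∀ q ∈ F, nI q ≤ Y) →
    (F.card : ℝ) ≤ C * Y ^ (1:ℝ) := by
  obtain ⟨C, -, hC⟩ := ideal_count_bound (K := K)
  refine ⟨C, fun Y hY F hF => ?_⟩
  rw [Real.rpow_one]
  refine le_trans ?_ (hC Y hY)
  have := fin_ideals (K := K) Y
  have h2 := Nat.card_le_card_of_injective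
    (fun q : F => (⟨q.1, hF q.1 q.2⟩ : {I : (Ideal (𝓞 K))⁰ // (Ideal.absNorm (I : Ideal (𝓞 K)) : ℝ) ≤ Y}))
    (fun p q h => Subtype.ext (congrArg (fun z => z.1) h))
  rw [Nat.card_eq_fintype_card, Fintype.card_coe] at h2
  exact_mod_cast h2

/-- exponents -/
noncomputable def ex (m : ℕ) (i : Fin (m + 1)) : ℝ := ((m + 2 + (i + 1) : ℕ) : ℝ)

lemma zeta_eq (s : ℝ) : ∑' I : (Ideal (𝓞 K))⁰, nI I ^ (-s) = zetaKR K s := by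
  unfold zetaKR
  rw [← (Equiv.subtypeEquivRight (p := fun I : Ideal (𝓞 K) => I ∈ (Ideal (𝓞 K))⁰) (q := fun I => I ≠ 0)
    (fun _ => mem_nonZeroDivisors_iff_ne_zero)).tsum_eq]
  rfl

lemma zeta_prod (m : ℕ) :
    ∏ i : Fin (m+1), ∑' I : (Ideal (𝓞 K))⁰, nI I ^ (-(ex m i * (1 / ((m + 2 : ℕ) : ℝ)))) =
      ∏ i ∈ Finset.Icc 1 (m + 2 - 1), zetaKR K (1 + (i : ℝ) / ((m + 2 : ℕ) : ℝ)) := by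
  have e1 : Finset.Icc 1 (m + 2 - 1) = Finset.Ico 1 (m + 2) := by ext i; simp; omega
  rw [e1, Finset.prod_Ico_eq_prod_range, show m + 2 - 1 = m + 1 by omega, Finset.prod_range]
  refine Finset.prod_congr rfl fun i _ => ?_
  rw [zeta_eq]
  congr 1
  unfold ex
  push_cast
  field_simp
  ring

lemma le_root_iff {m : ℕ} {a M x : ℝ} (ha : 0 ≤ a) (hM : 0 < M) (hx : 0 < x) :
    a ≤ (x / M) ^ (1 / ((m + 2 : ℕ) : ℝ)) ↔ a ^ (m + 2) * M ≤ x := by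
  rw [one_div, Real.le_rpow_inv_iff_of_pos ha (by positivity) (by positivity), Real.rpow_natCast,
    le_div_iff₀ hM]

lemma prod_split (m : ℕ) (a : Fin (m + 2) → Ideal (𝓞 K)) (b : Fin (m + 1) → (Ideal (𝓞 K))⁰)
    (hb : ∀ i, a i.succ = b i) :
    ∏ i : Fin (m + 2), (Ideal.absNorm (a i) : ℝ) ^ (m + 2 + (i : ℕ)) =
      (Ideal.absNorm (a 0) : ℝ) ^ (m + 2) * wM nI (ex m) b := by
  rw [Fin.prod_univ_succ]
  unfold wM ex nI
  simp only [Fin.val_zero, add_zero, Fin.val_succ, Real.rpow_natCast, hb]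

lemma wM_pos (m : ℕ) (b : Fin (m + 1) → (Ideal (𝓞 K))⁰) : 1 ≤ wM nI (ex m) b :=
  wM_one_le one_le_absNorm (fun i => by unfold ex; positivity) b

lemma Th_eq (m : ℕ) {x : ℝ} (hx : 1 ≤ x) (S : Finset (Fin (m + 1) → (Ideal (𝓞 K))⁰))
    (hS : ∀ q, q ∈ S ↔ wM nI (ex m) q ≤ x) :
    Th K (m + 2) x = ∑ q ∈ S, cntI K ((x / wM nI (ex m) q) ^ (1 / ((m + 2 : ℕ) : ℝ))) := by
  have hx0 : 0 < x := by linarith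
  let E : {a : Fin (m + 2) → Ideal (𝓞 K) // (∀ i, a i ≠ 0) ∧
      (∏ i : Fin (m + 2), (Ideal.absNorm (a i) : ℝ) ^ (m + 2 + (i : ℕ))) ≤ x} ≃
      Σ q : S, {I : (Ideal (𝓞 K))⁰ // (Ideal.absNorm (I : Ideal (𝓞 K)) : ℝ) ≤
        (x / wM nI (ex m) q.1) ^ (1 / ((m + 2 : ℕ) : ℝ))} :=
    { toFun := fun a => 
        ⟨⟨fun i => ⟨a.1 i.succ, mem_nonZeroDivisors_iff_ne_zero.2 (a.2.1 _)⟩, by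
          rw [hS]
          have h := a.2.2
          rw [prod_split m a.1 (fun i => ⟨a.1 i.succ, mem_nonZeroDivisors_iff_ne_zero.2 (a.2.1 _)⟩)
            (fun i => rfl)] at h
          refine le_trans (le_mul_of_one_le_left (zero_le_one.trans (wM_pos m _)) ?_) h
          exact one_le_pow₀ (one_le_absNorm ⟨a.1 0, mem_nonZeroDivisors_iff_ne_zero.2 (a.2.1 _)⟩)⟩,
          ⟨⟨a.1 0, mem_nonZeroDivisors_iff_ne_zero.2 (a.2.1 _)⟩, by
            rw [le_root_iff (by positivity) (one_pos.trans_le (wM_pos m _)) hx0]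
            have h := a.2.2
            rwa [prod_split m a.1 (fun i => ⟨a.1 i.succ, mem_nonZeroDivisors_iff_ne_zero.2 (a.2.1 _)⟩)
              (fun i => rfl)] at h⟩⟩
      invFun := fun p => ⟨Fin.cons (p.2.1 : Ideal (𝓞 K)) (fun i => (p.1.1 i : Ideal (𝓞 K))), by
          refine ⟨fun i => ?_, ?_⟩
          · refine Fin.cases ?_ (fun i => ?_) i
            · exact mem_nonZeroDivisors_iff_ne_zero.1 p.2.1.2
            · exact mem_nonZeroDivisors_iff_ne_zero.1 (p.1.1 i).2
          · rw [prod_split m _ p.1.1 (fun i => rfl)]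
            exact (le_root_iff (by positivity) (one_pos.trans_le (wM_pos m _)) hx0).1 p.2.2⟩
      left_inv := fun a => by
        refine Subtype.ext (funext fun i => ?_)
        refine Fin.cases ?_ (fun i => ?_) i <;> rfl
      right_inv := fun p => rfl }
  have hfin : ∀ q : S, Finite {I : (Ideal (𝓞 K))⁰ // (Ideal.absNorm (I : Ideal (𝓞 K)) : ℝ) ≤
        (x / wM nI (ex m) q.1) ^ (1 / ((m + 2 : ℕ) : ℝ))} := fun q => fin_ideals _
  unfold Th
  rw [Nat.card_congr E, Nat.card_sigma]
  exact Finset.sum_coe_sort S (fun q => cntI K ((x / wM nI (ex m) q) ^ (1 / ((m + 2 : ℕ) : ℝ))))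

lemma finite_of_count {Q : Type} {f : Q → ℝ} {x B : ℝ}
    (hc : ∀ F : Finset Q, (∀ q ∈ F, f q ≤ x) → (F.card : ℝ) ≤ B) : {q | f q ≤ x}.Finite := by
  by_contra h
  obtain ⟨F, hF, hcard⟩ := Set.Infinite.exists_subset_card_eq h (⌊B⌋₊ + 1)
  have h1 := hc F fun q hq => hF hq
  rw [hcard] at h1
  have := Nat.lt_floor_add_one B
  push_cast at h1
  linarith

lemma final_bound (m : ℕ) : ∃ E : ℝ, ∀ x : ℝ, Real.exp 1 ≤ x →
    |(Th K (m + 2) x : ℝ) - kappa K * (∏ i ∈ Finset.Icc 1 (m + 2 - 1), zetaKR K (1 + (i : ℝ) / ((m + 2 : ℕ) : ℝ))) *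
      x ^ (1 / ((m + 2 : ℕ) : ℝ))| ≤
      E * Rgen ((m + 2 : ℕ) : ℝ) (1 - 2 / ((Module.finrank ℚ K : ℝ) + 1)) x := by
  obtain ⟨C, hC⟩ := nI_count (K := K)
  have hN : ∀ I : (Ideal (𝓞 K))⁰, 1 ≤ nI I := one_le_absNorm
  obtain ⟨C', hC'⟩ := wM_count hN hC (ex m) (by unfold ex; positivity) (fun i => by
    unfold ex
    rw [Fin.val_succ, Fin.val_zero]
    norm_cast
    omega)
  have hex0 : ex m 0 = ((m + 2 : ℕ) : ℝ) + 1 := by unfold ex; simp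
  rw [hex0] at hC'
  obtain ⟨D, hD, hL⟩ := landau (K := K)
  have hn : (1:ℝ) ≤ Module.finrank ℚ K := by exact_mod_cast Module.finrank_pos (R := ℚ) (M := K)
  have hθ : 0 ≤ 1 - 2 / ((Module.finrank ℚ K : ℝ) + 1) := by
    rw [sub_nonneg, div_le_one (by linarith)]; linarith
  have hκ : kappa K = (2 ^ nrRealPlaces K * (2 * Real.pi) ^ nrComplexPlaces K * regulator K * classNumber K) /
      (torsionOrder K * Real.sqrt |(discr K : ℝ)|) := by
    unfold kappa
    congr 1; ring
  have hsum := wM_hasSum hN hC (ex m) (1 / ((m + 2 : ℕ) : ℝ)) (fun i => by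
    rw [mul_one_div, lt_div_iff₀ (by positivity), one_mul]
    unfold ex
    norm_cast
    omega)
  obtain ⟨E, hE⟩ := main_estimate (f := wM nI (ex m)) (H := ((m + 2 : ℕ) : ℝ)) (κ := kappa K)
    (cnt := fun s => (cntI K s : ℝ)) (by positivity) hθ hD (wM_pos m) hC' (fun X hX => by rw [hκ]; exact hL X hX)
  refine ⟨E, fun x hx => ?_⟩
  have hx1 := one_le_of_exp hx
  have hfin := finite_of_count (hC' x (by linarith))
  have hmem : ∀ q, q ∈ hfin.toFinset ↔ wM nI (ex m) q ≤ x := fun q => by simp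
  have h := hE x hx hfin.toFinset hmem
  rw [hsum.tsum_eq, zeta_prod] at h
  rw [Th_eq m hx1 hfin.toFinset hmem]
  push_cast at h ⊢
  exact h

end

end Landau
end

/-- `T_h(x) = κ (∏_{i=1}^{h-1} ζ_K(1 + i/h)) x^{1/h} + O_h(R_{T_h}(x))`. -/
theorem count_weighted_tuples (h : ℕ) (hh : 2 ≤ h) :
    (fun x : ℝ => (Th K h x : ℝ) -
        kappa K * (∏ i ∈ Finset.Icc 1 (h - 1), zetaKR K (1 + (i : ℝ)/h)) *
          x ^ ((1 : ℝ)/h))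
      =O[atTop] fun x : ℝ => RTh K h x := by
  obtain ⟨m, rfl⟩ : ∃ m, h = m + 2 := ⟨h - 2, by omega⟩
  obtain ⟨E, hE⟩ := Landau.final_bound (K := K) m
  refine Asymptotics.IsBigO.of_bound E ?_
  filter_upwards [eventually_ge_atTop (Real.exp 1)] with x hx
  have hR : RTh K (m + 2) x =
      Landau.Rgen ((m + 2 : ℕ) : ℝ) (1 - 2 / ((Module.finrank ℚ K : ℝ) + 1)) x := rfl
  have hpos : 0 ≤ RTh K (m + 2) x := by
    rw [hR]
    exact (Real.rpow_nonneg ((Real.exp_pos 1).le.trans hx) _).trans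
      (Landau.Rgen_ge (by positivity) hx)
  rw [Real.norm_eq_abs, Real.norm_eq_abs, abs_of_nonneg hpos, hR]
  exact hE x hx

end
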